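/- Assume that for all sufficiently large n the mismatched matrix-MSE sequence (MSE_n)_{n≥1} converges uniformly in (λ,λ') on a compact set K ⊂ ℝ₊². Then for all σ, σ' > 0 and (λ,λ') ∈ K, lim_{n→∞} MSE_n(σ,σ',λ,λ') equals: σ⁴ + (1/√λ' − 1/(λ'σ'²))² if λ ≤ 1/σ⁴ and λ' ≥ 1/σ'⁴; σ⁴(1−√(λ/λ'))² + 2/√(λλ') + 1/(λ'²σ'⁴) + (2σ²/(λ'σ'²))(1−√(λ/λ')) − 2/(λλ'σ²σ'²) if λ ≥ 1/σ⁴ and √(λλ') ≥ 1/(σ²σ'²); and σ⁴ otherwise. -/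

import Mathlib

open MeasureTheory ProbabilityTheory Filter Matrix

noncomputable section

instance {n : ℕ} : MeasurableSpace (Matrix (Fin n) (Fin n) ℝ) :=
  inferInstanceAs (MeasurableSpace (Fin n → Fin n → ℝ))

/-- Squared Frobenius norm of a matrix. -/
def frobSq {n : ℕ} (M : Matrix (Fin n) (Fin n) ℝ) : ℝ := ∑ i, ∑ j, (M i j) ^ 2

/-- i.i.d. centered Gaussian prior with variance `v` on `ℝⁿ`. -/
def gaussPrior (n : ℕ) (v : ℝ) : Measure (Fin n → ℝ) :=
  Measure.pi fun _ => gaussianReal 0 (Real.toNNReal v)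

/-- Law of the symmetric noise matrix `Z`: independent `N(0,1)` entries above the
diagonal and `N(0,2)` entries on the diagonal, extended symmetrically. -/
def noiseMeasure (n : ℕ) : Measure (Matrix (Fin n) (Fin n) ℝ) :=
  (Measure.pi fun p : Fin n × Fin n =>
      gaussianReal 0 (if p.1 = p.2 then 2 else 1)).map
    (fun g => Matrix.of fun i j => if i ≤ j then g (i, j) else g (j, i))

/-- Observation matrix `Y = √(λ/n) s sᵀ + Z`. -/
def obs (n : ℕ) (lam : ℝ) (s : Fin n → ℝ) (Z : Matrix (Fin n) (Fin n) ℝ) :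
    Matrix (Fin n) (Fin n) ℝ :=
  Real.sqrt (lam / n) • Matrix.vecMulVec s s + Z

/-- Posterior weight `exp(−¼‖Y−√(λ'/n) x xᵀ‖_F²)`. -/
def weight (n : ℕ) (lam' : ℝ) (Y : Matrix (Fin n) (Fin n) ℝ) (x : Fin n → ℝ) : ℝ :=
  Real.exp (-(1 / 4) * frobSq (Y - Real.sqrt (lam' / n) • Matrix.vecMulVec x x))

/-- Gibbs (mismatched posterior) average `⟨f(x)⟩_{λ',σ'}` of an observable `f`. -/
def gibbs (n : ℕ) (sig' lam' : ℝ) (Y : Matrix (Fin n) (Fin n) ℝ)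
    (f : (Fin n → ℝ) → ℝ) : ℝ :=
  (∫ x, f x * weight n lam' Y x ∂gaussPrior n (sig' ^ 2)) /
    (∫ x, weight n lam' Y x ∂gaussPrior n (sig' ^ 2))

/-- Posterior mean matrix `⟨x xᵀ⟩_{λ',σ'}`. -/
def gibbsMatrix (n : ℕ) (sig' lam' : ℝ) (Y : Matrix (Fin n) (Fin n) ℝ) :
    Matrix (Fin n) (Fin n) ℝ :=
  Matrix.of fun i j => gibbs n sig' lam' Y (fun x => x i * x j)

/-- Mismatched matrix-MSE `MSE_n(σ,σ',λ,λ')`. -/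
def MSE (n : ℕ) (sig sig' lam lam' : ℝ) : ℝ :=
  (1 / (n : ℝ) ^ 2) *
    ∫ p, frobSq (Matrix.vecMulVec p.1 p.1 -
        gibbsMatrix n sig' lam' (obs n lam p.1 p.2))
      ∂((gaussPrior n (sig ^ 2)).prod (noiseMeasure n))

/-- The limiting mismatched MSE formula, eq. (4) of the paper. -/
def MSElim (sig sig' lam lam' : ℝ) : ℝ :=
  if lam ≤ 1 / sig ^ 4 ∧ 1 / sig' ^ 4 ≤ lam' then
    sig ^ 4 + (1 / Real.sqrt lam' - 1 / (lam' * sig' ^ 2)) ^ 2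
  else if 1 / sig ^ 4 ≤ lam ∧ 1 / (sig ^ 2 * sig' ^ 2) ≤ Real.sqrt (lam * lam') then
    sig ^ 4 * (1 - Real.sqrt (lam / lam')) ^ 2 + 2 / Real.sqrt (lam * lam') +
      1 / (lam' ^ 2 * sig' ^ 4) +
      (2 * sig ^ 2 / (lam' * sig' ^ 2)) * (1 - Real.sqrt (lam / lam')) -
      2 / (lam * lam' * sig ^ 2 * sig' ^ 2)
  else sig ^ 4

section

lemma sum_symm_noise {n : ℕ} (M : Matrix (Fin n) (Fin n) ℝ) (g : Fin n × Fin n → ℝ) :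
    ∑ i, ∑ j, M i j * (if i ≤ j then g (i, j) else g (j, i)) =
      ∑ p : Fin n × Fin n, (if p.1 < p.2 then M p.1 p.2 + M p.2 p.1
        else if p.1 = p.2 then M p.1 p.2 else 0) * g p := by
  have h1 : ∑ i, ∑ j, M i j * (if i ≤ j then g (i, j) else g (j, i)) =
      ∑ i, ∑ j, M i j * (if i ≤ j then g (i, j) else 0) +
      ∑ i, ∑ j, M i j * (if i ≤ j then 0 else g (j, i)) := by
    rw [← Finset.sum_add_distrib]
    refine Finset.sum_congr rfl fun i _ => ?_
    rw [← Finset.sum_add_distrib]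
    refine Finset.sum_congr rfl fun j _ => ?_
    split_ifs <;> ring
  rw [h1, Finset.sum_comm (f := fun i j => M i j * (if i ≤ j then 0 else g (j, i))),
    ← Finset.sum_add_distrib, Fintype.sum_prod_type]
  refine Finset.sum_congr rfl fun i _ => ?_
  rw [← Finset.sum_add_distrib]
  refine Finset.sum_congr rfl fun j _ => ?_
  rcases lt_trichotomy i j with h | h | h
  · simp [h, h.le, h.not_ge]; ring
  · subst h; simp
  · simp [h.not_ge, h.le, h.not_gt, h.ne']

lemma sum_symm_sq {n : ℕ} (M : Matrix (Fin n) (Fin n) ℝ) :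
    ∑ p : Fin n × Fin n, ((if p.1 = p.2 then 2 else 1 : NNReal) : ℝ) *
      (if p.1 < p.2 then M p.1 p.2 + M p.2 p.1 else if p.1 = p.2 then M p.1 p.2 else 0) ^ 2 / 2
      = (1 / 4) * ∑ i, ∑ j, (M i j + M j i) ^ 2 := by
  rw [Fintype.sum_prod_type]
  set h : Fin n → Fin n → ℝ := fun i j => ((if i = j then 2 else 1 : NNReal) : ℝ) *
      (if i < j then M i j + M j i else if i = j then M i j else 0) ^ 2 / 2 with hh
  have h2 : ∑ i, ∑ j, h i j + ∑ i, ∑ j, h i j = (1/2) * ∑ i, ∑ j, (M i j + M j i) ^ 2 := by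
    rw [show ∑ i, ∑ j, h i j + ∑ i, ∑ j, h i j = ∑ i, ∑ j, h i j + ∑ i, ∑ j, h j i from
      congrArg _ Finset.sum_comm]
    rw [← Finset.sum_add_distrib, Finset.mul_sum]
    refine Finset.sum_congr rfl fun i _ => ?_
    rw [← Finset.sum_add_distrib, Finset.mul_sum]
    refine Finset.sum_congr rfl fun j _ => ?_
    rcases lt_trichotomy i j with h | h | h
    · simp [hh, h, h.ne, h.ne', h.not_gt]; ring
    · subst h; simp [hh]; ring
    · simp [hh, h, h.ne, h.ne', h.not_gt]; ring
  linarith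

lemma measurable_symmMap (n : ℕ) : Measurable (fun g : Fin n × Fin n → ℝ =>
    (Matrix.of fun i j => if i ≤ j then g (i, j) else g (j, i) : Matrix (Fin n) (Fin n) ℝ)) := by
  refine measurable_pi_lambda _ fun i => measurable_pi_lambda _ fun j => ?_
  by_cases h : i ≤ j
  · simpa [h] using measurable_pi_apply (i, j)
  · simpa [h] using measurable_pi_apply (j, i)

instance (n : ℕ) : IsProbabilityMeasure (noiseMeasure n) :=
  Measure.isProbabilityMeasure_map (measurable_symmMap n).aemeasurable

instance (n : ℕ) (v : ℝ) : IsProbabilityMeasure (gaussPrior n v) := by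
  unfold gaussPrior; infer_instance

lemma measurable_entry {n : ℕ} (i j : Fin n) :
    Measurable (fun Z : Matrix (Fin n) (Fin n) ℝ => Z i j) :=
  (measurable_pi_apply j).comp (measurable_pi_apply i)

lemma measurable_matrix {n : ℕ} {α : Type*} [MeasurableSpace α]
    {f : α → Matrix (Fin n) (Fin n) ℝ} (h : ∀ i j, Measurable fun a => f a i j) : Measurable f :=
  measurable_pi_lambda _ fun i => measurable_pi_lambda _ fun j => h i j

lemma noise_char (n : ℕ) (M : Matrix (Fin n) (Fin n) ℝ) :
    ∫ Z, Complex.exp (((∑ i, ∑ j, M i j * Z i j : ℝ) : ℂ) * Complex.I) ∂noiseMeasure n =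
      Complex.exp (((-((1 / 4) * ∑ i, ∑ j, (M i j + M j i) ^ 2) : ℝ) : ℂ)) := by
  unfold noiseMeasure
  rw [integral_map (measurable_symmMap n).aemeasurable]
  · simp only [Matrix.of_apply, sum_symm_noise]
    rw [← sum_symm_sq]
    push_cast
    simp only [Finset.sum_mul, Complex.exp_sum]
    rw [integral_fintype_prod_eq_prod (𝕜 := ℂ) (f := fun (p : Fin n × Fin n) (x : ℝ) => Complex.exp
      (((if p.1 < p.2 then M p.1 p.2 + M p.2 p.1 else if p.1 = p.2 then M p.1 p.2 else 0 : ℝ) : ℂ)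
        * x * Complex.I)),
      ← Finset.sum_neg_distrib, Complex.exp_sum]
    refine Finset.prod_congr rfl fun p _ => ?_
    have := charFun_gaussianReal (μ := 0) (v := if p.1 = p.2 then 2 else 1)
      (if p.1 < p.2 then M p.1 p.2 + M p.2 p.1 else if p.1 = p.2 then M p.1 p.2 else 0)
    rw [charFun_apply_real] at this
    rw [this]
    congr 1
    simp
  · apply Measurable.aestronglyMeasurable
    apply Complex.measurable_exp.comp
    apply Measurable.mul_const
    apply Complex.measurable_ofReal.comp
    exact Finset.measurable_sum _ fun i _ => Finset.measurable_sum _ fun j _ =>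
      (measurable_entry i j).const_mul _

lemma pi_meas_ext {n : ℕ} (μ ν : Measure (Fin n → Fin n → ℝ)) [IsFiniteMeasure μ]
    [IsFiniteMeasure ν]
    (h : ∀ M : Fin n → Fin n → ℝ,
      ∫ Z, Complex.exp (((∑ i, ∑ j, M i j * Z i j : ℝ) : ℂ) * Complex.I) ∂μ =
      ∫ Z, Complex.exp (((∑ i, ∑ j, M i j * Z i j : ℝ) : ℂ) * Complex.I) ∂ν) : μ = ν := by
  refine Measure.ext_of_charFunDual ?_
  ext L
  rw [charFunDual_apply, charFunDual_apply]
  have hL : ∀ Z : Fin n → Fin n → ℝ, L Z = ∑ i, ∑ j, L (Pi.single i (Pi.single j 1)) * Z i j := by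
    intro Z
    have : Z = ∑ i, ∑ j, Z i j • (Pi.single i (Pi.single j (1:ℝ)) : Fin n → Fin n → ℝ) := by
      ext a b
      simp only [Finset.sum_apply, Pi.smul_apply, smul_eq_mul]
      rw [Finset.sum_eq_single a, Finset.sum_eq_single b]
      · simp [Pi.single_apply]
      · intro c _ hc
        simp [hc.symm]
      · simp
      · intro c _ hc
        simp [hc.symm]
      · simp
    conv_lhs => rw [this]
    simp only [map_sum, map_smul, smul_eq_mul]
    refine Finset.sum_congr rfl fun i _ => Finset.sum_congr rfl fun j _ => mul_comm _ _
  have := h (fun i j => L (Pi.single i (Pi.single j 1)))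
  simpa only [← hL] using this

lemma matrix_meas_ext {n : ℕ} (μ ν : Measure (Matrix (Fin n) (Fin n) ℝ)) [hμ : IsFiniteMeasure μ]
    [hν : IsFiniteMeasure ν]
    (h : ∀ M : Matrix (Fin n) (Fin n) ℝ,
      ∫ Z, Complex.exp (((∑ i, ∑ j, M i j * Z i j : ℝ) : ℂ) * Complex.I) ∂μ =
      ∫ Z, Complex.exp (((∑ i, ∑ j, M i j * Z i j : ℝ) : ℂ) * Complex.I) ∂ν) : μ = ν :=
  @pi_meas_ext n μ ν hμ hν h
end

section

instance {n : ℕ} : BorelSpace (Matrix (Fin n) (Fin n) ℝ) :=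
  inferInstanceAs (BorelSpace (Fin n → Fin n → ℝ))
instance {n : ℕ} : SecondCountableTopology (Matrix (Fin n) (Fin n) ℝ) :=
  inferInstanceAs (SecondCountableTopology (Fin n → Fin n → ℝ))

lemma sum_mul_eq_trace {n : ℕ} (A B : Matrix (Fin n) (Fin n) ℝ) :
    ∑ i, ∑ j, A i j * B i j = (Aᵀ * B).trace := by
  simp only [Matrix.trace, Matrix.diag, Matrix.mul_apply, Matrix.transpose_apply]
  exact Finset.sum_comm

lemma measurable_conj {n : ℕ} (O : Matrix (Fin n) (Fin n) ℝ) :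
    Measurable (fun Z : Matrix (Fin n) (Fin n) ℝ => Oᵀ * Z * O) := by
  apply Continuous.measurable
  fun_prop

lemma noise_rotate {n : ℕ} (O : Matrix (Fin n) (Fin n) ℝ) (hO : Oᵀ * O = 1) :
    (noiseMeasure n).map (fun Z => Oᵀ * Z * O) = noiseMeasure n := by
  haveI : IsProbabilityMeasure ((noiseMeasure n).map (fun Z => Oᵀ * Z * O)) :=
    Measure.isProbabilityMeasure_map (measurable_conj O).aemeasurable
  refine matrix_meas_ext _ _ fun M => ?_
  rw [integral_map (measurable_conj O).aemeasurable, noise_char]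
  · have h1 : ∀ Z : Matrix (Fin n) (Fin n) ℝ, ∑ i, ∑ j, M i j * (Oᵀ * Z * O) i j =
        ∑ i, ∑ j, (O * M * Oᵀ) i j * Z i j := by
      intro Z
      rw [sum_mul_eq_trace, sum_mul_eq_trace, ← Matrix.mul_assoc, Matrix.trace_mul_comm]
      simp [Matrix.transpose_mul, Matrix.mul_assoc]
    simp only [h1]
    rw [noise_char]
    congr 4
    have h2 : ∀ A : Matrix (Fin n) (Fin n) ℝ, ∑ i, ∑ j, (A i j + A j i) ^ 2 =
        ((A + Aᵀ)ᵀ * (A + Aᵀ)).trace := by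
      intro A
      rw [← sum_mul_eq_trace]
      simp [pow_two]
    rw [h2, h2]
    have h3 : O * M * Oᵀ + (O * M * Oᵀ)ᵀ = O * (M + Mᵀ) * Oᵀ := by
      simp [Matrix.transpose_mul, Matrix.mul_assoc, Matrix.mul_add, Matrix.add_mul]
    rw [h3]
    have h4 : (O * (M + Mᵀ) * Oᵀ)ᵀ * (O * (M + Mᵀ) * Oᵀ) = O * ((M + Mᵀ)ᵀ * (Oᵀ * O) * (M + Mᵀ) * Oᵀ) := by
      simp only [Matrix.transpose_mul, Matrix.transpose_transpose, Matrix.mul_assoc]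
    rw [h4, hO, Matrix.trace_mul_comm, Matrix.mul_one, Matrix.mul_assoc, hO, Matrix.mul_one]
  · apply Measurable.aestronglyMeasurable
    apply Complex.measurable_exp.comp
    apply Measurable.mul_const
    apply Complex.measurable_ofReal.comp
    exact Finset.measurable_sum _ fun i _ => Finset.measurable_sum _ fun j _ =>
      (measurable_entry i j).const_mul _

/-- Bordered matrix. -/
def blk {k : ℕ} (d : ℝ) (w : Fin k → ℝ) (Z : Matrix (Fin k) (Fin k) ℝ) :
    Matrix (Fin (k+1)) (Fin (k+1)) ℝ :=
  Matrix.of (Fin.cons (Fin.cons d w) (fun i => Fin.cons (w i) (Z i)))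

lemma measurable_blk (k : ℕ) : Measurable
    (fun p : ℝ × (Fin k → ℝ) × Matrix (Fin k) (Fin k) ℝ => blk p.1 p.2.1 p.2.2) := by
  refine measurable_matrix fun i j => ?_
  refine Fin.cases ?_ (fun i => ?_) i <;> refine Fin.cases ?_ (fun j => ?_) j <;>
    simp only [blk, Matrix.of_apply, Fin.cons_zero, Fin.cons_succ]
  · exact measurable_fst
  · exact (measurable_pi_apply j).comp (measurable_fst.comp measurable_snd)
  · exact (measurable_pi_apply i).comp (measurable_fst.comp measurable_snd)
  · exact (measurable_entry i j).comp (measurable_snd.comp measurable_snd)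

lemma gaussPrior_char (k : ℕ) (c : Fin k → ℝ) :
    ∫ w, Complex.exp (((∑ j, c j * w j : ℝ) : ℂ) * Complex.I) ∂gaussPrior k 1 =
      Complex.exp (((-((1 / 2) * ∑ j, (c j) ^ 2) : ℝ) : ℂ)) := by
  unfold gaussPrior
  push_cast
  simp only [Finset.sum_mul, Complex.exp_sum]
  rw [integral_fintype_prod_eq_prod (𝕜 := ℂ) (f := fun (p : Fin k) (x : ℝ) => Complex.exp
      ((c p : ℂ) * x * Complex.I)), Finset.mul_sum, ← Finset.sum_neg_distrib, Complex.exp_sum]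
  refine Finset.prod_congr rfl fun p _ => ?_
  have := charFun_gaussianReal (μ := 0) (v := Real.toNNReal 1) (c p)
  rw [charFun_apply_real] at this
  rw [this]
  congr 1
  simp
  ring

lemma noise_blk (k : ℕ) :
    ((gaussianReal 0 2).prod ((gaussPrior k 1).prod (noiseMeasure k))).map
      (fun p : ℝ × (Fin k → ℝ) × Matrix (Fin k) (Fin k) ℝ => blk p.1 p.2.1 p.2.2) =
    noiseMeasure (k+1) := by
  haveI : IsProbabilityMeasure (((gaussianReal 0 2).prod ((gaussPrior k 1).prod (noiseMeasure k))).map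
      (fun p : ℝ × (Fin k → ℝ) × Matrix (Fin k) (Fin k) ℝ => blk p.1 p.2.1 p.2.2)) :=
    Measure.isProbabilityMeasure_map (measurable_blk k).aemeasurable
  refine matrix_meas_ext _ _ fun M => ?_
  rw [integral_map (measurable_blk k).aemeasurable, noise_char]
  · have h1 : ∀ p : ℝ × (Fin k → ℝ) × Matrix (Fin k) (Fin k) ℝ,
        Complex.exp (((∑ i, ∑ j, M i j * (blk p.1 p.2.1 p.2.2) i j : ℝ) : ℂ) * Complex.I) =
        Complex.exp ((((M 0 0 * p.1 : ℝ)) : ℂ) * Complex.I) *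
        (Complex.exp (((∑ j, (M 0 j.succ + M j.succ 0) * p.2.1 j : ℝ) : ℂ) * Complex.I) *
         Complex.exp (((∑ i, ∑ j, (Matrix.of fun i j : Fin k => M i.succ j.succ) i j * p.2.2 i j : ℝ) : ℂ) * Complex.I)) := by
      intro p
      rw [← Complex.exp_add, ← Complex.exp_add, ← add_mul, ← add_mul]
      congr 2
      rw [← Complex.ofReal_add, ← Complex.ofReal_add]
      congr 1
      simp only [Fin.sum_univ_succ, blk, Matrix.of_apply, Fin.cons_zero, Fin.cons_succ,
        Finset.sum_add_distrib, add_mul]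
      ring
    simp only [h1]
    rw [integral_prod_mul (f := fun d : ℝ => Complex.exp ((((M 0 0 * d : ℝ)) : ℂ) * Complex.I))
      (g := fun q : (Fin k → ℝ) × Matrix (Fin k) (Fin k) ℝ =>
        (Complex.exp (((∑ j, (M 0 j.succ + M j.succ 0) * q.1 j : ℝ) : ℂ) * Complex.I) *
         Complex.exp (((∑ i, ∑ j, (Matrix.of fun i j : Fin k => M i.succ j.succ) i j * q.2 i j : ℝ) : ℂ) * Complex.I))),
      integral_prod_mul (f := fun w : Fin k → ℝ =>
        Complex.exp (((∑ j, (M 0 j.succ + M j.succ 0) * w j : ℝ) : ℂ) * Complex.I))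
        (g := fun Z : Matrix (Fin k) (Fin k) ℝ =>
         Complex.exp (((∑ i, ∑ j, (Matrix.of fun i j : Fin k => M i.succ j.succ) i j * Z i j : ℝ) : ℂ) * Complex.I)),
      noise_char, gaussPrior_char]
    have h2 := charFun_gaussianReal (μ := 0) (v := 2) (M 0 0)
    rw [charFun_apply_real] at h2
    have h3 : ∫ d : ℝ, Complex.exp ((((M 0 0 * d : ℝ)) : ℂ) * Complex.I) ∂gaussianReal 0 2 =
        Complex.exp ((-(M 0 0)^2 : ℝ) : ℂ) := by
      push_cast
      rw [h2]; congr 1; simp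
    rw [h3, ← Complex.exp_add, ← Complex.exp_add, ← Complex.ofReal_add, ← Complex.ofReal_add]
    congr 2
    simp only [Fin.sum_univ_succ, Matrix.of_apply, Finset.sum_add_distrib]
    have h5 : ∑ x : Fin k, (M x.succ 0 + M 0 x.succ)^2 = ∑ x : Fin k, (M 0 x.succ + M x.succ 0)^2 :=
      Finset.sum_congr rfl fun x _ => by rw [add_comm]
    rw [h5]
    ring
  · apply Measurable.aestronglyMeasurable
    apply Complex.measurable_exp.comp
    apply Measurable.mul_const
    apply Complex.measurable_ofReal.comp
    exact Finset.measurable_sum _ fun i _ => Finset.measurable_sum _ fun j _ =>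
      (measurable_entry i j).const_mul _

lemma noise_ae_symm (n : ℕ) : ∀ᵐ Z ∂noiseMeasure n, Zᵀ = Z := by
  unfold noiseMeasure
  rw [ae_map_iff (measurable_symmMap n).aemeasurable]
  · refine Filter.Eventually.of_forall fun g => ?_
    ext i j
    simp only [Matrix.transpose_apply, Matrix.of_apply]
    rcases lt_trichotomy i j with h | h | h
    · simp [h.le, h.not_ge]
    · subst h; simp
    · simp [h.le, h.not_ge]
  · exact (isClosed_eq (by fun_prop) continuous_id).measurableSet

/-- integral of `exp (τ x²)` under a Gaussian. -/
lemma integral_exp_sq_gaussian (v : NNReal) (hv : v ≠ 0) (τ : ℝ) (h : 2 * τ * v < 1) :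
    ∫ x, Real.exp (τ * x ^ 2) ∂gaussianReal 0 v = (Real.sqrt (1 - 2 * τ * v))⁻¹ := by
  have hv' : (0:ℝ) < v := lt_of_le_of_ne v.2 (by exact_mod_cast hv.symm)
  rw [integral_gaussianReal_eq_integral_smul hv]
  simp only [gaussianPDFReal, smul_eq_mul, sub_zero]
  have : ∀ x : ℝ, (√(2 * Real.pi * v))⁻¹ * Real.exp (-x ^ 2 / (2 * v)) * Real.exp (τ * x ^ 2) =
      (√(2 * Real.pi * v))⁻¹ * Real.exp (-((1 - 2 * τ * v) / (2 * v)) * x ^ 2) := by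
    intro x
    rw [mul_assoc, ← Real.exp_add]
    congr 2
    field_simp
    ring
  simp only [this]
  rw [integral_const_mul, integral_gaussian]
  rw [← Real.sqrt_inv, ← Real.sqrt_inv, ← Real.sqrt_mul (by positivity)]
  congr 1
  have h1 : 1 - 2 * τ * v ≠ 0 := by linarith
  have := Real.pi_ne_zero
  field_simp

lemma integrable_exp_sq_gaussian (v : NNReal) (hv : v ≠ 0) (τ : ℝ) (h : 2 * τ * v < 1) :
    Integrable (fun x => Real.exp (τ * x ^ 2)) (gaussianReal 0 v) := by
  by_contra hc
  have h1 := integral_exp_sq_gaussian v hv τ h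
  rw [integral_undef hc] at h1
  have : 0 < √(1 - 2 * τ * v) := Real.sqrt_pos.2 (by linarith)
  have := inv_pos.2 this
  linarith

lemma chernoff_le {α : Type*} [MeasurableSpace α] (μ : Measure α) [IsProbabilityMeasure μ]
    (X : α → ℝ) (c : ℝ) (hX : Integrable (fun a => Real.exp (X a)) μ) :
    μ.real {a | c ≤ X a} ≤ Real.exp (-c) * ∫ a, Real.exp (X a) ∂μ := by
  have h := mul_meas_ge_le_integral_of_nonneg (μ := μ) (f := fun a => Real.exp (X a))
    (Filter.Eventually.of_forall fun a => (Real.exp_pos _).le) hX (Real.exp c)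
  have h2 : {a | c ≤ X a} = {a | Real.exp c ≤ Real.exp (X a)} := by
    ext a; simp
  rw [h2, Real.exp_neg]
  rw [le_inv_mul_iff₀ (Real.exp_pos _)]
  exact h

lemma integral_exp_sq_prior (k : ℕ) (v τ : ℝ) (hv : 0 < v) (h : 2 * τ * v < 1) :
    Integrable (fun w => Real.exp (τ * (w ⬝ᵥ w))) (gaussPrior k v) ∧
    ∫ w, Real.exp (τ * (w ⬝ᵥ w)) ∂gaussPrior k v = ((Real.sqrt (1 - 2 * τ * v))⁻¹) ^ k := by
  have h0 : Real.toNNReal v ≠ 0 := by simpa using hv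
  have h1 : ((Real.toNNReal v : NNReal) : ℝ) = v := Real.coe_toNNReal _ hv.le
  have h2 : ∀ w : Fin k → ℝ, Real.exp (τ * (w ⬝ᵥ w)) = ∏ i, Real.exp (τ * (w i)^2) := by
    intro w
    rw [← Real.exp_sum, dotProduct, Finset.mul_sum]
    simp [pow_two]
  simp only [h2]
  unfold gaussPrior
  constructor
  · exact Integrable.fintype_prod (f := fun (_ : Fin k) (x : ℝ) => Real.exp (τ * x^2))
      fun i => integrable_exp_sq_gaussian _ h0 τ (by rw [h1]; exact h)
  · rw [integral_fintype_prod_eq_prod (𝕜 := ℝ) (f := fun (_ : Fin k) (x : ℝ) => Real.exp (τ * x^2))]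
    rw [Finset.prod_congr rfl fun i _ => integral_exp_sq_gaussian _ h0 τ (by rw [h1]; exact h)]
    simp [h1]

end

section

lemma norm_upper (v δ : ℝ) (hv : 0 < v) (hδ : 0 < δ) : ∃ c : ℝ, 0 < c ∧ c < 1 ∧ ∀ N k : ℕ, k ≤ N →
    (gaussPrior k v).real {w | (1 + δ) * v * N ≤ w ⬝ᵥ w} ≤ c ^ N := by
  set τ := δ / (4 * (1 + δ)) with hτ
  have hτ0 : 0 < τ := by positivity
  have hτ1 : 4 * τ * (1 + δ) = δ := by rw [hτ]; field_simp
  have hτ2 : τ < 1 / 4 := by nlinarith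
  clear_value τ
  have hs : 0 < √(1 - 2 * τ) := Real.sqrt_pos.2 (by linarith)
  refine ⟨Real.exp (-(τ * (1 + δ))) * (√(1 - 2 * τ))⁻¹, by positivity, ?_, ?_⟩
  · rw [mul_inv_lt_iff₀ hs, one_mul]
    apply Real.lt_sqrt_of_sq_lt
    rw [← Real.exp_nat_mul]
    have h1 : ((2:ℕ):ℝ) * -(τ * (1 + δ)) = -(2 * (τ * (1+δ))) := by push_cast; ring
    rw [h1, Real.exp_neg]
    have h2 := Real.add_one_le_exp (2 * (τ * (1 + δ)))
    have h3 : 0 < 2 * (τ * (1+δ)) := by positivity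
    rw [inv_lt_comm₀ (Real.exp_pos _) (by linarith)]
    refine lt_of_lt_of_le ?_ h2
    rw [inv_lt_iff_one_lt_mul₀ (by linarith)]
    nlinarith
  · intro N k hk
    obtain ⟨hi, he⟩ := integral_exp_sq_prior k v (τ / v) hv (by field_simp; linarith)
    have := chernoff_le (gaussPrior k v) (fun w => τ / v * (w ⬝ᵥ w)) (τ * (1 + δ) * N) hi
    rw [he] at this
    have hset : {w : Fin k → ℝ | (1 + δ) * v * N ≤ w ⬝ᵥ w} =
        {w | τ * (1 + δ) * N ≤ τ / v * (w ⬝ᵥ w)} := by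
      ext w
      simp only [Set.mem_setOf_eq]
      rw [div_mul_eq_mul_div, le_div_iff₀ hv]
      rw [show τ * (1 + δ) * N * v = τ * ((1 + δ) * v * N) by ring]
      exact (mul_le_mul_iff_right₀ hτ0).symm
    rw [hset]
    refine this.trans ?_
    have h5 : 2 * (τ / v) * v = 2 * τ := by field_simp
    rw [h5, mul_pow, ← Real.exp_nat_mul]
    have h6 : (N:ℝ) * -(τ * (1 + δ)) = -(τ * (1 + δ) * N) := by ring
    rw [h6]
    gcongr
    rw [one_le_inv₀ hs]
    exact Real.sqrt_le_one.2 (by linarith)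

lemma norm_lower (v δ : ℝ) (hv : 0 < v) (hδ : 0 < δ) (hδ1 : δ ≤ 1) :
    ∃ c : ℝ, 0 < c ∧ c < 1 ∧ ∀ N k : ℕ, (1 - δ / 2) * N ≤ k →
    (gaussPrior k v).real {w | w ⬝ᵥ w ≤ (1 - δ) * v * N} ≤ c ^ N := by
  set τ := δ / 8 with hτ
  have hτ0 : 0 < τ := by positivity
  have hs : 0 < √(1 + 2 * τ) := Real.sqrt_pos.2 (by linarith)
  have hl : 0 ≤ Real.log (1 + 2 * τ) := Real.log_nonneg (by linarith)
  refine ⟨Real.exp (τ * (1 - δ) - (1 - δ / 2) / 2 * Real.log (1 + 2 * τ)), by positivity, ?_, ?_⟩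
  · rw [Real.exp_lt_one_iff]
    have h1 := Real.one_sub_inv_le_log_of_pos (x := 1 + 2 * τ) (by linarith)
    have h2 : 1 - (1 + 2 * τ)⁻¹ = 2 * τ / (1 + 2 * τ) := by field_simp; ring
    rw [h2] at h1
    have h3 : τ * (1 - δ) < (1 - δ / 2) / 2 * (2 * τ / (1 + 2 * τ)) := by
      rw [mul_div_assoc', lt_div_iff₀ (by linarith)]
      nlinarith [mul_pos hτ0 hδ, mul_pos hτ0 hτ0]
    have h4 : (1 - δ / 2) / 2 * (2 * τ / (1 + 2 * τ)) ≤ (1 - δ / 2) / 2 * Real.log (1 + 2 * τ) := by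
      apply mul_le_mul_of_nonneg_left h1; linarith
    linarith
  · intro N k hk
    obtain ⟨hi, he⟩ := integral_exp_sq_prior k v (-τ / v) hv (by field_simp; linarith)
    have := chernoff_le (gaussPrior k v) (fun w => -τ / v * (w ⬝ᵥ w)) (-τ * (1 - δ) * N) hi
    rw [he] at this
    have hset : {w : Fin k → ℝ | w ⬝ᵥ w ≤ (1 - δ) * v * N} =
        {w | -τ * (1 - δ) * N ≤ -τ / v * (w ⬝ᵥ w)} := by
      ext w
      simp only [Set.mem_setOf_eq]
      rw [div_mul_eq_mul_div, le_div_iff₀ hv]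
      rw [show -τ * (1 - δ) * N * v = -(τ * ((1 - δ) * v * N)) by ring, neg_mul, neg_le_neg_iff]
      exact (mul_le_mul_iff_right₀ hτ0).symm
    rw [hset]
    refine this.trans ?_
    have h5 : 1 - 2 * (-τ / v) * v = 1 + 2 * τ := by field_simp; ring
    have h7 : √(1 + 2 * τ) = Real.exp (1 / 2 * Real.log (1 + 2 * τ)) := by
      rw [Real.sqrt_eq_rpow, Real.rpow_def_of_pos (by linarith)]
      congr 1; ring
    rw [h5, h7, ← Real.exp_neg, ← Real.exp_nat_mul, ← Real.exp_nat_mul, ← Real.exp_add]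
    apply Real.exp_le_exp.2
    nlinarith [mul_le_mul_of_nonneg_right hk hl]

lemma diag_tail (δ : ℝ) (hδ : 0 < δ) : ∃ c : ℝ, 0 < c ∧ c < 1 ∧ ∀ N : ℕ,
    (gaussianReal 0 2).real {d | δ * √N ≤ |d|} ≤ 2 * c ^ N := by
  refine ⟨Real.exp (-(δ^2/8)), by positivity, ?_, ?_⟩
  · rw [Real.exp_lt_one_iff]; have := pow_pos hδ 2; linarith
  · intro N
    have := chernoff_le (gaussianReal 0 2) (fun x => 1/8 * x^2) (δ^2/8 * N)
      (integrable_exp_sq_gaussian 2 (by norm_num) (1/8) (by norm_num))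
    rw [integral_exp_sq_gaussian 2 (by norm_num) (1/8) (by norm_num)] at this
    have hset : {d : ℝ | δ * √N ≤ |d|} = {x | δ^2/8 * N ≤ 1/8*x^2} := by
      ext x
      simp only [Set.mem_setOf_eq]
      rw [← sq_abs x, ← pow_le_pow_iff_left₀ (by positivity) (abs_nonneg x) two_ne_zero, mul_pow,
        Real.sq_sqrt (by positivity)]
      constructor <;> intro h <;> linarith
    rw [hset, ← Real.exp_nat_mul]
    refine this.trans ?_
    rw [mul_comm, show (N:ℝ) * -(δ^2/8) = -(δ^2/8 * N) by ring]
    gcongr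
    have : (1:ℝ)/2 ≤ √(1 - 2 * (1/8) * ((2:NNReal):ℝ)) := by
      apply Real.le_sqrt_of_sq_le; norm_num
    calc _ ≤ ((1:ℝ)/2)⁻¹ := inv_anti₀ (by norm_num) this
      _ = 2 := by norm_num

lemma blk_union_bound (k : ℕ) (A : Set (Matrix (Fin (k+1)) (Fin (k+1)) ℝ)) (hA : MeasurableSet A)
    (D : Set ℝ) (V : Set (Fin k → ℝ)) (hV : MeasurableSet V)
    (S : Set ((Fin k → ℝ) × Matrix (Fin k) (Fin k) ℝ)) (hS : MeasurableSet S)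
    (h : ∀ d w Z, d ∉ D → w ∉ V → (w, Z) ∉ S → blk d w Z ∉ A) (c : ℝ) (hc : 0 ≤ c)
    (hw : ∀ w ∉ V, (noiseMeasure k).real {Z | (w, Z) ∈ S} ≤ c) :
    (noiseMeasure (k+1)).real A ≤ (gaussianReal 0 2).real D + (gaussPrior k 1).real V + c := by
  have hprod : ((gaussPrior k 1).prod (noiseMeasure k)).real (S ∩ (Vᶜ ×ˢ Set.univ)) ≤ c := by
    apply ENNReal.toReal_le_of_le_ofReal hc
    rw [Measure.prod_apply (hS.inter (hV.compl.prod MeasurableSet.univ))]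
    calc _ ≤ ∫⁻ w, ENNReal.ofReal c ∂gaussPrior k 1 := by
          apply lintegral_mono
          intro w
          by_cases hwV : w ∈ V
          · have : Prod.mk w ⁻¹' (S ∩ Vᶜ ×ˢ Set.univ) = ∅ := by
              ext Z; simp [hwV]
            simp [this]
          · have h1 : Prod.mk w ⁻¹' (S ∩ Vᶜ ×ˢ Set.univ) ⊆ {Z | (w, Z) ∈ S} := fun Z hZ => hZ.1
            refine (measure_mono h1).trans ?_
            rw [← ENNReal.ofReal_toReal (measure_ne_top (noiseMeasure k) {Z | (w, Z) ∈ S})]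
            exact ENNReal.ofReal_le_ofReal (hw w hwV)
      _ = _ := by simp
  rw [← noise_blk, map_measureReal_apply (measurable_blk k) hA]
  set P := (gaussianReal 0 2).prod ((gaussPrior k 1).prod (noiseMeasure k))
  have hsub : (fun p : ℝ × (Fin k → ℝ) × Matrix (Fin k) (Fin k) ℝ => blk p.1 p.2.1 p.2.2) ⁻¹' A ⊆
      (D ×ˢ Set.univ ∪ Set.univ ×ˢ (V ×ˢ Set.univ)) ∪ Set.univ ×ˢ (S ∩ (Vᶜ ×ˢ Set.univ)) := by
    rintro ⟨d, w, Z⟩ hp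
    by_contra hn
    simp only [Set.mem_union, Set.mem_prod, Set.mem_univ, and_true, true_and, Set.mem_inter_iff,
      Set.mem_compl_iff, not_or, not_and, not_not] at hn
    exact h d w Z hn.1.1 hn.1.2 (fun hs => hn.1.2 (hn.2 hs)) hp
  refine (measureReal_mono hsub).trans ?_
  refine (measureReal_union_le _ _).trans ?_
  refine add_le_add ((measureReal_union_le _ _).trans (add_le_add ?_ ?_)) ?_
  · rw [measureReal_prod_prod]; simp
  · rw [measureReal_prod_prod, measureReal_prod_prod]; simp
  · rw [measureReal_prod_prod]; simpa using hprod
end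

section

/-- The quadratic form of `z - r Z`. -/
def qf {n : ℕ} (r z : ℝ) (Z : Matrix (Fin n) (Fin n) ℝ) (x : Fin n → ℝ) : ℝ :=
  z * (x ⬝ᵥ x) - r * (x ⬝ᵥ (Z *ᵥ x))

lemma dot_self_nonneg {n : ℕ} (x : Fin n → ℝ) : 0 ≤ x ⬝ᵥ x :=
  Finset.sum_nonneg fun _ _ => mul_self_nonneg _

lemma dot_self_pos {n : ℕ} {x : Fin n → ℝ} (hx : x ≠ 0) : 0 < x ⬝ᵥ x :=
  (dot_self_nonneg x).lt_of_ne' (by simpa [dotProduct_self_eq_zero] using hx)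

def Uset {n : ℕ} (r z g : ℝ) (u : Fin n → ℝ) : Set (Matrix (Fin n) (Fin n) ℝ) :=
  {Z | ∀ x, 0 ≤ qf r z Z x ∧ (u ⬝ᵥ x) ^ 2 ≤ g * (u ⬝ᵥ u) * qf r z Z x}

def Lset {n : ℕ} (r z l : ℝ) (u : Fin n → ℝ) : Set (Matrix (Fin n) (Fin n) ℝ) :=
  {Z | ∃ x, l * (u ⬝ᵥ u) < 2 * (u ⬝ᵥ x) - qf r z Z x}

lemma Uset_joint_closed {n : ℕ} (r z g : ℝ) :
    IsClosed {p : (Fin n → ℝ) × Matrix (Fin n) (Fin n) ℝ | p.2 ∈ Uset r z g p.1} := by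
  simp only [Uset, Set.mem_setOf_eq]
  simp only [Set.setOf_forall, qf, Set.setOf_and]
  apply isClosed_iInter
  intro x
  apply IsClosed.inter
  · apply isClosed_le <;> fun_prop
  · apply isClosed_le <;> fun_prop

lemma Lset_joint_open {n : ℕ} (r z l : ℝ) :
    IsOpen {p : (Fin n → ℝ) × Matrix (Fin n) (Fin n) ℝ | p.2 ∈ Lset r z l p.1} := by
  simp only [Lset, Set.mem_setOf_eq]
  simp only [Set.setOf_exists, qf]
  apply isOpen_iUnion
  intro x
  apply isOpen_lt <;> fun_prop

lemma Uset_meas {n : ℕ} (r z g : ℝ) (u : Fin n → ℝ) : MeasurableSet (Uset r z g u) := by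
  have := (Uset_joint_closed (n := n) r z g).preimage (f := fun Z => (u, Z)) (by fun_prop)
  exact this.measurableSet

lemma Lset_meas {n : ℕ} (r z g : ℝ) (u : Fin n → ℝ) : MeasurableSet (Lset r z g u) := by
  have := (Lset_joint_open (n := n) r z g).preimage (f := fun Z => (u, Z)) (by fun_prop)
  exact this.measurableSet

lemma exists_orth {n : ℕ} (u v : Fin n → ℝ) (h : u ⬝ᵥ u = v ⬝ᵥ v) :
    ∃ O : Matrix (Fin n) (Fin n) ℝ, Oᵀ * O = 1 ∧ O *ᵥ u = v := by
  by_cases huv : u = v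
  · exact ⟨1, by simp, by simp [huv]⟩
  set w := u - v with hw
  have hw0 : w ⬝ᵥ w ≠ 0 := by
    rw [Ne, dotProduct_self_eq_zero]
    exact sub_ne_zero.2 huv
  have hww : w ⬝ᵥ w = 2 * (w ⬝ᵥ u) := by
    simp only [hw, sub_dotProduct, dotProduct_sub]
    rw [dotProduct_comm v u, h]; ring
  set O : Matrix (Fin n) (Fin n) ℝ := 1 - (2 / (w ⬝ᵥ w)) • vecMulVec w w with hO
  have hOt : Oᵀ = O := by
    simp [hO, Matrix.transpose_sub, Matrix.transpose_vecMulVec]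
  refine ⟨O, ?_, ?_⟩
  · rw [hOt]
    have h1 : vecMulVec w w * vecMulVec w w = (w ⬝ᵥ w) • vecMulVec w w := by
      rw [vecMulVec_mul_vecMulVec]; ext i j; simp [vecMulVec_apply]; ring
    simp only [hO, Matrix.sub_mul, Matrix.mul_sub, Matrix.one_mul, Matrix.mul_one, Matrix.smul_mul,
      Matrix.mul_smul, h1, smul_smul]
    rw [div_mul_cancel₀ _ hw0]
    ext i j
    simp only [Matrix.sub_apply, Matrix.smul_apply, smul_eq_mul]
    ring
  · rw [hO, Matrix.sub_mulVec, Matrix.one_mulVec, Matrix.smul_mulVec, vecMulVec_mulVec]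
    ext i
    have h0 : w ⬝ᵥ u ≠ 0 := by intro h'; rw [h'] at hww; exact hw0 (by linarith)
    simp only [Pi.sub_apply, Pi.smul_apply, smul_eq_mul, MulOpposite.smul_eq_mul_unop, MulOpposite.unop_op]
    rw [hww]
    field_simp
    simp [hw]

lemma orth_dot {n : ℕ} {O : Matrix (Fin n) (Fin n) ℝ} (hO : Oᵀ * O = 1) (x y : Fin n → ℝ) :
    (O *ᵥ x) ⬝ᵥ (O *ᵥ y) = x ⬝ᵥ y := by
  rw [Matrix.dotProduct_mulVec, ← Matrix.mulVec_transpose, Matrix.mulVec_mulVec, hO, Matrix.one_mulVec]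

lemma qf_conj {n : ℕ} {O : Matrix (Fin n) (Fin n) ℝ} (hO : Oᵀ * O = 1) (r z : ℝ)
    (Z : Matrix (Fin n) (Fin n) ℝ) (x : Fin n → ℝ) :
    qf r z (Oᵀ * Z * O) x = qf r z Z (O *ᵥ x) := by
  unfold qf
  rw [orth_dot hO]
  congr 2
  rw [← Matrix.mulVec_mulVec, ← Matrix.mulVec_mulVec, Matrix.mulVec_transpose,
    dotProduct_comm, ← Matrix.dotProduct_mulVec, dotProduct_comm]

lemma orth_surj {n : ℕ} {O : Matrix (Fin n) (Fin n) ℝ} (hO : Oᵀ * O = 1) (y : Fin n → ℝ) :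
    ∃ x, O *ᵥ x = y := ⟨Oᵀ *ᵥ y, by
  rw [Matrix.mulVec_mulVec, mul_eq_one_comm.1 hO, Matrix.one_mulVec]⟩

lemma Uset_conj {n : ℕ} {O : Matrix (Fin n) (Fin n) ℝ} (hO : Oᵀ * O = 1) (r z g : ℝ)
    (Z : Matrix (Fin n) (Fin n) ℝ) (u : Fin n → ℝ) :
    Oᵀ * Z * O ∈ Uset r z g u ↔ Z ∈ Uset r z g (O *ᵥ u) := by
  simp only [Uset, Set.mem_setOf_eq, qf_conj hO]
  constructor
  · intro h y
    obtain ⟨x, rfl⟩ := orth_surj hO y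
    rw [orth_dot hO, orth_dot hO]; exact h x
  · intro h x
    have := h (O *ᵥ x)
    rwa [orth_dot hO, orth_dot hO] at this

lemma Lset_conj {n : ℕ} {O : Matrix (Fin n) (Fin n) ℝ} (hO : Oᵀ * O = 1) (r z g : ℝ)
    (Z : Matrix (Fin n) (Fin n) ℝ) (u : Fin n → ℝ) :
    Oᵀ * Z * O ∈ Lset r z g u ↔ Z ∈ Lset r z g (O *ᵥ u) := by
  simp only [Lset, Set.mem_setOf_eq, qf_conj hO]
  constructor
  · rintro ⟨x, hx⟩
    exact ⟨O *ᵥ x, by rwa [orth_dot hO, orth_dot hO]⟩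
  · rintro ⟨y, hy⟩
    obtain ⟨x, rfl⟩ := orth_surj hO y
    rw [orth_dot hO, orth_dot hO] at hy
    exact ⟨x, hy⟩

lemma Uset_smul {n : ℕ} (r z g c : ℝ) (hc : c ≠ 0) (u : Fin n → ℝ) :
    Uset r z g (c • u) = Uset r z g u := by
  have : 0 < c ^ 2 := by positivity
  ext Z
  simp only [Uset, Set.mem_setOf_eq, smul_dotProduct, dotProduct_smul, smul_eq_mul]
  refine forall_congr' fun x => and_congr_right fun _ => ?_
  rw [mul_pow, show g * (c * (c * (u ⬝ᵥ u))) * qf r z Z x = c^2 * (g * (u ⬝ᵥ u) * qf r z Z x) by ring]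
  exact mul_le_mul_iff_right₀ this

lemma qf_smul {n : ℕ} (r z c : ℝ) (Z : Matrix (Fin n) (Fin n) ℝ) (x : Fin n → ℝ) :
    qf r z Z (c • x) = c^2 * qf r z Z x := by
  simp only [qf, Matrix.mulVec_smul, smul_dotProduct, dotProduct_smul, smul_eq_mul]; ring

lemma Lset_smul {n : ℕ} (r z g c : ℝ) (hc : c ≠ 0) (u : Fin n → ℝ) :
    Lset r z g (c • u) = Lset r z g u := by
  have h2 : 0 < c ^ 2 := by positivity
  ext Z
  simp only [Lset, Set.mem_setOf_eq, smul_dotProduct, dotProduct_smul, smul_eq_mul]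
  constructor
  · rintro ⟨x, hx⟩
    refine ⟨c⁻¹ • x, ?_⟩
    rw [qf_smul, dotProduct_smul, smul_eq_mul]
    rw [← mul_lt_mul_iff_right₀ h2]
    calc _ = g * (c * (c * (u ⬝ᵥ u))) := by ring
      _ < _ := hx
      _ = _ := by field_simp
  · rintro ⟨x, hx⟩
    refine ⟨c • x, ?_⟩
    rw [qf_smul, dotProduct_smul, smul_eq_mul]
    rw [← mul_lt_mul_iff_right₀ h2] at hx
    calc _ = c ^ 2 * (g * (u ⬝ᵥ u)) := by ring
      _ < _ := hx
      _ = _ := by ring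

lemma noise_rot_inv {n : ℕ} (S : (Fin n → ℝ) → Set (Matrix (Fin n) (Fin n) ℝ))
    (hm : ∀ u, MeasurableSet (S u))
    (hs : ∀ c : ℝ, c ≠ 0 → ∀ u, S (c • u) = S u)
    (hr : ∀ O : Matrix (Fin n) (Fin n) ℝ, Oᵀ * O = 1 → ∀ Z u, Oᵀ * Z * O ∈ S u ↔ Z ∈ S (O *ᵥ u))
    (u v : Fin n → ℝ) (hu : u ≠ 0) (hv : v ≠ 0) :
    (noiseMeasure n).real (S u)ᶜ = (noiseMeasure n).real (S v)ᶜ := by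
  have hu' : 0 < u ⬝ᵥ u := (dot_self_nonneg u).lt_of_ne' (by simpa [dotProduct_self_eq_zero] using hu)
  have hv' : 0 < v ⬝ᵥ v := (dot_self_nonneg v).lt_of_ne' (by simpa [dotProduct_self_eq_zero] using hv)
  set c := √((u ⬝ᵥ u) / (v ⬝ᵥ v)) with hc
  have hc0 : c ≠ 0 := by positivity
  obtain ⟨O, hO, hOu⟩ := exists_orth u (c • v) (by
    rw [smul_dotProduct, dotProduct_smul, smul_eq_mul, smul_eq_mul, ← mul_assoc, hc,
      Real.mul_self_sqrt (by positivity)]; field_simp)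
  rw [← hs c hc0 v]
  conv_lhs => rw [← noise_rotate O hO]
  rw [map_measureReal_apply (measurable_conj O) (hm u).compl]
  congr 1
  ext Z
  simp only [Set.mem_preimage, Set.mem_compl_iff, hr O hO, hOu]

lemma qf_blk {k : ℕ} (r z d : ℝ) (w : Fin k → ℝ) (Z : Matrix (Fin k) (Fin k) ℝ) (x : Fin (k+1) → ℝ) :
    qf r z (blk d w Z) x = (z - r * d) * (x 0)^2 - 2 * r * x 0 * (w ⬝ᵥ (fun i => x i.succ)) +
      qf r z Z (fun i => x i.succ) := by
  simp only [qf, dotProduct, Matrix.mulVec, Fin.sum_univ_succ, blk, Matrix.of_apply, Fin.cons_zero, Fin.cons_succ]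
  simp only [mul_add, Finset.sum_add_distrib]
  have h : ∑ x_1 : Fin k, x x_1.succ * (w x_1 * x 0) = x 0 * ∑ i : Fin k, w i * x i.succ := by
    rw [Finset.mul_sum]; exact Finset.sum_congr rfl fun i _ => by ring
  rw [h]; ring

lemma U_step {k : ℕ} (r z g δ d : ℝ) (w : Fin k → ℝ) (Z : Matrix (Fin k) (Fin k) ℝ)
    (hg : 0 < g) (hδ : 0 < δ) (hz : 1 ≤ g * (z - δ - (1 + δ) * g)) (hd : r * d ≤ δ)
    (hw : r ^ 2 * (w ⬝ᵥ w) ≤ 1 + δ) (hU : Z ∈ Uset r z g w) :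
    blk d w Z ∈ Uset r z g (Pi.single (0 : Fin (k+1)) 1) := by
  intro x
  obtain ⟨hq, hc⟩ := hU (fun i => x i.succ)
  rw [qf_blk]
  set c := w ⬝ᵥ (fun i => x i.succ)
  set q := qf r z Z (fun i => x i.succ)
  have key : (x 0)^2 ≤ g * ((z - r * d) * (x 0)^2 - 2 * r * x 0 * c + q) := by
    have h1 : r^2 * c^2 ≤ (1 + δ) * g * q := by
      calc r^2 * c^2 ≤ r^2 * (g * (w ⬝ᵥ w) * q) := by gcongr
        _ = (r^2 * (w ⬝ᵥ w)) * (g * q) := by ring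
        _ ≤ (1 + δ) * (g * q) := by gcongr
        _ = _ := by ring
    have h2 : 0 ≤ ((1 + δ) * g) * ((1 + δ) * g * (x 0)^2 + q - 2 * r * x 0 * c) := by
      have := sq_nonneg ((1 + δ) * g * x 0 - r * c)
      nlinarith
    have h3 : 0 ≤ (1 + δ) * g * (x 0)^2 + q - 2 * r * x 0 * c := by
      by_contra hneg
      have : 0 < (1 + δ) * g := by positivity
      nlinarith
    have h4 : (z - δ) * (x 0)^2 ≤ (z - r * d) * (x 0)^2 := by
      apply mul_le_mul_of_nonneg_right _ (sq_nonneg _); linarith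
    calc (x 0)^2 ≤ g * (z - δ - (1 + δ) * g) * (x 0)^2 := by nlinarith [sq_nonneg (x 0)]
      _ = g * ((z - δ - (1 + δ) * g) * (x 0)^2) := by ring
      _ ≤ _ := by gcongr; linarith
  refine ⟨?_, by simpa using key⟩
  have : 0 ≤ g * ((z - r * d) * (x 0)^2 - 2 * r * x 0 * c + q) := (sq_nonneg _).trans key
  exact nonneg_of_mul_nonneg_right this hg

lemma L_step {k : ℕ} (r z l l' δ d : ℝ) (w : Fin k → ℝ) (Z : Matrix (Fin k) (Fin k) ℝ)
    (hr : r ≠ 0)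
    (hz : 0 < z + δ * (1 + |l|) - l) (hl' : l' * (z + δ * (1 + |l|) - l) ≤ 1) (hd : -δ ≤ r * d)
    (hw : |r ^ 2 * (w ⬝ᵥ w) - 1| ≤ δ) (hL : Z ∈ Lset r z l w) :
    blk d w Z ∈ Lset r z l' (Pi.single (0 : Fin (k+1)) 1) := by
  obtain ⟨y, hy⟩ := hL
  set D := z + δ * (1 + |l|) - l with hD
  set x0 := 1 / D with hx0
  refine ⟨Fin.cons x0 ((x0 * r) • y), ?_⟩
  rw [qf_blk]
  simp only [Fin.cons_zero, Fin.cons_succ, single_one_dotProduct]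
  rw [show (fun i => ((x0 * r) • y) i) = (x0 * r) • y from rfl, qf_smul, dotProduct_smul, smul_eq_mul]
  simp only [Pi.single_eq_same, mul_one]
  have h1 : 0 < x0 := by positivity
  have h2 : x0^2 * r^2 * (l * (w ⬝ᵥ w)) < x0^2 * r^2 * (2 * (w ⬝ᵥ y) - qf r z Z y) := by
    apply mul_lt_mul_of_pos_left hy; positivity
  have h3 : z - r * d - l * (r^2 * (w ⬝ᵥ w)) ≤ D := by
    have : |l * (r^2 * (w ⬝ᵥ w) - 1)| ≤ |l| * δ := by
      rw [abs_mul]; exact mul_le_mul_of_nonneg_left hw (abs_nonneg _)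
    have := (abs_le.1 this).1
    rw [hD]; nlinarith
  have h4 : x0^2 * (z - r * d - l * (r^2 * (w ⬝ᵥ w))) ≤ x0^2 * D := by gcongr
  have h5 : x0 * D = 1 := by rw [hx0]; field_simp
  have h6 : l' ≤ x0 := by rw [hx0, le_div_iff₀ hz]; exact hl'
  nlinarith
end

section

lemma Uset_rot {n : ℕ} (r z g : ℝ) (u v : Fin n → ℝ) (hu : u ≠ 0) (hv : v ≠ 0) :
    (noiseMeasure n).real (Uset r z g u)ᶜ = (noiseMeasure n).real (Uset r z g v)ᶜ :=
  noise_rot_inv _ (Uset_meas r z g) (fun c hc u => Uset_smul r z g c hc u)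
    (fun _ hO Z u => Uset_conj hO r z g Z u) u v hu hv

lemma Lset_rot {n : ℕ} (r z g : ℝ) (u v : Fin n → ℝ) (hu : u ≠ 0) (hv : v ≠ 0) :
    (noiseMeasure n).real (Lset r z g u)ᶜ = (noiseMeasure n).real (Lset r z g v)ᶜ :=
  noise_rot_inv _ (Lset_meas r z g) (fun c hc u => Lset_smul r z g c hc u)
    (fun _ hO Z u => Lset_conj hO r z g Z u) u v hu hv

lemma U_prob (z g : ℝ) (hg : 0 < g) (hz : 1 < g * (z - g)) : ∃ c : ℝ, 0 < c ∧ c < 1 ∧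
    ∀ N : ℕ, 1 ≤ N → ∀ k ≤ N, ∀ u : Fin k → ℝ,
      (noiseMeasure k).real (Uset (1 / √N) z g u)ᶜ ≤ k * (3 * c ^ N) := by
  set δ := (g * (z - g) - 1) / (g * (1 + g)) with hδ
  have hδ0 : 0 < δ := by apply div_pos <;> nlinarith
  have hδ1 : δ * (g * (1 + g)) = g * (z - g) - 1 := by rw [hδ]; field_simp
  clear_value δ
  obtain ⟨c1, h10, h11, h1⟩ := norm_upper 1 δ one_pos hδ0
  obtain ⟨c2, h20, h21, h2⟩ := diag_tail δ hδ0
  refine ⟨max c1 c2, lt_max_of_lt_left h10, max_lt h11 h21, ?_⟩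
  intro N hN k
  have hN0 : (0:ℝ) < N := by exact_mod_cast hN
  have hsN : 0 < √(N:ℝ) := Real.sqrt_pos.2 hN0
  induction k with
  | zero =>
    intro _ u
    have : Uset (1 / √N) z g u = Set.univ := by
      ext Z; simp [Uset, qf]
    rw [this]; simp
  | succ k ih =>
    intro hk
    have hk' : k ≤ N := by omega
    have base : (noiseMeasure (k+1)).real (Uset (1 / √N) z g (Pi.single (0 : Fin (k+1)) 1))ᶜ ≤
        ((k+1 : ℕ):ℝ) * (3 * (max c1 c2) ^ N) := by
      have hb := blk_union_bound k (Uset (1 / √N) z g (Pi.single (0 : Fin (k+1)) 1))ᶜ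
        (Uset_meas _ _ _ _).compl {d | δ * √N ≤ |d|} {w | (1 + δ) * 1 * N ≤ w ⬝ᵥ w}
        (by apply IsClosed.measurableSet; apply isClosed_le <;> fun_prop)
        {p | p.2 ∈ Uset (1 / √N) z g p.1}ᶜ (Uset_joint_closed _ _ _).measurableSet.compl
        (by
          intro d w Z hd hw hS
          simp only [Set.mem_compl_iff, not_not, Set.mem_setOf_eq, not_le] at hd hw hS ⊢
          refine U_step _ _ _ δ d w Z hg hδ0 (by nlinarith) ?_ ?_ hS
          · rw [one_div, inv_mul_le_iff₀ hsN]
            linarith [le_abs_self d]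
          · rw [div_pow, one_pow, Real.sq_sqrt hN0.le, one_div, inv_mul_le_iff₀ hN0]
            linarith)
        (k * (3 * (max c1 c2) ^ N)) (by positivity)
        (by intro w _; exact ih hk' w)
      refine hb.trans ?_
      have e1 := (h2 N).trans (mul_le_mul_of_nonneg_left
        (pow_le_pow_left₀ h20.le (le_max_right c1 c2) N) two_pos.le)
      have e2 := (h1 N k hk').trans (pow_le_pow_left₀ h10.le (le_max_left c1 c2) N)
      push_cast
      linarith
    intro u
    have hs : (Pi.single (0 : Fin (k+1)) 1 : Fin (k+1) → ℝ) ≠ 0 := by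
      intro h; have := congrFun h 0; simp at this
    by_cases hu : u = 0
    · refine (measureReal_mono ?_).trans base
      apply Set.compl_subset_compl.2
      intro Z hZ x
      refine ⟨(hZ x).1, by simp [hu]⟩
    · rw [Uset_rot _ _ _ u _ hu hs]; exact base

def LimL (z l : ℝ) : Prop := ∀ η : ℝ, η > 0 → ∃ δ : ℝ, δ > 0 ∧ ∃ N0 : ℕ, ∀ N : ℕ, N0 ≤ N → ∀ k : ℕ, k ≤ N →
  (1 - δ) * N ≤ k → ∀ u : Fin k → ℝ, u ≠ 0 → (noiseMeasure k).real (Lset (1 / √N) z l u)ᶜ ≤ η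

lemma LimL_neg (z l : ℝ) (hl : l < 0) : LimL z l := by
  intro η hη
  refine ⟨1, one_pos, 0, fun N _ k _ _ u hu => ?_⟩
  have : Lset (1 / √N) z l u = Set.univ := by
    ext Z
    simp only [Lset, Set.mem_setOf_eq, Set.mem_univ, iff_true]
    refine ⟨0, ?_⟩
    simp [qf]
    exact mul_neg_of_neg_of_pos hl (dot_self_pos hu)
  rw [this]; simp [hη.le]

lemma LimL_mono (z l l' : ℝ) (hl : l' ≤ l) (h : LimL z l) : LimL z l' := by
  intro η hη
  obtain ⟨δ, hδ, N0, H⟩ := h η hη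
  refine ⟨δ, hδ, N0, fun N hN k hk hk' u hu => (measureReal_mono ?_).trans (H N hN k hk hk' u hu)⟩
  apply Set.compl_subset_compl.2
  rintro Z ⟨x, hx⟩
  exact ⟨x, lt_of_le_of_lt (mul_le_mul_of_nonneg_right hl (dot_self_nonneg u)) hx⟩

lemma LimL_step (z l l' : ℝ) (hzl : 0 < z - l) (hl' : l' * (z - l) < 1) (h : LimL z l) :
    LimL z l' := by
  obtain ⟨δ', hδ0, hδ1, hδ2⟩ : ∃ δ' : ℝ, 0 < δ' ∧ δ' ≤ 1 ∧ l' * (z + δ' * (1 + |l|) - l) ≤ 1 := by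
    have hT : Tendsto (fun δ' : ℝ => l' * (z + δ' * (1 + |l|) - l)) (nhdsWithin 0 (Set.Ioi 0))
        (nhds (l' * (z + 0 * (1 + |l|) - l))) := by
      apply Filter.Tendsto.mono_left _ nhdsWithin_le_nhds
      apply Continuous.tendsto; fun_prop
    have h1 := hT.eventually (eventually_lt_nhds (b := 1) (by simpa using hl'))
    have h2 : ∀ᶠ x : ℝ in nhdsWithin 0 (Set.Ioi 0), 0 < x := eventually_mem_nhdsWithin
    have h3 : ∀ᶠ x : ℝ in nhdsWithin 0 (Set.Ioi 0), x ≤ 1 :=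
      nhdsWithin_le_nhds (Iic_mem_nhds one_pos)
    obtain ⟨x, hx1, hx2, hx3⟩ := (h1.and (h2.and h3)).exists
    exact ⟨x, hx2, hx3, hx1.le⟩
  intro η hη
  obtain ⟨δ1, hδ10, N1, H⟩ := h (η / 2) (by positivity)
  obtain ⟨c1, h10, h11, h1⟩ := norm_upper 1 δ' one_pos hδ0
  obtain ⟨c2, h20, h21, h2⟩ := diag_tail δ' hδ0
  obtain ⟨c3, h30, h31, h3⟩ := norm_lower 1 δ' one_pos hδ0 hδ1
  have hlim : Tendsto (fun N : ℕ => 2 * c2 ^ N + (c1 ^ N + c3 ^ N)) atTop (nhds (2 * 0 + (0 + 0))) :=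
    ((tendsto_pow_atTop_nhds_zero_of_lt_one h20.le h21).const_mul 2).add
      ((tendsto_pow_atTop_nhds_zero_of_lt_one h10.le h11).add
       (tendsto_pow_atTop_nhds_zero_of_lt_one h30.le h31))
  obtain ⟨N2, hN2⟩ := eventually_atTop.1 (hlim.eventually (eventually_lt_nhds (b := η / 2) (by simpa using hη)))
  set δ := min δ1 (δ' / 2) / 2 with hδ
  have hδp : 0 < δ := by positivity
  have hd1 : 2 * δ ≤ δ1 := by rw [hδ]; linarith [min_le_left δ1 (δ' / 2)]
  have hd2 : 2 * δ ≤ δ' / 2 := by rw [hδ]; linarith [min_le_right δ1 (δ' / 2)]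
  obtain ⟨N3, hN3⟩ := exists_nat_ge (1 / δ)
  refine ⟨δ, hδp, max (max N1 N2) (max N3 1), ?_⟩
  intro N hN k hk hk' u hu
  have hNN1 : N1 ≤ N := by omega
  have hNN2 : N2 ≤ N := by omega
  have hNN3 : N3 ≤ N := by omega
  have hN1 : 1 ≤ N := by omega
  have hN0 : (0:ℝ) < N := by exact_mod_cast hN1
  have hsN : 0 < √(N:ℝ) := Real.sqrt_pos.2 hN0
  have hδN : 1 ≤ δ * N := by
    have : 1 / δ ≤ N := hN3.trans (by exact_mod_cast hNN3)
    rw [div_le_iff₀ hδp] at this; linarith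
  match k, u, hu, hk, hk' with
  | 0, u, hu, _, _ => exact absurd (Subsingleton.elim u 0) hu
  | (k+1), u, hu, hk, hk' =>
    have hs : (Pi.single (0 : Fin (k+1)) 1 : Fin (k+1) → ℝ) ≠ 0 := by
      intro h; have := congrFun h 0; simp at this
    rw [Lset_rot _ _ _ u _ hu hs]
    push_cast at hk'
    have hkl : (1 - 2 * δ) * N ≤ k := by linarith
    have hkN : k ≤ N := by omega
    have hb := blk_union_bound k (Lset (1 / √N) z l' (Pi.single (0 : Fin (k+1)) 1))ᶜ
        (Lset_meas _ _ _ _).compl {d | δ' * √N ≤ |d|}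
        ({w | (1 + δ') * 1 * N ≤ w ⬝ᵥ w} ∪ {w | w ⬝ᵥ w ≤ (1 - δ') * 1 * N})
        (by
          apply MeasurableSet.union <;> apply IsClosed.measurableSet <;>
            apply isClosed_le <;> fun_prop)
        {p | p.2 ∈ Lset (1 / √N) z l p.1}ᶜ (Lset_joint_open _ _ _).measurableSet.compl
        (by
          intro d w Z hd hw hS
          simp only [Set.mem_compl_iff, not_not, Set.mem_setOf_eq, not_le, Set.mem_union, not_or] at hd hw hS ⊢
          refine L_step _ _ l _ δ' d w Z (by positivity) ?_ hδ2 ?_ ?_ hS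
          · have : 0 ≤ δ' * (1 + |l|) := by positivity
            linarith
          · rw [one_div, le_inv_mul_iff₀ hsN]
            linarith [neg_abs_le d]
          · rw [div_pow, one_pow, Real.sq_sqrt hN0.le, abs_le]
            constructor
            · have : (1 - δ') ≤ 1 / N * (w ⬝ᵥ w) := by
                rw [one_div, le_inv_mul_iff₀ hN0]; linarith
              linarith
            · have : 1 / N * (w ⬝ᵥ w) ≤ 1 + δ' := by
                rw [one_div, inv_mul_le_iff₀ hN0]; linarith
              linarith)
        (η / 2) (by positivity)
        (by
          intro w hw
          refine H N hNN1 k hkN ?_ w ?_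
          · exact le_trans (mul_le_mul_of_nonneg_right (by linarith) hN0.le) hkl
          · rintro rfl
            apply hw
            right
            simp only [Set.mem_setOf_eq, dotProduct_zero]
            have : 0 ≤ 1 - δ' := by linarith
            positivity)
    refine hb.trans ?_
    have e1 := h2 N
    have e2 := h1 N k hkN
    have e3 := h3 N k (le_trans (mul_le_mul_of_nonneg_right (by linarith) hN0.le) hkl)
    have e4 := hN2 N hNN2
    have e5 := measureReal_union_le (μ := gaussPrior k 1) {w | (1 + δ') * 1 * N ≤ w ⬝ᵥ w} {w | w ⬝ᵥ w ≤ (1 - δ') * 1 * N}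
    linarith

lemma LimL_all (t l : ℝ) (ht : 0 < t) (ht1 : t < 1) (hl : l < t) : LimL (t + 1 / t) l := by
  set z := t + 1 / t with hz
  have hinv : 1 < 1 / t := by rw [lt_div_iff₀ ht]; linarith
  have hti : t * (1 / t) = 1 := by field_simp
  by_contra hcon
  set S := {l : ℝ | LimL z l}
  have hSb : ∀ y ∈ S, y ≤ l := by
    intro y hy
    by_contra hh
    exact hcon (LimL_mono z y l (by linarith) hy)
  have hne : S.Nonempty := ⟨-1, LimL_neg z _ (by norm_num)⟩
  have hbdd : BddAbove S := ⟨l, hSb⟩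
  set m := sSup S with hm
  have hml : m ≤ l := csSup_le hne hSb
  have hmt : m < t := lt_of_le_of_lt hml hl
  have h1 : m * (z - m) < 1 := by
    have : 0 < (t - m) * (1 / t - m) := by apply mul_pos <;> linarith
    rw [hz]; nlinarith
  have hT : Tendsto (fun y : ℝ => m * (z - y)) (nhds m) (nhds (m * (z - m))) := by
    apply Continuous.tendsto; fun_prop
  obtain ⟨ε, hε, hball⟩ := Metric.eventually_nhds_iff.1 (hT.eventually (eventually_lt_nhds h1))
  obtain ⟨y, hyS, hy⟩ := exists_lt_of_lt_csSup hne (show m - ε < sSup S by linarith)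
  have hym : y ≤ m := le_csSup hbdd hyS
  have h2 : m * (z - y) < 1 := hball (by rw [Real.dist_eq, abs_lt]; constructor <;> linarith)
  have hzy : 0 < z - y := by rw [hz]; linarith
  have h3 : m < 1 / (z - y) := by rw [lt_div_iff₀ hzy]; exact h2
  obtain ⟨l', h4, h5⟩ := exists_between h3
  have : l' ∈ S := LimL_step z y l' hzy (by rwa [lt_div_iff₀ hzy] at h5) hyS
  have := le_csSup hbdd this
  linarith
end

section

abbrev Om (n : ℕ) : Type := (Fin n → ℝ) × Matrix (Fin n) (Fin n) ℝ

def mu (sig : ℝ) (n : ℕ) : Measure (Om n) := (gaussPrior n (sig ^ 2)).prod (noiseMeasure n)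

instance (sig : ℝ) (n : ℕ) : IsProbabilityMeasure (mu sig n) := by unfold mu; infer_instance

/-- Events of probability tending to one. -/
def PF (sig : ℝ) : Filter (Σ n, Om n) where
  sets := {A | Tendsto (fun n => (mu sig n).real {ω | (⟨n, ω⟩ : Σ n, Om n) ∉ A}) atTop (nhds 0)}
  univ_sets := by simp
  sets_of_superset := by
    intro A B hA hAB
    refine squeeze_zero (fun _ => measureReal_nonneg) (fun n => ?_) hA
    exact measureReal_mono fun ω hω h => hω (hAB h)
  inter_sets := by
    intro A B hA hB
    have := hA.add hB
    rw [add_zero] at this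
    refine squeeze_zero (fun _ => measureReal_nonneg) (fun n => ?_) this
    refine le_trans (measureReal_mono ?_) (measureReal_union_le _ _)
    intro ω hω
    simp only [Set.mem_setOf_eq, Set.mem_inter_iff, not_and_or] at hω
    exact hω

lemma PF_iff (sig : ℝ) (P : (Σ n, Om n) → Prop) : (∀ᶠ p in PF sig, P p) ↔
    Tendsto (fun n => (mu sig n).real {ω | ¬ P ⟨n, ω⟩}) atTop (nhds 0) := Iff.rfl

lemma PF_of_bound {sig : ℝ} {P : (Σ n, Om n) → Prop} (b : ℕ → ℝ) (hb : Tendsto b atTop (nhds 0))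
    (h : ∀ᶠ n in atTop, (mu sig n).real {ω | ¬ P ⟨n, ω⟩} ≤ b n) : ∀ᶠ p in PF sig, P p := by
  rw [PF_iff]
  exact squeeze_zero' (Eventually.of_forall fun _ => measureReal_nonneg) h hb

lemma PF_n {sig : ℝ} {P : ℕ → Prop} (h : ∀ᶠ n in atTop, P n) : ∀ᶠ p in PF sig, P p.1 := by
  refine PF_of_bound (fun _ => 0) tendsto_const_nhds ?_
  filter_upwards [h] with n hn
  simp [hn]

lemma PF_ae {sig : ℝ} {P : (Σ n, Om n) → Prop} (h : ∀ n, ∀ᵐ ω ∂(mu sig n), P ⟨n, ω⟩) :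
    ∀ᶠ p in PF sig, P p := by
  refine PF_of_bound (fun _ => 0) tendsto_const_nhds (Eventually.of_forall fun n => ?_)
  have := h n
  rw [ae_iff] at this
  simp [Measure.real, this]

lemma mu_le_of_fst {sig : ℝ} {n : ℕ} (A : Set (Fin n → ℝ)) :
    (mu sig n).real {ω | ω.1 ∈ A} = (gaussPrior n (sig^2)).real A := by
  have : {ω : Om n | ω.1 ∈ A} = A ×ˢ Set.univ := by ext ω; simp
  rw [this, mu, measureReal_prod_prod]; simp

lemma mu_le_of_snd {sig : ℝ} {n : ℕ} (A : Set (Matrix (Fin n) (Fin n) ℝ)) :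
    (mu sig n).real {ω | ω.2 ∈ A} = (noiseMeasure n).real A := by
  have : {ω : Om n | ω.2 ∈ A} = Set.univ ×ˢ A := by ext ω; simp
  rw [this, mu, measureReal_prod_prod]; simp

lemma mu_le_of_slice {sig : ℝ} {n : ℕ} (S : Set (Om n)) (hS : MeasurableSet S) (c : ℝ) (hc : 0 ≤ c)
    (h : ∀ s, (noiseMeasure n).real {Z | (s, Z) ∈ S} ≤ c) : (mu sig n).real S ≤ c := by
  apply ENNReal.toReal_le_of_le_ofReal hc
  unfold mu
  rw [Measure.prod_apply hS]
  calc _ ≤ ∫⁻ w, ENNReal.ofReal c ∂gaussPrior n (sig^2) := by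
          apply lintegral_mono
          intro w
          show noiseMeasure n {Z | (w, Z) ∈ S} ≤ _
          rw [← ENNReal.ofReal_toReal (measure_ne_top (noiseMeasure n) {Z | (w, Z) ∈ S})]
          exact ENNReal.ofReal_le_ofReal (h w)
      _ = _ := by simp

lemma PF_symm (sig : ℝ) : ∀ᶠ p in PF sig, (p.2.2)ᵀ = p.2.2 := by
  refine PF_ae fun n => ?_
  unfold mu
  exact Measure.quasiMeasurePreserving_snd.ae (noise_ae_symm n)

lemma PF_normS (sig : ℝ) (hsig : 0 < sig) :
    Tendsto (fun p : Σ n, Om n => (p.2.1 ⬝ᵥ p.2.1) / p.1) (PF sig) (nhds (sig^2)) := by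
  have hv : 0 < sig^2 := by positivity
  have key : ∀ δ : ℝ, 0 < δ → δ ≤ 1 → ∀ᶠ p in PF sig,
      (1 - δ) * sig^2 < (p.2.1 ⬝ᵥ p.2.1) / p.1 ∧ (p.2.1 ⬝ᵥ p.2.1) / p.1 < (1 + δ) * sig^2 := by
    intro δ hδ hδ1
    obtain ⟨c1, h10, h11, h1⟩ := norm_upper (sig^2) δ hv hδ
    obtain ⟨c2, h20, h21, h2⟩ := norm_lower (sig^2) δ hv hδ hδ1
    have e1 : ∀ᶠ p in PF sig, ¬ ((1 + δ) * sig^2 * p.1 ≤ p.2.1 ⬝ᵥ p.2.1) := by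
      refine PF_of_bound _ (tendsto_pow_atTop_nhds_zero_of_lt_one h10.le h11)
        (Eventually.of_forall fun n => ?_)
      simp only [not_not]
      exact (mu_le_of_fst {s | (1 + δ) * sig^2 * n ≤ s ⬝ᵥ s}).le.trans (h1 n n le_rfl)
    have e2 : ∀ᶠ p in PF sig, ¬ (p.2.1 ⬝ᵥ p.2.1 ≤ (1 - δ) * sig^2 * p.1) := by
      refine PF_of_bound _ (tendsto_pow_atTop_nhds_zero_of_lt_one h20.le h21)
        (Eventually.of_forall fun n => ?_)
      simp only [not_not]
      refine (mu_le_of_fst {s | s ⬝ᵥ s ≤ (1 - δ) * sig^2 * n}).le.trans (h2 n n ?_)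
      have : (0:ℝ) ≤ n := by positivity
      nlinarith
    filter_upwards [e1, e2, PF_n (eventually_gt_atTop 0)] with p h1 h2 hn
    have hn' : (0:ℝ) < p.1 := by exact_mod_cast hn
    push Not at h1 h2
    exact ⟨by rw [lt_div_iff₀ hn']; exact h2, by rw [div_lt_iff₀ hn']; exact h1⟩
  rw [Metric.tendsto_nhds]
  intro ε hε
  have h1 : 0 < min (ε / sig^2) 1 := by positivity
  filter_upwards [key _ h1 (min_le_right _ _)] with p hp
  have h2 : min (ε / sig^2) 1 * sig^2 ≤ ε := by
    calc _ ≤ ε / sig^2 * sig^2 := by gcongr; exact min_le_left _ _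
      _ = ε := by field_simp
  rw [Real.dist_eq, abs_lt]
  constructor <;> nlinarith [hp.1, hp.2]

lemma tendsto_n_mul_pow (c : ℝ) (h0 : 0 < c) (h1 : c < 1) :
    Tendsto (fun n : ℕ => (n:ℝ) * (3 * c ^ n)) atTop (nhds 0) := by
  have := (tendsto_self_mul_const_pow_of_lt_one h0.le h1).const_mul 3
  simp only [mul_zero] at this
  refine this.congr fun n => by ring

lemma U_cond (t g : ℝ) (ht : 0 < t) (h1 : t < g) (h2 : g < 1 / t) : 1 < g * (t + 1/t - g) := by
  have : 0 < (g - t) * (1/t - g) := by apply mul_pos <;> linarith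
  have : t * (1/t) = 1 := by field_simp
  nlinarith

lemma PF_U (sig t g : ℝ) (ht : 0 < t) (h1 : t < g) (h2 : g < 1 / t) :
    ∀ᶠ p in PF sig, p.2.2 ∈ Uset (1 / √p.1) (t + 1/t) g p.2.1 := by
  obtain ⟨c, hc0, hc1, hc⟩ := U_prob (t + 1/t) g (ht.trans h1) (U_cond t g ht h1 h2)
  refine PF_of_bound _ (tendsto_n_mul_pow c hc0 hc1) ?_
  filter_upwards [eventually_ge_atTop 1] with n hn
  refine mu_le_of_slice _ (Uset_joint_closed _ _ _).measurableSet.compl _ (by positivity) ?_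
  intro s
  exact hc n hn n le_rfl s

lemma PF_L (sig t l : ℝ) (hsig : 0 < sig) (ht : 0 < t) (ht1 : t < 1) (hl : l < t) :
    ∀ᶠ p in PF sig, p.2.2 ∈ Lset (1 / √p.1) (t + 1/t) l p.2.1 := by
  have h0 : ∀ᶠ p in PF sig, p.2.1 = 0 ∨ p.2.2 ∈ Lset (1 / √p.1) (t + 1/t) l p.2.1 := by
    rw [PF_iff, Metric.tendsto_atTop]
    intro ε hε
    obtain ⟨δ, hδ, N0, H⟩ := LimL_all t l ht ht1 hl (ε / 2) (by positivity)
    refine ⟨N0, fun n hn => ?_⟩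
    rw [Real.dist_eq, sub_zero, abs_of_nonneg measureReal_nonneg]
    refine lt_of_le_of_lt (b := ε / 2) ?_ (by linarith)
    refine mu_le_of_slice _ ?_ _ (by positivity) ?_
    · apply MeasurableSet.compl
      apply MeasurableSet.union
      · exact measurable_fst (measurableSet_singleton (0 : Fin n → ℝ))
      · exact (Lset_joint_open (n := n) (1/√n) (t+1/t) l).measurableSet
    · intro s
      by_cases hs : s = 0
      · simp [hs]; positivity
      · simp only [Set.mem_setOf_eq, hs, false_or]
        exact H n hn n le_rfl (by nlinarith [show (0:ℝ) ≤ n by positivity]) s hs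
  have hs := (PF_normS sig hsig).eventually (eventually_gt_nhds (show 0 < sig^2 by positivity))
  filter_upwards [h0, hs] with p h1 h2
  rcases h1 with h1 | h1
  · simp [h1] at h2
  · exact h1
end

section

/-- Continuous functions of polynomial growth. -/
def PG {ι : Type*} [Fintype ι] (f : (ι → ℝ) → ℝ) : Prop :=
  Continuous f ∧ ∃ C : ℝ, ∃ k : ℕ, 0 ≤ C ∧ ∀ x, |f x| ≤ C * (1 + x ⬝ᵥ x) ^ k

/-- Coercive potentials. -/
def Coer {ι : Type*} [Fintype ι] (V : (ι → ℝ) → ℝ) : Prop :=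
  Continuous V ∧ ∃ c : ℝ, 0 < c ∧ ∃ C : ℝ, ∀ x, c * (x ⬝ᵥ x) - C ≤ V x

section
variable {ι : Type*} [Fintype ι]

lemma dnn (x : ι → ℝ) : 0 ≤ x ⬝ᵥ x := by
  unfold dotProduct; exact Finset.sum_nonneg fun i _ => mul_self_nonneg _

lemma PG.const (c : ℝ) : PG (fun _ : ι → ℝ => c) :=
  ⟨continuous_const, |c|, 0, abs_nonneg _, by simp⟩

lemma PG.coord (i : ι) : PG (fun x : ι → ℝ => x i) := by
  refine ⟨continuous_apply i, 1, 1, zero_le_one, fun x => ?_⟩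
  have : x i * x i ≤ x ⬝ᵥ x := Finset.single_le_sum (f := fun i => x i * x i)
    (fun i _ => mul_self_nonneg _) (Finset.mem_univ i)
  rw [pow_one, one_mul, abs_le]
  constructor <;> nlinarith

lemma PG.mul {f g : (ι → ℝ) → ℝ} (hf : PG f) (hg : PG g) : PG (fun x => f x * g x) := by
  obtain ⟨cf, C, k, hC, hf⟩ := hf
  obtain ⟨cg, D, l, hD, hg⟩ := hg
  refine ⟨cf.mul cg, C * D, k + l, by positivity, fun x => ?_⟩
  rw [abs_mul, pow_add]
  have := dnn x
  calc _ ≤ (C * (1 + x ⬝ᵥ x) ^ k) * (D * (1 + x ⬝ᵥ x) ^ l) := by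
        gcongr; exact hf x; exact hg x
    _ = _ := by ring

lemma PG.add {f g : (ι → ℝ) → ℝ} (hf : PG f) (hg : PG g) : PG (fun x => f x + g x) := by
  obtain ⟨cf, C, k, hC, hf⟩ := hf
  obtain ⟨cg, D, l, hD, hg⟩ := hg
  refine ⟨cf.add cg, C + D, k + l, by positivity, fun x => ?_⟩
  have h1 : 1 ≤ 1 + x ⬝ᵥ x := by linarith [dnn x]
  calc _ ≤ |f x| + |g x| := abs_add_le _ _
    _ ≤ (C * (1 + x ⬝ᵥ x) ^ k) + (D * (1 + x ⬝ᵥ x) ^ l) := add_le_add (hf x) (hg x)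
    _ ≤ (C * (1 + x ⬝ᵥ x) ^ (k+l)) + (D * (1 + x ⬝ᵥ x) ^ (k+l)) := by
        gcongr <;> first | exact h1 | omega
    _ = _ := by ring

lemma PG.neg {f : (ι → ℝ) → ℝ} (hf : PG f) : PG (fun x => - f x) := by
  simpa using (PG.const (-1)).mul hf

lemma PG.sub {f g : (ι → ℝ) → ℝ} (hf : PG f) (hg : PG g) : PG (fun x => f x - g x) := by
  simpa [sub_eq_add_neg] using hf.add hg.neg

lemma PG.pow {f : (ι → ℝ) → ℝ} (hf : PG f) (k : ℕ) : PG (fun x => f x ^ k) := by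
  induction k with
  | zero => simpa using PG.const 1
  | succ k ih => simpa [pow_succ] using ih.mul hf

lemma PG.abs {f : (ι → ℝ) → ℝ} (hf : PG f) : PG (fun x => |f x|) :=
  ⟨hf.1.abs, by simpa using hf.2⟩

lemma PG.div {f : (ι → ℝ) → ℝ} (hf : PG f) (c : ℝ) : PG (fun x => f x / c) := by
  simpa [div_eq_mul_inv] using hf.mul (PG.const c⁻¹)

lemma PG.sum {κ : Type*} (s : Finset κ) {f : κ → (ι → ℝ) → ℝ} (hf : ∀ k, PG (f k)) :
    PG (fun x => ∑ k ∈ s, f k x) := by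
  classical
  induction s using Finset.induction_on with
  | empty => simpa using PG.const 0
  | insert a s ha ih => simpa [Finset.sum_insert ha] using (hf a).add ih

lemma PG.dotc (u : ι → ℝ) : PG (fun x : ι → ℝ => u ⬝ᵥ x) := by
  unfold dotProduct
  exact PG.sum _ fun i => (PG.const _).mul (PG.coord i)

lemma PG.dotx : PG (fun x : ι → ℝ => x ⬝ᵥ x) := by
  unfold dotProduct
  exact PG.sum _ fun i => (PG.coord i).mul (PG.coord i)

lemma PG.mv (B : Matrix ι ι ℝ) (i : ι) : PG (fun x : ι → ℝ => (B *ᵥ x) i) := PG.dotc (B i)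

lemma PG.qd (B : Matrix ι ι ℝ) : PG (fun x : ι → ℝ => x ⬝ᵥ (B *ᵥ x)) := by
  unfold dotProduct
  exact PG.sum _ fun i => (PG.coord i).mul (PG.mv B i)

lemma dot_add_le (x h : ι → ℝ) : (x + h) ⬝ᵥ (x + h) ≤ 2 * (x ⬝ᵥ x) + 2 * (h ⬝ᵥ h) := by
  have := dnn (x - h)
  simp only [add_dotProduct, dotProduct_add, sub_dotProduct, dotProduct_sub] at *
  rw [dotProduct_comm h x] at *
  linarith

lemma PG.shift {f : (ι → ℝ) → ℝ} (hf : PG f) (h : ι → ℝ) : PG (fun x => f (x + h)) := by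
  obtain ⟨cf, C, k, hC, hf⟩ := hf
  refine ⟨cf.comp (by fun_prop), C * (2 + 2 * (h ⬝ᵥ h)) ^ k, k, ?_, fun x => ?_⟩
  · have := dnn h; positivity
  · rw [mul_assoc, ← mul_pow]
    refine (hf _).trans ?_
    have h1 := dnn h
    have h2 := dnn x
    have h3 := dot_add_le x h
    have h4 := dnn (x + h)
    gcongr
    nlinarith [mul_nonneg h1 h2]

lemma integrable_exp_dot (c : ℝ) (hc : 0 < c) :
    Integrable (fun x : ι → ℝ => Real.exp (-(c * (x ⬝ᵥ x)))) := by
  have : (fun x : ι → ℝ => Real.exp (-(c * (x ⬝ᵥ x)))) =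
      fun x => ∏ i, Real.exp (-c * x i ^ 2) := by
    ext x
    rw [← Real.exp_sum]
    congr 1
    simp only [dotProduct, Finset.mul_sum, ← Finset.sum_neg_distrib]
    exact Finset.sum_congr rfl fun i _ => by ring
  rw [this]
  exact Integrable.fintype_prod (f := fun _ y => Real.exp (-c * y ^ 2))
    fun i => integrable_exp_neg_mul_sq hc

lemma poly_exp (c : ℝ) (hc : 0 < c) (k : ℕ) :
    ∃ K : ℝ, 0 ≤ K ∧ ∀ y : ℝ, 0 ≤ y → (1 + y) ^ k ≤ K * Real.exp (c * y) := by
  set d := c / (k + 1) with hd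
  have hd0 : 0 < d := by positivity
  refine ⟨(1 + 1/d) ^ k, by positivity, fun y hy => ?_⟩
  have h1 : 1 + y ≤ (1 + 1/d) * Real.exp (d * y) := by
    have := Real.add_one_le_exp (d * y)
    calc 1 + y ≤ (1 + 1/d) * (d * y + 1) := by
          have : 1 / d * d = 1 := by field_simp
          have h2 : 0 ≤ 1/d := by positivity
          nlinarith [mul_nonneg hd0.le hy]
      _ ≤ _ := by gcongr
  calc (1 + y) ^ k ≤ ((1 + 1/d) * Real.exp (d * y)) ^ k := by gcongr
    _ = (1 + 1/d) ^ k * Real.exp (k * (d * y)) := by rw [mul_pow, ← Real.exp_nat_mul]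
    _ ≤ _ := by
      have h3 : k * d ≤ c := by
        rw [hd, mul_div_assoc', div_le_iff₀ (by positivity)]
        nlinarith
      have h4 : k * (d * y) ≤ c * y := by nlinarith
      gcongr

lemma PG.integrable_exp {f V : (ι → ℝ) → ℝ} (hf : PG f) (hV : Coer V) :
    Integrable (fun x => f x * Real.exp (-V x)) := by
  obtain ⟨cf, C, k, hC, hf⟩ := hf
  obtain ⟨cV, c, hc, D, hV⟩ := hV
  obtain ⟨K, hK, hKk⟩ := poly_exp (c/2) (by positivity) k
  refine ((integrable_exp_dot (ι := ι) (c/2) (by positivity)).const_mul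
    (C * K * Real.exp D)).mono' (cf.mul (by fun_prop)).aestronglyMeasurable
    (Eventually.of_forall fun x => ?_)
  rw [Real.norm_eq_abs, abs_mul, Real.abs_exp]
  calc _ ≤ (C * (K * Real.exp (c/2 * (x ⬝ᵥ x)))) * Real.exp (D - c * (x ⬝ᵥ x)) := by
        gcongr
        · exact (hf x).trans (by gcongr; exact hKk _ (dnn x))
        · linarith [hV x]
    _ = C * K * Real.exp D * Real.exp (-(c/2*(x ⬝ᵥ x))) := by
        rw [show -(c/2*(x ⬝ᵥ x)) = c/2 * (x ⬝ᵥ x) + (- (c * (x ⬝ᵥ x))) by ring,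
          Real.exp_add, sub_eq_add_neg, Real.exp_add]
        ring

/-- Gibbs measure with potential `V`. -/
def gm (V : (ι → ℝ) → ℝ) : Measure (ι → ℝ) := volume.tilted (fun x => - V x)

lemma Coer.integrable {V : (ι → ℝ) → ℝ} (hV : Coer V) : Integrable (fun x => Real.exp (-V x)) := by
  simpa using (PG.const (ι := ι) 1).integrable_exp hV

lemma Coer.prob {V : (ι → ℝ) → ℝ} (hV : Coer V) : IsProbabilityMeasure (gm V) :=
  isProbabilityMeasure_tilted hV.integrable

lemma Coer.pos {V : (ι → ℝ) → ℝ} (hV : Coer V) : 0 < ∫ x, Real.exp (-V x) :=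
  integral_exp_pos hV.integrable

lemma gm_int (V : (ι → ℝ) → ℝ) (f : (ι → ℝ) → ℝ) :
    ∫ x, f x ∂(gm V) = (∫ x, f x * Real.exp (-V x)) / ∫ x, Real.exp (-V x) := by
  unfold gm
  rw [integral_tilted, ← integral_div]
  congr 1; ext x
  rw [smul_eq_mul]; ring

lemma PG.int {f V : (ι → ℝ) → ℝ} (hf : PG f) (hV : Coer V) : Integrable f (gm V) := by
  unfold gm
  have h := hf.integrable_exp hV
  rw [integrable_tilted_iff hV.integrable]
  simpa [mul_comm] using h

end
end

section
section
variable {ι : Type*} [Fintype ι]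

lemma gm_integrable_iff {V : (ι → ℝ) → ℝ} (hV : Coer V) (f : (ι → ℝ) → ℝ) :
    Integrable f (gm V) ↔ Integrable (fun x => f x * Real.exp (-V x)) := by
  unfold gm
  rw [integrable_tilted_iff hV.integrable]
  simp [mul_comm]

lemma ibp {V f f' V' : (ι → ℝ) → ℝ} (hV : Coer V) (v : ι → ℝ)
    (h1 : Integrable f (gm V)) (h2 : Integrable f' (gm V))
    (h3 : Integrable (fun x => f x * V' x) (gm V))
    (hf : ∀ x, HasLineDerivAt ℝ f (f' x) x v) (hVd : ∀ x, HasLineDerivAt ℝ V (V' x) x v) :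
    ∫ x, f' x ∂(gm V) = ∫ x, f x * V' x ∂(gm V) := by
  rw [gm_integrable_iff hV] at h1 h2 h3
  have := integral_bilinear_hasLineDerivAt_right_eq_neg_left_of_integrable (μ := volume)
    (f := f) (f' := f') (g := fun x => Real.exp (-V x))
    (g' := fun x => Real.exp (-V x) * (- V' x)) (v := v) (B := ContinuousLinearMap.mul ℝ ℝ)
    (by simpa using h2) (by
      refine h3.neg.congr (Eventually.of_forall fun x => ?_)
      simp only [Pi.neg_apply, ContinuousLinearMap.mul_apply']; ring) (by simpa using h1)
    (fun x _ => hf x) (fun x _ => by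
      have h := hVd x
      unfold HasLineDerivAt at h ⊢
      have h' := h.neg.exp
      simpa using h')
  simp only [ContinuousLinearMap.mul_apply'] at this
  rw [gm_int, gm_int]
  congr 1
  rw [← neg_inj, ← this, ← integral_neg]
  congr 1; ext x; ring

/-- Jensen. -/
lemma jensen {V f W : (ι → ℝ) → ℝ} (hV : Coer V) (hW : Coer W) (hf : PG f)
    (h : ∀ x, V x - f x = W x) :
    Real.exp (∫ x, f x ∂(gm V)) * ∫ x, Real.exp (-V x) ≤ ∫ x, Real.exp (-W x) := by
  set m := ∫ x, f x ∂(gm V) with hm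
  have e1 := hf.integrable_exp hV
  have e2 := hV.integrable
  have hm' : ∫ x, f x * Real.exp (-V x) = m * ∫ x, Real.exp (-V x) := by
    rw [hm, gm_int, div_mul_cancel₀ _ hV.pos.ne']
  calc _ = ∫ x, Real.exp m * (f x * Real.exp (-V x) + (1 - m) * Real.exp (-V x)) := by
        rw [integral_const_mul, integral_add e1 (e2.const_mul _), integral_const_mul, hm']; ring
    _ ≤ _ := by
        apply integral_mono ((e1.add (e2.const_mul _)).const_mul _) hW.integrable
        intro x
        show Real.exp m * (f x * Real.exp (-V x) + (1 - m) * Real.exp (-V x)) ≤ Real.exp (-W x)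
        have := Real.add_one_le_exp (f x - m)
        rw [← h x, show -(V x - f x) = m + (f x - m) + (- V x) by ring, Real.exp_add, Real.exp_add]
        rw [← add_mul, ← mul_assoc]
        gcongr
        linarith

lemma lineDeriv_coord [DecidableEq ι] (j i : ι) (x : ι → ℝ) :
    HasLineDerivAt ℝ (fun x : ι → ℝ => x j) (if j = i then 1 else 0) x (Pi.single i 1) := by
  unfold HasLineDerivAt
  simp only [Pi.add_apply, Pi.smul_apply, smul_eq_mul, Pi.single_apply]
  simpa using ((hasDerivAt_id (0:ℝ)).mul_const (if j = i then (1:ℝ) else 0)).const_add (x j)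

lemma lineDeriv_qd {B : Matrix ι ι ℝ} (hB : Bᵀ = B) (x v : ι → ℝ) :
    HasLineDerivAt ℝ (fun x : ι → ℝ => x ⬝ᵥ (B *ᵥ x)) (2 * (v ⬝ᵥ (B *ᵥ x))) x v := by
  unfold HasLineDerivAt
  have hs : x ⬝ᵥ (B *ᵥ v) = v ⬝ᵥ (B *ᵥ x) := by
    rw [dotProduct_mulVec, ← mulVec_transpose, hB, dotProduct_comm]
  have : (fun t : ℝ => (x + t • v) ⬝ᵥ (B *ᵥ (x + t • v))) = fun t =>
      x ⬝ᵥ (B *ᵥ x) + t * (2 * (v ⬝ᵥ (B *ᵥ x))) + t ^ 2 * (v ⬝ᵥ (B *ᵥ v)) := by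
    ext t
    simp only [mulVec_add, mulVec_smul, add_dotProduct, dotProduct_add, smul_dotProduct,
      dotProduct_smul, smul_eq_mul, hs]
    ring
  show HasDerivAt (fun t : ℝ => (x + t • v) ⬝ᵥ (B *ᵥ (x + t • v))) _ _
  rw [this]
  have h1 := (((hasDerivAt_id (0:ℝ)).mul_const (2 * (v ⬝ᵥ (B *ᵥ x)))).const_add
    (x ⬝ᵥ (B *ᵥ x))).add (((hasDerivAt_id (0:ℝ)).pow 2).mul_const (v ⬝ᵥ (B *ᵥ v)))
  refine (h1.congr_deriv (by simp)).congr_of_eventuallyEq (Eventually.of_forall fun t => ?_)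
  simp

lemma lineDeriv_dot (x v : ι → ℝ) :
    HasLineDerivAt ℝ (fun x : ι → ℝ => x ⬝ᵥ x) (2 * (v ⬝ᵥ x)) x v := by
  classical
  simpa using lineDeriv_qd (B := (1 : Matrix ι ι ℝ)) (by simp) x v

lemma HasLineDerivAt.mul' {f g : (ι → ℝ) → ℝ} {a b : ℝ} {x v : ι → ℝ}
    (hf : HasLineDerivAt ℝ f a x v) (hg : HasLineDerivAt ℝ g b x v) :
    HasLineDerivAt ℝ (fun x => f x * g x) (a * g x + f x * b) x v := by
  unfold HasLineDerivAt at *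
  have := HasDerivAt.mul hf hg
  simp only [zero_smul, add_zero] at this
  exact this

/-- quadratic-quartic potential -/
def UU (B : Matrix ι ι ℝ) (κ : ℝ) (x : ι → ℝ) : ℝ := (1/2) * (x ⬝ᵥ (B *ᵥ x)) + κ * (x ⬝ᵥ x) ^ 2

lemma UU_PG (B : Matrix ι ι ℝ) (κ : ℝ) : PG (UU B κ) :=
  ((PG.const _).mul (PG.qd B)).add ((PG.const _).mul (PG.dotx.pow 2))

lemma UU_deriv {B : Matrix ι ι ℝ} (hB : Bᵀ = B) (κ : ℝ) (x v : ι → ℝ) :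
    HasLineDerivAt ℝ (UU B κ) (v ⬝ᵥ (B *ᵥ x) + 4 * κ * (x ⬝ᵥ x) * (v ⬝ᵥ x)) x v := by
  have h1 := lineDeriv_qd hB x v
  have h2 := (lineDeriv_dot x v).mul' (lineDeriv_dot x v)
  unfold HasLineDerivAt at *
  have := (h1.const_mul (1/2)).add (h2.const_mul κ)
  refine (this.congr_deriv (by ring)).congr_of_eventuallyEq (Eventually.of_forall fun t => ?_)
  simp only [UU, Pi.add_apply]; ring

lemma quad_bound (B : Matrix ι ι ℝ) : ∃ M : ℝ, 0 ≤ M ∧ ∀ x : ι → ℝ, |x ⬝ᵥ (B *ᵥ x)| ≤ M * (x ⬝ᵥ x) := by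
  refine ⟨∑ i, ∑ j, |B i j|, by positivity, fun x => ?_⟩
  have hc : ∀ i, x i * x i ≤ x ⬝ᵥ x := fun i => Finset.single_le_sum (f := fun i => x i * x i)
    (fun i _ => mul_self_nonneg _) (Finset.mem_univ i)
  rw [Finset.sum_mul]
  simp only [Finset.sum_mul]
  have e : x ⬝ᵥ (B *ᵥ x) = ∑ i, ∑ j, x i * (B i j * x j) := by
    simp only [dotProduct, mulVec, Finset.mul_sum]
  rw [e]
  refine (Finset.abs_sum_le_sum_abs _ _).trans (Finset.sum_le_sum fun i _ => ?_)
  refine (Finset.abs_sum_le_sum_abs _ _).trans (Finset.sum_le_sum fun j _ => ?_)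
  have : |x i * x j| ≤ x ⬝ᵥ x := by
    rw [abs_le]
    constructor <;> nlinarith [hc i, hc j, sq_nonneg (x i + x j), sq_nonneg (x i - x j)]
  rw [show x i * (B i j * x j) = B i j * (x i * x j) by ring, abs_mul]
  gcongr

lemma UU_coer_quartic (B : Matrix ι ι ℝ) (κ : ℝ) (hκ : 0 < κ) : Coer (UU B κ) := by
  obtain ⟨M, hM, h⟩ := quad_bound B
  refine ⟨(UU_PG B κ).1, 1, one_pos, (1 + M/2)^2/(4*κ), fun x => ?_⟩
  have h1 := (abs_le.1 (h x)).1
  have : 0 ≤ κ * ((x ⬝ᵥ x) - (1+M/2)/(2*κ))^2 := by positivity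
  have e : κ * ((x ⬝ᵥ x) - (1+M/2)/(2*κ))^2 = κ * (x ⬝ᵥ x)^2 - (1+M/2)*(x ⬝ᵥ x) + (1 + M/2)^2/(4*κ) := by
    field_simp; ring
  unfold UU
  linarith

lemma UU_coer_quad (B : Matrix ι ι ℝ) (κ ε : ℝ) (hκ : 0 ≤ κ) (hε : 0 < ε)
    (h : ∀ x, ε * (x ⬝ᵥ x) ≤ x ⬝ᵥ (B *ᵥ x)) : Coer (UU B κ) := by
  refine ⟨(UU_PG B κ).1, ε/2, by positivity, 0, fun x => ?_⟩
  have := mul_nonneg hκ (sq_nonneg (x ⬝ᵥ x))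
  unfold UU; linarith [h x]

lemma single_dot' [DecidableEq ι] (i : ι) (x : ι → ℝ) : (Pi.single i 1 : ι → ℝ) ⬝ᵥ x = x i := by simp

/-- first IBP: `δ_ij = ⟨x_j ((Bx)_i + 4κ‖x‖² x_i)⟩` -/
lemma ibp1 [DecidableEq ι] {B : Matrix ι ι ℝ} (hB : Bᵀ = B) (κ : ℝ) (hV : Coer (UU B κ)) (i j : ι) :
    (if j = i then 1 else 0 : ℝ) = ∫ x, x j * ((B *ᵥ x) i + 4 * κ * (x ⬝ᵥ x) * x i) ∂(gm (UU B κ)) := by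
  have := hV.prob
  have h := ibp (f := fun x => x j) (f' := fun _ => if j = i then 1 else 0)
    (V' := fun x => (Pi.single i 1) ⬝ᵥ (B *ᵥ x) + 4 * κ * (x ⬝ᵥ x) * ((Pi.single i 1) ⬝ᵥ x)) hV (Pi.single i 1) ((PG.coord j).int hV)
    ((PG.const _).int hV) ?_ (lineDeriv_coord j i) (fun x => UU_deriv hB κ x _)
  · simpa only [single_dot', integral_const, probReal_univ, one_smul] using h
  · simp only [single_dot']
    exact ((PG.coord j).mul ((PG.mv B i).add (((PG.const _).mul PG.dotx).mul (PG.coord i)))).int hV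

/-- second IBP -/
lemma ibp2 [DecidableEq ι] {B : Matrix ι ι ℝ} (hB : Bᵀ = B) (hV : Coer (UU B 0)) (i j : ι) :
    ∫ x, (2 * x i * x j + (x ⬝ᵥ x) * (if j = i then 1 else 0 : ℝ)) ∂(gm (UU B 0)) =
      ∫ x, (x ⬝ᵥ x) * x j * (B *ᵥ x) i ∂(gm (UU B 0)) := by
  have h := ibp (f := fun x => (x ⬝ᵥ x) * x j)
    (f' := fun x => (2 * ((Pi.single i 1) ⬝ᵥ x)) * x j + (x ⬝ᵥ x) * (if j = i then 1 else 0))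
    (V' := fun x => (Pi.single i 1) ⬝ᵥ (B *ᵥ x) + 4 * 0 * (x ⬝ᵥ x) * ((Pi.single i 1) ⬝ᵥ x)) hV (Pi.single i 1)
    ((PG.dotx.mul (PG.coord j)).int hV)
    ?_ ?_ (fun x => (lineDeriv_dot x _).mul' (lineDeriv_coord j i x)) (fun x => UU_deriv hB 0 x _)
  · simpa only [single_dot', mul_zero, zero_mul, add_zero] using h
  · simp only [single_dot']
    exact ((((PG.const _).mul (PG.coord i)).mul (PG.coord j)).add (PG.dotx.mul (PG.const _))).int hV
  · simp only [single_dot']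
    exact ((PG.dotx.mul (PG.coord j)).mul ((PG.mv B i).add (((PG.const _).mul PG.dotx).mul (PG.coord i)))).int hV
end
end

section
section
variable {ι : Type*} [Fintype ι]

/-- potential of a product of centered Gaussians -/
def GV (v : ι → NNReal) (x : ι → ℝ) : ℝ := ∑ i, x i ^ 2 / (2 * v i)

lemma GV_PG (v : ι → NNReal) : PG (GV v) :=
  PG.sum _ fun i => ((PG.coord i).pow 2).div _

lemma GV_coer (v : ι → NNReal) (hv : ∀ i, v i ≠ 0) : Coer (GV v) := by
  refine ⟨(GV_PG v).1, 1 / (2 * (1 + ∑ i, (v i : ℝ))), by positivity, 0, fun x => ?_⟩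
  rw [sub_zero, GV, dotProduct, Finset.mul_sum]
  refine Finset.sum_le_sum fun i _ => ?_
  have h0 : (0:ℝ) < v i := by exact_mod_cast pos_iff_ne_zero.2 (hv i)
  have h1 : (v i : ℝ) ≤ 1 + ∑ i, (v i : ℝ) := by
    have := Finset.single_le_sum (f := fun i => (v i : ℝ)) (fun i _ => NNReal.coe_nonneg _) (Finset.mem_univ i)
    linarith
  rw [← sq, div_mul_eq_mul_div, one_mul]
  gcongr

lemma pi_gauss_eq (v : ι → NNReal) (hv : ∀ i, v i ≠ 0) :
    Measure.pi (fun i => gaussianReal 0 (v i)) =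
      volume.withDensity (fun x : ι → ℝ => ENNReal.ofReal (∏ i, gaussianPDFReal 0 (v i) (x i))) := by
  refine Measure.pi_eq fun s hs => ?_
  rw [withDensity_apply _ (MeasurableSet.univ_pi hs), volume_pi, Measure.restrict_pi_pi,
    ← ofReal_integral_eq_lintegral_ofReal]
  · rw [integral_fintype_prod_eq_prod, ENNReal.ofReal_prod_of_nonneg]
    · exact Finset.prod_congr rfl fun i _ => (gaussianReal_apply_eq_integral 0 (hv i) (s i)).symm
    · intro i _
      exact integral_nonneg fun x => gaussianPDFReal_nonneg _ _ _
  · exact Integrable.fintype_prod_dep (f := fun i y => gaussianPDFReal 0 (v i) y)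
      fun i => (integrable_gaussianPDFReal 0 (v i)).restrict
  · exact Eventually.of_forall fun x => Finset.prod_nonneg fun i _ => gaussianPDFReal_nonneg _ _ _

lemma pi_gauss_gm (v : ι → NNReal) (hv : ∀ i, v i ≠ 0) :
    Measure.pi (fun i => gaussianReal 0 (v i)) = gm (GV v) := by
  have hp : ∀ x : ι → ℝ, ∏ i, gaussianPDFReal 0 (v i) (x i) =
      (∏ i, (√(2 * Real.pi * v i))⁻¹) * Real.exp (-GV v x) := by
    intro x
    simp only [gaussianPDFReal, GV, sub_zero, Finset.prod_mul_distrib, ← Real.exp_sum,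
      ← Finset.sum_neg_distrib, neg_div]
  have h1 : ∫ x : ι → ℝ, ∏ i, gaussianPDFReal 0 (v i) (x i) = 1 := by
    rw [integral_fintype_prod_volume_eq_prod]
    simp [integral_gaussianPDFReal_eq_one _ (hv _)]
  simp only [hp] at h1
  rw [integral_const_mul] at h1
  rw [pi_gauss_eq v hv, gm, Measure.tilted]
  congr 1; ext x
  rw [hp, eq_div_of_mul_eq (GV_coer v hv).pos.ne' h1]
  congr 1; ring

/-- effective coupling matrix -/
def BB (n : ℕ) (sig' lam' : ℝ) (Y : Matrix (Fin n) (Fin n) ℝ) : Matrix (Fin n) (Fin n) ℝ :=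
  (1 / sig'^2) • (1 : Matrix (Fin n) (Fin n) ℝ) - √(lam'/n) • Y

lemma frob_expand {n : ℕ} (c : ℝ) (Y : Matrix (Fin n) (Fin n) ℝ) (x : Fin n → ℝ) :
    frobSq (Y - c • vecMulVec x x) = frobSq Y - 2 * c * (x ⬝ᵥ (Y *ᵥ x)) + c^2 * (x ⬝ᵥ x)^2 := by
  have e1 : x ⬝ᵥ (Y *ᵥ x) = ∑ i, ∑ j, x i * (Y i j * x j) := by
    simp only [dotProduct, mulVec, Finset.mul_sum]
  have e2 : (x ⬝ᵥ x)^2 = ∑ i, ∑ j, (x i * x i) * (x j * x j) := by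
    rw [sq, dotProduct, Finset.sum_mul_sum]
  rw [e1, e2]
  simp only [frobSq, Finset.mul_sum, ← Finset.sum_sub_distrib, ← Finset.sum_add_distrib]
  refine Finset.sum_congr rfl fun i _ => Finset.sum_congr rfl fun j _ => ?_
  simp [vecMulVec_apply]; ring

lemma gibbs_eq {n : ℕ} {sig' lam' : ℝ} (hs : 0 < sig') (hl : 0 < lam')
    (Y : Matrix (Fin n) (Fin n) ℝ) (f : (Fin n → ℝ) → ℝ) :
    gibbs n sig' lam' Y f = ∫ x, f x ∂(gm (UU (BB n sig' lam' Y) (lam'/(4*n)))) := by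
  have hv : ∀ i : Fin n, (fun _ => Real.toNNReal (sig'^2)) i ≠ 0 := by
    intro i; simp; positivity
  have key : ∀ x : Fin n → ℝ, weight n lam' Y x * Real.exp (-GV (fun _ : Fin n => Real.toNNReal (sig'^2)) x) =
      Real.exp (-(1/4) * frobSq Y) * Real.exp (-UU (BB n sig' lam' Y) (lam'/(4*n)) x) := by
    intro x
    rw [weight, frob_expand, ← Real.exp_add, ← Real.exp_add]
    congr 1
    rw [Real.sq_sqrt (by positivity), GV, UU, BB]
    have : ∑ i, x i ^ 2 / (2 * ((Real.toNNReal (sig'^2) : NNReal) : ℝ)) = (x ⬝ᵥ x) / (2 * sig'^2) := by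
      rw [Real.coe_toNNReal _ (by positivity), dotProduct, Finset.sum_div]
      exact Finset.sum_congr rfl fun i _ => by rw [sq]
    rw [this, sub_mulVec, smul_mulVec, smul_mulVec, one_mulVec, dotProduct_sub, dotProduct_smul,
      dotProduct_smul, smul_eq_mul, smul_eq_mul]
    field_simp
    ring
  unfold gibbs gaussPrior
  rw [pi_gauss_gm _ hv, gm_int, gm_int, gm_int, div_div_div_cancel_right₀ (GV_coer _ hv).pos.ne']
  simp only [mul_assoc, key]
  have : ∀ x : Fin n → ℝ, f x * (Real.exp (-(1/4) * frobSq Y) * Real.exp (-UU (BB n sig' lam' Y) (lam'/(4*n)) x))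
     = Real.exp (-(1/4) * frobSq Y) * (f x * Real.exp (-UU (BB n sig' lam' Y) (lam'/(4*n)) x)) := by
    intro x; ring
  simp only [this]
  rw [integral_const_mul, integral_const_mul, mul_div_mul_left _ _ (Real.exp_pos _).ne']
end
end

section
section
variable {ι : Type*} [Fintype ι] [DecidableEq ι]

lemma det_unit_of_lower {B : Matrix ι ι ℝ} {ε : ℝ} (hε : 0 < ε)
    (h : ∀ x, ε * (x ⬝ᵥ x) ≤ x ⬝ᵥ (B *ᵥ x)) : IsUnit B.det := by
  rw [isUnit_iff_ne_zero]
  intro h0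
  obtain ⟨v, hv, hBv⟩ := exists_mulVec_eq_zero_iff.2 h0
  have := h v
  rw [hBv, dotProduct_zero] at this
  have h1 : 0 ≤ v ⬝ᵥ v := dnn v
  have h2 : v ⬝ᵥ v = 0 := by nlinarith
  exact hv (dotProduct_self_eq_zero.1 h2)

lemma inv_solve {B : Matrix ι ι ℝ} {ε : ℝ} (hε : 0 < ε)
    (h : ∀ x, ε * (x ⬝ᵥ x) ≤ x ⬝ᵥ (B *ᵥ x)) (u : ι → ℝ) : B *ᵥ (B⁻¹ *ᵥ u) = u := by
  rw [mulVec_mulVec, mul_nonsing_inv _ (det_unit_of_lower hε h), one_mulVec]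

lemma solve_bounds {ε : ℝ} (hε : 0 < ε) (y u : ι → ℝ) (h : ε * (y ⬝ᵥ y) ≤ y ⬝ᵥ u) :
    y ⬝ᵥ y ≤ (u ⬝ᵥ u) / ε ^ 2 ∧ y ⬝ᵥ u ≤ (u ⬝ᵥ u) / ε ∧ 0 ≤ y ⬝ᵥ u := by
  have h1 := dnn (u - ε • y)
  simp only [sub_dotProduct, dotProduct_sub, smul_dotProduct, dotProduct_smul, smul_eq_mul] at h1
  rw [dotProduct_comm u y] at h1
  have h2 := dnn y
  refine ⟨?_, ?_, ?_⟩
  · rw [le_div_iff₀ (by positivity)]; nlinarith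
  · rw [le_div_iff₀ (by positivity)]; nlinarith
  · nlinarith

lemma trace_eq_sum (A : Matrix ι ι ℝ) : A.trace = ∑ i, (Pi.single i 1 : ι → ℝ) ⬝ᵥ (A *ᵥ (Pi.single i 1)) := by
  simp [trace]

lemma trace_inv_sq {B : Matrix ι ι ℝ} (hB : Bᵀ = B) {ε : ℝ} (hε : 0 < ε)
    (h : ∀ x, ε * (x ⬝ᵥ x) ≤ x ⬝ᵥ (B *ᵥ x)) : (B⁻¹ * B⁻¹).trace ≤ Fintype.card ι / ε ^ 2 := by
  rw [trace_eq_sum]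
  have : ∀ i : ι, (Pi.single i 1 : ι → ℝ) ⬝ᵥ ((B⁻¹ * B⁻¹) *ᵥ (Pi.single i 1)) ≤ 1 / ε ^ 2 := by
    intro i
    set u : ι → ℝ := Pi.single i 1 with hu
    have hC : (B⁻¹)ᵀ = B⁻¹ := by rw [transpose_nonsing_inv, hB]
    have h1 := (solve_bounds hε (B⁻¹ *ᵥ u) u (by
      have := h (B⁻¹ *ᵥ u); rwa [inv_solve hε h] at this)).1
    rw [← mulVec_mulVec, dotProduct_mulVec, ← mulVec_transpose, hC]
    refine h1.trans_eq ?_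
    simp [hu]
  calc _ ≤ ∑ i : ι, 1 / ε^2 := Finset.sum_le_sum fun i _ => this i
    _ = _ := by simp; ring

variable {B : Matrix ι ι ℝ}

lemma ga_cov (hB : Bᵀ = B) (hV : Coer (UU B 0)) (i j : ι) :
    ∫ x, x i * x j ∂(gm (UU B 0)) = B⁻¹ i j := by
  have : B * (Matrix.of fun i j => ∫ x, x i * x j ∂(gm (UU B 0))) = 1 := by
    ext i j
    have h := ibp1 hB 0 hV i j
    simp only [mul_zero, zero_mul, add_zero] at h
    rw [one_apply, eq_comm, show (if i = j then (1:ℝ) else 0) = if j = i then 1 else 0 by simp [eq_comm], h,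
      mul_apply]
    simp only [of_apply, ← integral_const_mul]
    rw [← integral_finset_sum _ fun k _ => (((PG.const (B i k)).mul ((PG.coord k).mul (PG.coord j))).int hV)]
    congr 1; ext x
    simp only [mulVec, dotProduct, Finset.mul_sum]
    exact Finset.sum_congr rfl fun k _ => by ring
  rw [inv_eq_right_inv this, of_apply]

lemma ga_tr (hB : Bᵀ = B) (hV : Coer (UU B 0)) :
    ∫ x, x ⬝ᵥ x ∂(gm (UU B 0)) = B⁻¹.trace := by
  simp only [dotProduct]
  rw [integral_finset_sum _ fun k _ => (((PG.coord k).mul (PG.coord k)).int hV)]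
  simp [ga_cov hB hV, trace]

lemma ga_q (hB : Bᵀ = B) (hV : Coer (UU B 0)) :
    ∫ x, (x ⬝ᵥ x)^2 ∂(gm (UU B 0)) = B⁻¹.trace ^ 2 + 2 * (B⁻¹ * B⁻¹).trace := by
  have hdet : B * B⁻¹ = 1 := by
    have : B * (Matrix.of fun i j => ∫ x, x i * x j ∂(gm (UU B 0))) = 1 := by
      ext i j
      have h := ibp1 hB 0 hV i j
      simp only [mul_zero, zero_mul, add_zero] at h
      rw [one_apply, eq_comm, show (if i = j then (1:ℝ) else 0) = if j = i then 1 else 0 by simp [eq_comm], h,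
        mul_apply]
      simp only [of_apply, ← integral_const_mul]
      rw [← integral_finset_sum _ fun k _ => (((PG.const (B i k)).mul ((PG.coord k).mul (PG.coord j))).int hV)]
      congr 1; ext x
      simp only [mulVec, dotProduct, Finset.mul_sum]
      exact Finset.sum_congr rfl fun k _ => by ring
    rw [inv_eq_right_inv this]; exact this
  have hdet' : B⁻¹ * B = 1 := mul_eq_one_comm.1 hdet
  set N : Matrix ι ι ℝ := Matrix.of fun i j => ∫ x, (x ⬝ᵥ x) * (x i * x j) ∂(gm (UU B 0)) with hN
  have h1 : B * N = (2:ℝ) • B⁻¹ + B⁻¹.trace • (1 : Matrix ι ι ℝ) := by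
    ext i j
    have h := ibp2 hB hV i j
    rw [integral_add, integral_mul_const, ga_tr hB hV] at h
    · have e : ∀ x : ι → ℝ, 2 * x i * x j = 2 * (x i * x j) := fun x => by ring
      simp only [e] at h
      rw [integral_const_mul, ga_cov hB hV] at h
      simp only [Matrix.add_apply, Matrix.smul_apply, smul_eq_mul, one_apply]
      rw [show (if i = j then (1:ℝ) else 0) = if j = i then 1 else 0 by simp [eq_comm], h, mul_apply]
      simp only [hN, of_apply, ← integral_const_mul]
      rw [← integral_finset_sum _ fun k _ => (((PG.const (B i k)).mul (PG.dotx.mul ((PG.coord k).mul (PG.coord j)))).int hV)]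
      congr 1; ext x
      simp only [mulVec]
      conv_rhs => rw [dotProduct_comm (B i) x]
      rw [show (x ⬝ᵥ x) * x j * (x ⬝ᵥ B i) = ∑ k, (x ⬝ᵥ x) * x j * (x k * B i k) by
        rw [← Finset.mul_sum]; rfl]
      exact Finset.sum_congr rfl fun k _ => by ring
    · exact (((PG.const _).mul (PG.coord i)).mul (PG.coord j)).int hV
    · exact (PG.dotx.mul (PG.const _)).int hV
  have h2 : N = (2:ℝ) • (B⁻¹ * B⁻¹) + B⁻¹.trace • B⁻¹ := by
    calc N = B⁻¹ * (B * N) := by rw [← mul_assoc, hdet', one_mul]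
      _ = _ := by rw [h1, mul_add, Matrix.mul_smul, Matrix.mul_smul, mul_one]
  have h3 : ∫ x, (x ⬝ᵥ x)^2 ∂(gm (UU B 0)) = N.trace := by
    simp only [trace, diag_apply, hN, of_apply]
    rw [← integral_finset_sum _ fun k _ => ((PG.dotx.mul ((PG.coord k).mul (PG.coord k))).int hV)]
    congr 1; ext x
    rw [← Finset.mul_sum, sq]; rfl
  rw [h3, h2, trace_add, trace_smul, trace_smul, smul_eq_mul, smul_eq_mul]; ring

lemma ga_odd {f : (ι → ℝ) → ℝ} (hf : ∀ x, f (-x) = - f x) : ∫ x, f x ∂(gm (UU B 0)) = 0 := by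
  rw [gm_int]
  have h : ∫ x, f x * Real.exp (-UU B 0 x) = ∫ x, f (-x) * Real.exp (-UU B 0 (-x)) :=
    (integral_neg_eq_self (fun x => f x * Real.exp (-UU B 0 x)) volume).symm
  have e : ∀ x, UU B 0 (-x) = UU B 0 x := fun x => by simp [UU, mulVec_neg]
  simp only [hf, e, neg_mul, integral_neg] at h
  have : ∫ x, f x * Real.exp (-UU B 0 x) = 0 := by linarith
  rw [this, zero_div]

lemma ga_lin2 (hB : Bᵀ = B) (hV : Coer (UU B 0)) (u : ι → ℝ) :
    ∫ x, (u ⬝ᵥ x)^2 ∂(gm (UU B 0)) = u ⬝ᵥ (B⁻¹ *ᵥ u) := by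
  have e : ∀ x : ι → ℝ, (u ⬝ᵥ x)^2 = ∑ i, ∑ j, u i * u j * (x i * x j) := by
    intro x
    rw [sq, dotProduct, Finset.sum_mul_sum]
    exact Finset.sum_congr rfl fun i _ => Finset.sum_congr rfl fun j _ => by ring
  simp only [e]
  have hp : ∀ i j, PG (fun x : ι → ℝ => u i * u j * (x i * x j)) := fun i j =>
    (PG.const _).mul ((PG.coord i).mul (PG.coord j))
  rw [integral_finset_sum _ fun i _ => (PG.sum _ fun j => hp i j).int hV]
  simp only [dotProduct, mulVec, Finset.mul_sum]
  refine Finset.sum_congr rfl fun i _ => ?_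
  rw [integral_finset_sum _ fun j _ => (hp i j).int hV]
  refine Finset.sum_congr rfl fun j _ => ?_
  rw [integral_const_mul, ga_cov hB hV]; ring

lemma ga_shift (hB : Bᵀ = B) (hV : Coer (UU B 0)) (h : ι → ℝ) (P : ℝ) :
    ∫ x, ((x + h) ⬝ᵥ (x + h) - P)^2 ∂(gm (UU B 0)) =
      (B⁻¹.trace + h ⬝ᵥ h - P)^2 + 2 * (B⁻¹ * B⁻¹).trace + 4 * (h ⬝ᵥ (B⁻¹ *ᵥ h)) := by
  have := hV.prob
  have e : ∀ x : ι → ℝ, ((x + h) ⬝ᵥ (x + h) - P)^2 =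
      (x ⬝ᵥ x)^2 + (4 * (h ⬝ᵥ x)^2 + ((2 * (h ⬝ᵥ h - P)) * (x ⬝ᵥ x) + ((h ⬝ᵥ h - P)^2 +
        (4 * ((x ⬝ᵥ x) * (h ⬝ᵥ x)) + (4 * (h ⬝ᵥ h - P)) * (h ⬝ᵥ x))))) := by
    intro x
    simp only [add_dotProduct, dotProduct_add]
    rw [dotProduct_comm x h]; ring
  simp only [e]
  have p1 : PG fun x : ι → ℝ => (x ⬝ᵥ x)^2 := PG.dotx.pow 2
  have p2 : PG fun x : ι → ℝ => 4 * (h ⬝ᵥ x)^2 := (PG.const _).mul ((PG.dotc h).pow 2)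
  have p3 : PG fun x : ι → ℝ => (2 * (h ⬝ᵥ h - P)) * (x ⬝ᵥ x) := (PG.const _).mul PG.dotx
  have p4 : PG fun x : ι → ℝ => (h ⬝ᵥ h - P)^2 := PG.const _
  have p5 : PG fun x : ι → ℝ => 4 * ((x ⬝ᵥ x) * (h ⬝ᵥ x)) := (PG.const _).mul (PG.dotx.mul (PG.dotc h))
  have p6 : PG fun x : ι → ℝ => (4 * (h ⬝ᵥ h - P)) * (h ⬝ᵥ x) := (PG.const _).mul (PG.dotc h)
  rw [integral_add (p1.int hV) ((p2.add (p3.add (p4.add (p5.add p6)))).int hV),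
    integral_add (p2.int hV) ((p3.add (p4.add (p5.add p6))).int hV),
    integral_add (p3.int hV) ((p4.add (p5.add p6)).int hV),
    integral_add (p4.int hV) ((p5.add p6).int hV), integral_add (p5.int hV) (p6.int hV),
    integral_const_mul, integral_const_mul, integral_const_mul, integral_const_mul, ga_q hB hV,
    ga_lin2 hB hV, ga_tr hB hV, ga_odd (f := fun x => (x ⬝ᵥ x) * (h ⬝ᵥ x)) (by intro x; simp),
    ga_odd (f := fun x => (h ⬝ᵥ x)) (by intro x; simp)]
  simp only [integral_const, probReal_univ, one_smul]
  ring

lemma Coer.shift {V : (ι → ℝ) → ℝ} (hV : Coer V) (h : ι → ℝ) : Coer (fun x => V (x + h)) := by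
  obtain ⟨cV, c, hc, C, hV⟩ := hV
  refine ⟨cV.comp (by fun_prop), c / 2, by positivity, C + c * (h ⬝ᵥ h), fun x => ?_⟩
  have h1 := dot_add_le (x + h) (-h)
  simp only [add_neg_cancel_right, neg_dotProduct, dotProduct_neg, neg_neg] at h1
  have := hV (x + h)
  nlinarith

lemma conc0 (hB : Bᵀ = B) {κ P : ℝ} (hV : Coer (UU B 0))
    (hV' : Coer (UU (B - (4 * κ * P) • (1 : Matrix ι ι ℝ)) κ)) (h : ι → ℝ) :
    ∫ x, κ * (x ⬝ᵥ x - P)^2 ∂(gm (UU (B - (4 * κ * P) • (1 : Matrix ι ι ℝ)) κ)) ≤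
      κ * ∫ x, ((x + h) ⬝ᵥ (x + h) - P)^2 ∂(gm (UU B 0)) + (1/2) * (h ⬝ᵥ (B *ᵥ h)) := by
  have := hV.prob
  have := hV'.prob
  have hX : PG (fun x : ι → ℝ => (x ⬝ᵥ x - P)^2) := (PG.dotx.sub (PG.const _)).pow 2
  have hX' : PG (fun x : ι → ℝ => κ * (x ⬝ᵥ x - P)^2) := (PG.const _).mul hX
  have eU : ∀ x : ι → ℝ, UU (B - (4 * κ * P) • (1 : Matrix ι ι ℝ)) κ x =
      UU B 0 x + (κ * (x ⬝ᵥ x - P)^2 - κ * P^2) := by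
    intro x
    simp only [UU, sub_mulVec, smul_mulVec, one_mulVec, dotProduct_sub, dotProduct_smul, smul_eq_mul]
    ring
  have j1 := jensen (f := fun x => κ * (x ⬝ᵥ x - P)^2 - κ * P^2) hV' hV (hX'.sub (PG.const _))
    (fun x => by rw [eU]; ring)
  have hXs := hX.shift h
  have pl : PG (fun x : ι → ℝ => x ⬝ᵥ (B *ᵥ h)) := by
    simpa [dotProduct_comm] using PG.dotc (B *ᵥ h)
  have j2 := jensen (f := fun x => (-1) * (x ⬝ᵥ (B *ᵥ h)) + ((κ * P^2 - (1/2) * (h ⬝ᵥ (B *ᵥ h))) -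
      κ * ((x + h) ⬝ᵥ (x + h) - P)^2)) hV (hV'.shift h)
      (((PG.const _).mul pl).add ((PG.const _).sub ((PG.const _).mul hXs))) (fun x => by
        rw [eU]
        have hs : h ⬝ᵥ (B *ᵥ x) = x ⬝ᵥ (B *ᵥ h) := by
          rw [dotProduct_mulVec, ← mulVec_transpose, hB, dotProduct_comm]
        simp only [UU, mulVec_add, dotProduct_add, add_dotProduct, hs]
        ring)
  rw [integral_add_right_eq_self (fun x => Real.exp (-UU (B - (4 * κ * P) • (1 : Matrix ι ι ℝ)) κ x)) h] at j2
  rw [integral_sub (hX'.int hV') (integrable_const _)] at j1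
  rw [integral_add (((PG.const _).mul pl).int hV) (((PG.const _).sub ((PG.const _).mul hXs)).int hV),
    integral_sub (integrable_const _) (((PG.const _).mul hXs).int hV), integral_const_mul,
    ga_odd (f := fun x => x ⬝ᵥ (B *ᵥ h)) (by intro x; simp), integral_const_mul] at j2
  simp only [integral_const, probReal_univ, one_smul] at j1 j2
  have h1 := hV.pos
  have h2 := hV'.pos
  set m1 := ∫ x, κ * (x ⬝ᵥ x - P)^2 ∂(gm (UU (B - (4 * κ * P) • (1 : Matrix ι ι ℝ)) κ))
  set m2 := ∫ x, ((x + h) ⬝ᵥ (x + h) - P)^2 ∂(gm (UU B 0))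
  by_contra hcon
  push Not at hcon
  have h3 := mul_le_mul_of_nonneg_left j1 (Real.exp_pos (-1 * 0 + (κ * P ^ 2 - 1 / 2 * h ⬝ᵥ B *ᵥ h - κ * m2))).le
  have h4 := h3.trans j2
  rw [← mul_assoc, ← Real.exp_add] at h4
  have h5 : 1 < Real.exp (-1 * 0 + (κ * P ^ 2 - 1 / 2 * h ⬝ᵥ B *ᵥ h - κ * m2) + (m1 - κ * P ^ 2)) := by
    rw [Real.one_lt_exp_iff]; linarith
  nlinarith

/-- deterministic concentration bound -/
lemma conc (hB : Bᵀ = B) {κ P ε : ℝ} (hκ : 0 < κ) (hε : 0 < ε)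
    (hl : ∀ x, ε * (x ⬝ᵥ x) ≤ x ⬝ᵥ (B *ᵥ x)) (h : ι → ℝ) :
    κ * ∫ x, (x ⬝ᵥ x - P)^2 ∂(gm (UU (B - (4 * κ * P) • (1 : Matrix ι ι ℝ)) κ)) ≤
      κ * ((B⁻¹.trace + h ⬝ᵥ h - P)^2 + 2 * (Fintype.card ι / ε^2) + 4 * ((h ⬝ᵥ h) / ε))
        + (1/2) * (h ⬝ᵥ (B *ᵥ h)) := by
  have hV := UU_coer_quad B 0 ε le_rfl hε hl
  have h0 := conc0 hB hV (UU_coer_quartic (B - (4 * κ * P) • (1 : Matrix ι ι ℝ)) κ hκ) h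
  rw [integral_const_mul, ga_shift hB hV] at h0
  have h1 := trace_inv_sq hB hε hl
  have h2 := (solve_bounds hε (B⁻¹ *ᵥ h) h (by
      have := hl (B⁻¹ *ᵥ h); rwa [inv_solve hε hl] at this)).2.1
  rw [dotProduct_comm] at h2
  refine h0.trans ?_
  gcongr
end
end

section

/-- Gibbs measure in reduced parameters. -/
def gY (n : ℕ) (a β : ℝ) (Y : Matrix (Fin n) (Fin n) ℝ) : Measure (Fin n → ℝ) :=
  gm (UU (β • (1 : Matrix (Fin n) (Fin n) ℝ) - a • Y) (a^2/(4*n)))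

lemma gY_coer {n : ℕ} (hn : 0 < n) {a : ℝ} (ha : 0 < a) (β : ℝ) (Y : Matrix (Fin n) (Fin n) ℝ) :
    Coer (UU (β • (1 : Matrix (Fin n) (Fin n) ℝ) - a • Y) (a^2/(4*n))) :=
  UU_coer_quartic _ _ (by have : (0:ℝ) < n := by exact_mod_cast hn
                          positivity)

lemma PG.intY {n : ℕ} {f : (Fin n → ℝ) → ℝ} (hf : PG f) (hn : 0 < n) {a : ℝ} (ha : 0 < a) (β : ℝ)
    (Y : Matrix (Fin n) (Fin n) ℝ) : Integrable f (gY n a β Y) := hf.int (gY_coer hn ha β Y)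

lemma gY_prob {n : ℕ} (hn : 0 < n) {a : ℝ} (ha : 0 < a) (β : ℝ)
    (Y : Matrix (Fin n) (Fin n) ℝ) : IsProbabilityMeasure (gY n a β Y) := (gY_coer hn ha β Y).prob

def RR {n : ℕ} (x : Fin n → ℝ) : ℝ := (x ⬝ᵥ x) / n

lemma RR_PG {n : ℕ} : PG (fun x : Fin n → ℝ => RR x) := PG.dotx.div _

lemma RR_nonneg {n : ℕ} (x : Fin n → ℝ) : 0 ≤ RR x := div_nonneg (dnn x) (by positivity)

/-- second moment matrices with a weight -/
def Mat (n : ℕ) (a β : ℝ) (Y : Matrix (Fin n) (Fin n) ℝ) (φ : (Fin n → ℝ) → ℝ) :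
    Matrix (Fin n) (Fin n) ℝ := Matrix.of fun i j => (∫ x, φ x * (x i * x j) ∂(gY n a β Y)) / n

section
variable {n : ℕ} (hn : 0 < n) {a : ℝ} (ha : 0 < a) {β : ℝ} {Y : Matrix (Fin n) (Fin n) ℝ}
  {φ : (Fin n → ℝ) → ℝ} (hφ : PG φ)

lemma Mat_symm (φ : (Fin n → ℝ) → ℝ) : (Mat n a β Y φ)ᵀ = Mat n a β Y φ := by
  ext i j; simp [Mat, mul_comm]

include hn ha hφ in
lemma Mat_bil (u w : Fin n → ℝ) : u ⬝ᵥ (Mat n a β Y φ *ᵥ w) =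
    (∫ x, φ x * ((u ⬝ᵥ x) * (w ⬝ᵥ x)) ∂(gY n a β Y)) / n := by
  have hV := gY_coer hn ha β Y
  have e : ∀ x : Fin n → ℝ, φ x * ((u ⬝ᵥ x) * (w ⬝ᵥ x)) =
      ∑ i, ∑ j, u i * w j * (φ x * (x i * x j)) := by
    intro x
    rw [dotProduct, dotProduct, Finset.sum_mul_sum]
    simp only [Finset.mul_sum]
    exact Finset.sum_congr rfl fun i _ => Finset.sum_congr rfl fun j _ => by ring
  simp only [e]
  have hp : ∀ i j, PG (fun x : Fin n → ℝ => u i * w j * (φ x * (x i * x j))) := fun i j =>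
    (PG.const _).mul (hφ.mul ((PG.coord i).mul (PG.coord j)))
  rw [integral_finset_sum _ fun i _ => (PG.sum _ fun j => hp i j).intY hn ha β Y, Finset.sum_div]
  simp only [dotProduct, mulVec, Finset.mul_sum]
  refine Finset.sum_congr rfl fun i _ => ?_
  rw [integral_finset_sum _ fun j _ => (hp i j).intY hn ha β Y, Finset.sum_div]
  refine Finset.sum_congr rfl fun j _ => ?_
  rw [integral_const_mul]
  simp only [Mat, of_apply]; ring

include hn ha hφ in
lemma Mat_trace (G : Matrix (Fin n) (Fin n) ℝ) : (G * Mat n a β Y φ).trace =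
    (∫ x, φ x * (x ⬝ᵥ (G *ᵥ x)) ∂(gY n a β Y)) / n := by
  have hV := gY_coer hn ha β Y
  have e : ∀ x : Fin n → ℝ, φ x * (x ⬝ᵥ (G *ᵥ x)) =
      ∑ i, ∑ j, G i j * (φ x * (x j * x i)) := by
    intro x
    simp only [dotProduct, mulVec, Finset.mul_sum]
    exact Finset.sum_congr rfl fun i _ => Finset.sum_congr rfl fun j _ => by ring
  simp only [e]
  have hp : ∀ i j, PG (fun x : Fin n → ℝ => G i j * (φ x * (x j * x i))) := fun i j =>
    (PG.const _).mul (hφ.mul ((PG.coord j).mul (PG.coord i)))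
  rw [integral_finset_sum _ fun i _ => (PG.sum _ fun j => hp i j).intY hn ha β Y, Finset.sum_div]
  simp only [trace, diag_apply, mul_apply]
  refine Finset.sum_congr rfl fun i _ => ?_
  rw [integral_finset_sum _ fun j _ => (hp i j).intY hn ha β Y, Finset.sum_div]
  refine Finset.sum_congr rfl fun j _ => ?_
  rw [integral_const_mul]
  simp only [Mat, of_apply]; ring

include hn ha in
lemma Mat_trace_one : (Mat n a β Y fun _ => 1).trace = ∫ x, RR x ∂(gY n a β Y) := by
  have := Mat_trace (Y := Y) (β := β) hn ha (PG.const (ι := Fin n) 1) 1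
  simp only [one_mul, one_mulVec] at this
  rw [this, ← integral_div]; rfl

include hn ha in
lemma xibp (hY : Yᵀ = Y) {z ρ : ℝ} (hz : a^2 * ρ = a * z - β) :
    (z • (1 : Matrix (Fin n) (Fin n) ℝ) - Y) * Mat n a β Y (fun _ => 1) =
      (1/(a*n)) • (1 : Matrix (Fin n) (Fin n) ℝ) - a • Mat n a β Y (fun x => RR x - ρ) := by
  have hV := gY_coer hn ha β Y
  have hn' : (0:ℝ) < n := by exact_mod_cast hn
  ext i j
  have h := ibp1 (B := β • (1 : Matrix (Fin n) (Fin n) ℝ) - a • Y) (by simp [hY]) _ hV i j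
  have e : ∀ x : Fin n → ℝ, x j * (((β • (1 : Matrix (Fin n) (Fin n) ℝ) - a • Y) *ᵥ x) i +
      4 * (a^2/(4*n)) * (x ⬝ᵥ x) * x i) = a^2 * ((RR x - ρ) * (x i * x j)) +
        ∑ k, (a * (z • (1 : Matrix (Fin n) (Fin n) ℝ) - Y) i k) * (1 * (x k * x j)) := by
    intro x
    have : ∑ k, (a * (z • (1 : Matrix (Fin n) (Fin n) ℝ) - Y) i k) * (1 * (x k * x j)) =
        a * ((z • (1 : Matrix (Fin n) (Fin n) ℝ) - Y) *ᵥ x) i * x j := by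
      simp only [mulVec, dotProduct, Finset.mul_sum, Finset.sum_mul]
      exact Finset.sum_congr rfl fun k _ => by ring
    rw [this]
    simp only [sub_mulVec, smul_mulVec, one_mulVec, Pi.sub_apply, Pi.smul_apply, smul_eq_mul, RR]
    have : β = a * z - a^2 * ρ := by linarith
    rw [this]
    field_simp
    ring
  simp only [e] at h
  change _ = ∫ x, _ ∂(gY n a β Y) at h
  have hp1 : PG (fun x : Fin n → ℝ => a^2 * ((RR x - ρ) * (x i * x j))) :=
    (PG.const _).mul ((RR_PG.sub (PG.const _)).mul ((PG.coord i).mul (PG.coord j)))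
  have hp2 : ∀ k, PG (fun x : Fin n → ℝ => (a * (z • (1 : Matrix (Fin n) (Fin n) ℝ) - Y) i k) * (1 * (x k * x j))) :=
    fun k => (PG.const _).mul ((PG.const _).mul ((PG.coord k).mul (PG.coord j)))
  rw [integral_add (hp1.intY hn ha β Y) ((PG.sum _ hp2).intY hn ha β Y), integral_const_mul,
    integral_finset_sum _ fun k _ => (hp2 k).intY hn ha β Y] at h
  have eR : ((1/(a*n)) • (1 : Matrix (Fin n) (Fin n) ℝ) - a • Mat n a β Y (fun x => RR x - ρ)) i j =
      (1/(a*n)) * (if j = i then 1 else 0) - a * ((∫ x, (RR x - ρ) * (x i * x j) ∂(gY n a β Y)) / n) := by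
    simp only [Matrix.sub_apply, Matrix.smul_apply, smul_eq_mul, one_apply, Mat, of_apply]
    simp [eq_comm]
  have eL : ((z • (1 : Matrix (Fin n) (Fin n) ℝ) - Y) * Mat n a β Y (fun _ => 1)) i j =
      (1/(a*n)) * ∑ k, ∫ x, (a * (z • (1 : Matrix (Fin n) (Fin n) ℝ) - Y) i k) * (1 * (x k * x j)) ∂(gY n a β Y) := by
    rw [mul_apply, Finset.mul_sum]
    refine Finset.sum_congr rfl fun k _ => ?_
    rw [integral_const_mul]
    simp only [Mat, of_apply]
    field_simp
  rw [eR, eL, h]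
  field_simp
  ring

include hn ha in
lemma xtrace (hY : Yᵀ = Y) :
    1 = β * (∫ x, RR x ∂(gY n a β Y)) - a * ((∫ x, x ⬝ᵥ (Y *ᵥ x) ∂(gY n a β Y)) / n) +
      a^2 * ∫ x, RR x ^ 2 ∂(gY n a β Y) := by
  have hV := gY_coer hn ha β Y
  have hn' : (0:ℝ) < n := by exact_mod_cast hn
  have h := xibp hn ha hY (β := β) (z := β / a) (ρ := 0) (by field_simp; ring)
  have h2 := congrArg trace h
  rw [sub_mul, smul_mul_assoc, one_mul, trace_sub, trace_smul, Mat_trace_one hn ha,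
    Mat_trace hn ha (PG.const 1) Y, trace_sub, trace_smul, trace_smul, trace_one] at h2
  have h3 := Mat_trace (β := β) (Y := Y) hn ha (φ := fun x => RR x - 0) (RR_PG.sub (PG.const 0)) 1
  rw [one_mul] at h3
  rw [h3] at h2
  simp only [one_mul, one_mulVec, sub_zero, smul_eq_mul, Fintype.card_fin] at h2
  have h4 : (∫ x, RR x * (x ⬝ᵥ x) ∂(gY n a β Y)) / n = ∫ x, RR x ^ 2 ∂(gY n a β Y) := by
    rw [← integral_div]; congr 1; ext x; rw [RR]; ring
  rw [h4] at h2
  field_simp at h2 ⊢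
  linarith

include hn ha in
lemma sq_av_le {f : (Fin n → ℝ) → ℝ} (hf : PG f) :
    (∫ x, f x ∂(gY n a β Y))^2 ≤ ∫ x, f x ^ 2 ∂(gY n a β Y) := by
  have hV := gY_coer hn ha β Y
  have : IsProbabilityMeasure (gY n a β Y) := hV.prob
  set m := ∫ x, f x ∂(gY n a β Y) with hm
  have h : 0 ≤ ∫ x, (f x - m)^2 ∂(gY n a β Y) := integral_nonneg fun x => sq_nonneg _
  have e : ∀ x, (f x - m)^2 = f x ^2 + ((-2*m) * f x + m^2) := fun x => by ring
  simp only [e] at h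
  have p1 := (hf.pow 2).intY hn ha β Y
  have p2 := ((PG.const (-2*m)).mul hf).intY hn ha β Y
  rw [integral_add p1 ((((PG.const (-2*m)).mul hf).add (PG.const (m^2))).intY hn ha β Y), integral_add p2 (integrable_const _),
    integral_const_mul, integral_const, probReal_univ, one_smul] at h
  change 0 ≤ _ + (-2 * m * m + _) at h
  nlinarith

include hn ha in
lemma apriori (hβ : 0 ≤ β) (hY : Yᵀ = Y) {m : ℝ} (hm : 0 ≤ m) (h : ∀ x, x ⬝ᵥ (Y *ᵥ x) ≤ m * (x ⬝ᵥ x)) :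
    a^2 * ∫ x, RR x ^ 2 ∂(gY n a β Y) ≤ 2 + m^2 := by
  have hV := gY_coer hn ha β Y
  have hn' : (0:ℝ) < n := by exact_mod_cast hn
  have h1 := xtrace hn ha hY (β := β)
  have h2 := sq_av_le hn ha (RR_PG (n := n)) (β := β) (Y := Y)
  have h0 : 0 ≤ ∫ x, RR x ∂(gY n a β Y) := integral_nonneg fun x => RR_nonneg x
  have h3 : (∫ x, x ⬝ᵥ (Y *ᵥ x) ∂(gY n a β Y)) / n ≤ m * ∫ x, RR x ∂(gY n a β Y) := by
    rw [← integral_div, ← integral_const_mul]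
    refine integral_mono (((PG.qd Y).div _).intY hn ha β Y) (((PG.const m).mul RR_PG).intY hn ha β Y) fun x => ?_
    simp only [RR]
    rw [mul_div_assoc']
    gcongr
    exact h x
  have h4 : a * ((∫ x, x ⬝ᵥ (Y *ᵥ x) ∂(gY n a β Y)) / n) ≤ a * (m * ∫ x, RR x ∂(gY n a β Y)) := by gcongr
  nlinarith [sq_nonneg (a * (∫ x, RR x ∂(gY n a β Y)) - m), mul_nonneg hβ h0, mul_pos ha ha]
end
end

section

abbrev PP : Type := Σ n, Om n

def WW (p : PP) : Matrix (Fin p.1) (Fin p.1) ℝ := (1/√p.1) • p.2.2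
def YY (ℓ : ℝ) (p : PP) : Matrix (Fin p.1) (Fin p.1) ℝ := (ℓ/p.1) • vecMulVec p.2.1 p.2.1 + WW p
def BW (z : ℝ) (p : PP) : Matrix (Fin p.1) (Fin p.1) ℝ := z • 1 - WW p
def BY (ℓ z : ℝ) (p : PP) : Matrix (Fin p.1) (Fin p.1) ℝ := z • 1 - YY ℓ p
def GG (t : ℝ) (p : PP) : Matrix (Fin p.1) (Fin p.1) ℝ := (BW (t + 1/t) p)⁻¹
/-- the vector G s -/
def gs (t : ℝ) (p : PP) : Fin p.1 → ℝ := GG t p *ᵥ p.2.1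

lemma qf_eq (z : ℝ) (p : PP) (x : Fin p.1 → ℝ) : qf (1/√p.1) z p.2.2 x = x ⬝ᵥ (BW z p *ᵥ x) := by
  simp only [qf, BW, WW, sub_mulVec, smul_mulVec, one_mulVec, dotProduct_sub, dotProduct_smul, smul_eq_mul]

lemma YY_quad (ℓ : ℝ) (p : PP) (x : Fin p.1 → ℝ) :
    x ⬝ᵥ (YY ℓ p *ᵥ x) = (ℓ/p.1) * (p.2.1 ⬝ᵥ x)^2 + x ⬝ᵥ (WW p *ᵥ x) := by
  simp only [YY, add_mulVec, smul_mulVec, vecMulVec_mulVec, dotProduct_add, dotProduct_smul, smul_eq_mul,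
    IsCentralScalar.op_smul_eq_smul]
  rw [dotProduct_comm x p.2.1]; ring

lemma BW_quad (z : ℝ) (p : PP) (x : Fin p.1 → ℝ) :
    x ⬝ᵥ (BW z p *ᵥ x) = z * (x ⬝ᵥ x) - x ⬝ᵥ (WW p *ᵥ x) := by
  simp only [BW, sub_mulVec, smul_mulVec, one_mulVec, dotProduct_sub, dotProduct_smul, smul_eq_mul]

lemma BY_quad (ℓ z : ℝ) (p : PP) (x : Fin p.1 → ℝ) :
    x ⬝ᵥ (BY ℓ z p *ᵥ x) = z * (x ⬝ᵥ x) - x ⬝ᵥ (YY ℓ p *ᵥ x) := by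
  simp only [BY, sub_mulVec, smul_mulVec, one_mulVec, dotProduct_sub, dotProduct_smul, smul_eq_mul]

lemma symm_dot {n : ℕ} {B : Matrix (Fin n) (Fin n) ℝ} (hB : Bᵀ = B) (x y : Fin n → ℝ) :
    x ⬝ᵥ (B *ᵥ y) = (B *ᵥ x) ⬝ᵥ y := by
  rw [dotProduct_mulVec, ← mulVec_transpose, hB]

lemma quad_var {n : ℕ} {B : Matrix (Fin n) (Fin n) ℝ} (hB : Bᵀ = B) (h : ∀ x, 0 ≤ x ⬝ᵥ (B *ᵥ x))
    {y s : Fin n → ℝ} (hy : B *ᵥ y = s) (x : Fin n → ℝ) : 2 * (s ⬝ᵥ x) - x ⬝ᵥ (B *ᵥ x) ≤ s ⬝ᵥ y := by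
  have h1 := h (x - y)
  rw [mulVec_sub, hy, dotProduct_sub, sub_dotProduct, sub_dotProduct, symm_dot hB y x, hy] at h1
  rw [dotProduct_comm x s, dotProduct_comm y s] at h1
  linarith

lemma WW_symm {p : PP} (h : (p.2.2)ᵀ = p.2.2) : (WW p)ᵀ = WW p := by
  rw [WW, transpose_smul, h]
lemma BW_symm {p : PP} (h : (p.2.2)ᵀ = p.2.2) (z : ℝ) : (BW z p)ᵀ = BW z p := by
  rw [BW, transpose_sub, transpose_smul, transpose_one, WW_symm h]
lemma YY_symm {p : PP} (h : (p.2.2)ᵀ = p.2.2) (ℓ : ℝ) : (YY ℓ p)ᵀ = YY ℓ p := by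
  rw [YY, transpose_add, transpose_smul, transpose_vecMulVec, WW_symm h]
lemma BY_symm {p : PP} (h : (p.2.2)ᵀ = p.2.2) (ℓ z : ℝ) : (BY ℓ z p)ᵀ = BY ℓ z p := by
  rw [BY, transpose_sub, transpose_smul, transpose_one, YY_symm h]

lemma zdiff (t u : ℝ) (ht : 0 < t) (hu : 0 < u) : (t + 1/t) - (u + 1/u) = (u - t) * ((1 - t*u)/(t*u)) := by
  field_simp; ring

lemma zlt {t u : ℝ} (ht : 0 < t) (hu : t < u) (h1 : u ≤ 1) : u + 1/u < t + 1/t := by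
  have := zdiff t u ht (ht.trans hu)
  have h2 : 0 < (u - t) * ((1 - t*u)/(t*u)) := by
    apply mul_pos (by linarith); apply div_pos
    · nlinarith
    · exact mul_pos ht (ht.trans hu)
  linarith

/-- (a) -/
lemma PF_lower (sig t t' : ℝ) (ht : 0 < t) (h1 : t < t') (h2 : t' < 1) :
    ∀ᶠ p in PF sig, ∀ x, ((t + 1/t) - (t' + 1/t')) * (x ⬝ᵥ x) ≤ x ⬝ᵥ (BW (t + 1/t) p *ᵥ x) := by
  have ht' := ht.trans h1
  filter_upwards [PF_U sig t' 1 ht' h2 (by rw [lt_div_iff₀ ht']; linarith)] with p hp x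
  have := (hp x).1
  rw [qf_eq, BW_quad] at this
  rw [BW_quad]; linarith

lemma PF_lower' (sig t : ℝ) (ht : 0 < t) (h2 : t < 1) : ∃ ε : ℝ, 0 < ε ∧
    ∀ᶠ p in PF sig, ∀ x, ε * (x ⬝ᵥ x) ≤ x ⬝ᵥ (BW (t + 1/t) p *ᵥ x) :=
  ⟨_, sub_pos.2 (zlt ht (show t < (t+1)/2 by linarith) (by linarith)),
    PF_lower sig t ((t+1)/2) ht (by linarith) (by linarith)⟩

lemma gs_upper (sig t g : ℝ) (ht : 0 < t) (ht1 : t < 1) (h1 : t < g) (h2 : g < 1/t) :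
    ∀ᶠ p in PF sig, p.2.1 ⬝ᵥ gs t p ≤ g * (p.2.1 ⬝ᵥ p.2.1) := by
  obtain ⟨ε, hε, hl⟩ := PF_lower' sig t ht ht1
  filter_upwards [PF_U sig t g ht h1 h2, hl] with p hp hl
  have h3 := (hp (gs t p)).2
  rw [qf_eq, gs, GG, inv_solve hε hl, dotProduct_comm ((BW (t+1/t) p)⁻¹ *ᵥ p.2.1) p.2.1] at h3
  rw [gs, GG]
  set v := p.2.1 ⬝ᵥ (BW (t+1/t) p)⁻¹ *ᵥ p.2.1
  have h4 := dnn p.2.1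
  by_contra hc
  push Not at hc
  have : 0 ≤ g * (p.2.1 ⬝ᵥ p.2.1) := mul_nonneg (by linarith) h4
  nlinarith

lemma gs_lower (sig t l : ℝ) (hsig : 0 < sig) (ht : 0 < t) (ht1 : t < 1) (h1 : l < t) :
    ∀ᶠ p in PF sig, l * (p.2.1 ⬝ᵥ p.2.1) ≤ p.2.1 ⬝ᵥ gs t p := by
  obtain ⟨ε, hε, hl⟩ := PF_lower' sig t ht ht1
  filter_upwards [PF_L sig t l hsig ht ht1 h1, hl, PF_symm sig] with p hp hl hs
  obtain ⟨x, hx⟩ := hp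
  rw [qf_eq] at hx
  have := quad_var (BW_symm hs _) (fun x => (by have := dnn x; positivity : 0 ≤ ε * (x ⬝ᵥ x)).trans (hl x))
    (inv_solve hε hl p.2.1) x
  rw [gs, GG]; linarith

/-- (b) -/
lemma gs_lim (sig t : ℝ) (hsig : 0 < sig) (ht : 0 < t) (ht1 : t < 1) :
    Tendsto (fun p : PP => (p.2.1 ⬝ᵥ gs t p) / p.1) (PF sig) (nhds (t * sig^2)) := by
  have hv : 0 < sig^2 := by positivity
  have hS := PF_normS sig hsig
  have ht2 : t < 1/t := by rw [lt_div_iff₀ ht]; nlinarith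
  rw [tendsto_order]
  constructor
  · intro b hb
    have hb' : b / sig^2 < t := by rw [div_lt_iff₀ hv]; exact hb
    obtain ⟨l, h1, h2⟩ := exists_between hb'
    rw [div_lt_iff₀ hv] at h1
    have := (hS.const_mul l).eventually_const_lt h1
    filter_upwards [this, gs_lower sig t l hsig ht ht1 h2] with p h3 h4
    rw [← mul_div_assoc] at h3
    exact h3.trans_le (by gcongr)
  · intro b hb
    have hb' : t < b / sig^2 := by rw [lt_div_iff₀ hv]; exact hb
    obtain ⟨g, h1, h2⟩ := exists_between (lt_min hb' ht2)
    have h2' := h2.trans_le (min_le_left _ _)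
    rw [lt_div_iff₀ hv] at h2'
    have := (hS.const_mul g).eventually_lt_const h2'
    filter_upwards [this, gs_upper sig t g ht ht1 h1 (h2.trans_le (min_le_right _ _))] with p h3 h4
    rw [← mul_div_assoc] at h3
    exact lt_of_le_of_lt (by gcongr) h3

lemma gs_compare (sig t u : ℝ) (ht : 0 < t) (ht1 : t < 1) (hu : 0 < u) (hu1 : u < 1) :
    ∀ᶠ p in PF sig, (p.2.1 ⬝ᵥ gs t p) / p.1 - (p.2.1 ⬝ᵥ gs u p) / p.1 ≤
      ((u + 1/u) - (t + 1/t)) * ((gs t p ⬝ᵥ gs t p) / p.1) := by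
  obtain ⟨ε, hε, hl⟩ := PF_lower' sig t ht ht1
  obtain ⟨ε', hε', hl'⟩ := PF_lower' sig u hu hu1
  filter_upwards [hl, hl', PF_symm sig] with p hl hl' hs
  have := quad_var (BW_symm hs _) (fun x => (by have := dnn x; positivity : 0 ≤ ε' * (x ⬝ᵥ x)).trans (hl' x))
    (inv_solve hε' hl' p.2.1) (gs t p)
  have e : gs t p ⬝ᵥ (BW (u+1/u) p *ᵥ gs t p) = gs t p ⬝ᵥ (BW (t+1/t) p *ᵥ gs t p) +
      ((u + 1/u) - (t + 1/t)) * (gs t p ⬝ᵥ gs t p) := by rw [BW_quad, BW_quad]; ring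
  have e2 : BW (t+1/t) p *ᵥ gs t p = p.2.1 := inv_solve hε hl p.2.1
  rw [e, e2, dotProduct_comm (gs t p) p.2.1] at this
  rw [← sub_div, ← mul_div_assoc]
  have h0 : (0:ℝ) ≤ p.1 := by positivity
  apply div_le_div_of_nonneg_right _ h0
  have e3 : gs u p = (BW (u+1/u) p)⁻¹ *ᵥ p.2.1 := rfl
  rw [e3]; linarith

/-- (c) -/
lemma gs_norm (sig t : ℝ) (hsig : 0 < sig) (ht : 0 < t) (ht1 : t < 1) :
    Tendsto (fun p : PP => (gs t p ⬝ᵥ gs t p) / p.1) (PF sig) (nhds (t^2/(1-t^2) * sig^2)) := by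
  have hc : ContinuousAt (fun u => t*u/(1-t*u) * sig^2) t := by
    apply ContinuousAt.mul _ continuousAt_const
    apply ContinuousAt.div (by fun_prop) (by fun_prop)
    nlinarith
  have e0 : t^2/(1-t^2) * sig^2 = (fun u => t*u/(1-t*u) * sig^2) t := by simp only [pow_two]
  have key : ∀ u, 0 < u → u < 1 → u ≠ t → Tendsto (fun p : PP => ((p.2.1 ⬝ᵥ gs t p) / p.1 - (p.2.1 ⬝ᵥ gs u p) / p.1)
      / ((u + 1/u) - (t + 1/t))) (PF sig) (nhds ((fun u => t*u/(1-t*u) * sig^2) u)) := by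
    intro u hu hu1 hut
    have := ((gs_lim sig t hsig ht ht1).sub (gs_lim sig u hsig hu hu1)).div_const ((u + 1/u) - (t + 1/t))
    convert this using 2
    rw [zdiff u t hu ht]
    have h1 : t - u ≠ 0 := sub_ne_zero.2 hut.symm
    have h2 : 1 - t * u ≠ 0 := by nlinarith
    have h3 : 1 - u * t ≠ 0 := by nlinarith
    field_simp
  rw [e0, tendsto_order]
  constructor
  · intro b hb
    have h1 := hc.eventually_const_lt hb
    have h2 : ∃ᶠ u in nhds t, u < t := (_root_.frequently_lt_nhds t)
    obtain ⟨u, hu, h3, h4⟩ := (h2.and_eventually (h1.and (eventually_gt_nhds ht))).exists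
    filter_upwards [(key u h4 (by linarith) hu.ne).eventually_const_lt h3, gs_compare sig t u ht ht1 h4 (by linarith)]
      with p h5 h6
    have h7 := zlt h4 hu ht1.le
    refine h5.trans_le ?_
    rw [div_le_iff₀ (by linarith)]; linarith
  · intro b hb
    have h1 := hc.eventually_lt_const hb
    have h2 : ∃ᶠ u in nhds t, t < u := (_root_.frequently_gt_nhds t)
    obtain ⟨u, hu, h3, h4⟩ := (h2.and_eventually (h1.and (eventually_lt_nhds ht1))).exists
    filter_upwards [(key u (ht.trans hu) h4 hu.ne').eventually_lt_const h3, gs_compare sig t u ht ht1 (ht.trans hu) h4]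
      with p h5 h6
    have h7 := zlt ht hu h4.le
    refine lt_of_le_of_lt ?_ h5
    rw [le_div_iff_of_neg (by linarith)]; linarith

end

section

abbrev ee {n : ℕ} (i : Fin n) : Fin n → ℝ := Pi.single i 1

lemma ee_dot {n : ℕ} (i : Fin n) : ee i ⬝ᵥ ee i = 1 := by simp [ee]

lemma PF_U_all (sig t g : ℝ) (ht : 0 < t) (h1 : t < g) (h2 : g < 1 / t) :
    ∀ᶠ p in PF sig, ∀ i, p.2.2 ∈ Uset (1 / √p.1) (t + 1/t) g (ee i) := by
  obtain ⟨c, hc0, hc1, hc⟩ := U_prob (t + 1/t) g (ht.trans h1) (U_cond t g ht h1 h2)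
  have hb : Tendsto (fun n : ℕ => (n:ℝ) * (n * (3 * c^n))) atTop (nhds 0) := by
    have := (tendsto_pow_const_mul_const_pow_of_lt_one 2 hc0.le hc1).const_mul 3
    simp only [mul_zero] at this
    refine this.congr fun n => by ring
  refine PF_of_bound _ hb ?_
  filter_upwards [eventually_ge_atTop 1] with n hn
  have : {ω : Om n | ¬ ∀ i, ω.2 ∈ Uset (1 / √n) (t + 1/t) g (ee i)} =
      {ω | ω.2 ∈ ⋃ i : Fin n, (Uset (1 / √n) (t + 1/t) g (ee i))ᶜ} := by
    ext ω; simp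
  refine (congrArg (mu sig n).real this).trans_le ?_
  rw [mu_le_of_snd]
  refine (measureReal_iUnion_fintype_le _).trans ?_
  refine (Finset.sum_le_sum fun i _ => hc n hn n le_rfl (ee i)).trans ?_
  simp

lemma PF_L_most (sig t l δ : ℝ) (ht : 0 < t) (ht1 : t < 1) (hl : l < t) (hδ : 0 < δ) :
    ∀ᶠ p in PF sig, ∑ i, Set.indicator (Lset (1 / √p.1) (t + 1/t) l (ee i))ᶜ (fun _ => (1:ℝ)) p.2.2 < δ * p.1 := by
  rw [PF_iff, Metric.tendsto_atTop]
  intro ε hε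
  obtain ⟨δ', hδ', N0, H⟩ := LimL_all t l ht ht1 hl (δ * (ε / 2)) (by positivity)
  refine ⟨max N0 1, fun n hn => ?_⟩
  rw [Real.dist_eq, sub_zero, abs_of_nonneg measureReal_nonneg]
  have hn1 : (1:ℝ) ≤ n := by exact_mod_cast (le_max_right _ _).trans hn
  have := mu_le_of_snd (sig := sig) (n := n) {Z | δ * n ≤ ∑ i, Set.indicator (Lset (1 / √n) (t + 1/t) l (ee i))ᶜ (fun _ => (1:ℝ)) Z}
  refine lt_of_le_of_lt (b := ε / 2) ?_ (by linarith)
  simp only [not_lt]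
  refine (Eq.le this).trans ?_
  have hi : ∀ i : Fin n, Integrable (Set.indicator (Lset (1 / √n) (t + 1/t) l (ee i))ᶜ (fun _ => (1:ℝ))) (noiseMeasure n) :=
    fun i => (integrable_const _).indicator (Lset_meas _ _ _ _).compl
  have h3 := mul_meas_ge_le_integral_of_nonneg (μ := noiseMeasure n) (f := fun Z => ∑ i : Fin n, Set.indicator (Lset (1 / √n) (t + 1/t) l (ee i))ᶜ (fun _ => (1:ℝ)) Z)
    (Eventually.of_forall fun Z => Finset.sum_nonneg fun i _ => Set.indicator_nonneg (fun _ _ => zero_le_one) _)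
    (integrable_finset_sum _ fun i _ => hi i) (δ * n)
  rw [integral_finset_sum _ fun i _ => hi i] at h3
  have h4 : ∀ i : Fin n, ∫ Z, Set.indicator (Lset (1 / √n) (t + 1/t) l (ee i))ᶜ (fun _ => (1:ℝ)) Z ∂(noiseMeasure n) ≤ δ * (ε/2) := by
    intro i
    rw [integral_indicator (Lset_meas _ _ _ _).compl]
    simp only [integral_const, smul_eq_mul, mul_one, measureReal_restrict_apply_univ]
    refine H n ((le_max_left _ _).trans hn) n le_rfl (by nlinarith) (ee i) ?_
    simp [ee]
  have h5 := h3.trans (Finset.sum_le_sum fun i _ => h4 i)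
  simp only [Finset.sum_const, Finset.card_univ, Fintype.card_fin, nsmul_eq_mul] at h5
  have h6 : 0 < δ * n := by positivity
  have h7 : δ * n * (noiseMeasure n).real {Z | δ * n ≤ ∑ i : Fin n, Set.indicator (Lset (1 / √n) (t + 1/t) l (ee i))ᶜ (fun _ => (1:ℝ)) Z} ≤ δ * n * (ε/2) := by
    refine h5.trans_eq (by ring)
  exact le_of_mul_le_mul_left h7 h6

/-- (d) -/
lemma trG_lim (sig t : ℝ) (ht : 0 < t) (ht1 : t < 1) :
    Tendsto (fun p : PP => (GG t p).trace / p.1) (PF sig) (nhds t) := by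
  obtain ⟨ε, hε, hl⟩ := PF_lower' sig t ht ht1
  have ht2 : t < 1/t := by rw [lt_div_iff₀ ht]; nlinarith
  rw [tendsto_order]
  constructor
  · intro b hb
    obtain ⟨l', h1, h2⟩ := exists_between (max_lt hb ht)
    obtain ⟨l, h1', h2'⟩ := exists_between h2
    have hb1 : b < l' := (le_max_left _ _).trans_lt h1
    have hl0 : 0 < l := ((le_max_right _ _).trans_lt h1).trans h1'
    have hδ : 0 < (l - l')/l := div_pos (by linarith) hl0
    filter_upwards [PF_L_most sig t l ((l - l')/l) ht ht1 h2' hδ, hl, PF_symm sig, PF_n (eventually_gt_atTop 0)] with p hp hl hs hn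
    have hn' : (0:ℝ) < p.1 := by exact_mod_cast hn
    have e : ∀ i, l - l * Set.indicator (Lset (1 / √p.1) (t + 1/t) l (ee i))ᶜ (fun _ => (1:ℝ)) p.2.2 ≤
        ee i ⬝ᵥ (GG t p *ᵥ ee i) := by
      intro i
      have hsol := inv_solve hε hl (ee i)
      have hv := quad_var (BW_symm hs _) (fun x => (by have := dnn x; positivity : 0 ≤ ε * (x ⬝ᵥ x)).trans (hl x)) hsol
      by_cases h : p.2.2 ∈ Lset (1 / √p.1) (t + 1/t) l (ee i)
      · rw [Set.indicator_of_notMem (by simpa using h)]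
        obtain ⟨x, hx⟩ := h
        rw [qf_eq, ee_dot] at hx
        have := hv x
        rw [GG]; linarith
      · rw [Set.indicator_of_mem (by exact h)]
        have := hv 0
        simp only [dotProduct_zero, mulVec_zero] at this
        rw [GG]; linarith
    have h3 := Finset.sum_le_sum fun i (_ : i ∈ Finset.univ) => e i
    rw [← trace_eq_sum, Finset.sum_sub_distrib, ← Finset.mul_sum] at h3
    simp only [Finset.sum_const, Finset.card_univ, Fintype.card_fin, nsmul_eq_mul] at h3
    refine hb1.trans_le ?_
    rw [le_div_iff₀ hn']
    have : l * ((l-l')/l * p.1) = (l - l') * p.1 := by field_simp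
    have h4 := mul_le_mul_of_nonneg_left hp.le hl0.le
    linarith
  · intro b hb
    obtain ⟨g', h1', h2'⟩ := exists_between hb
    obtain ⟨g, h1, h2⟩ := exists_between (lt_min h1' ht2)
    filter_upwards [PF_U_all sig t g ht h1 (h2.trans_le (min_le_right _ _)), hl, PF_n (eventually_gt_atTop 0)] with p hp hl hn
    have hn' : (0:ℝ) < p.1 := by exact_mod_cast hn
    have e : ∀ i, ee i ⬝ᵥ (GG t p *ᵥ ee i) ≤ g := by
      intro i
      have h3 := (hp i (GG t p *ᵥ ee i)).2
      rw [qf_eq, GG, inv_solve hε hl, ee_dot, dotProduct_comm ((BW (t+1/t) p)⁻¹ *ᵥ ee i)] at h3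
      rw [GG]
      by_contra hc
      push Not at hc
      nlinarith
    have h3 := Finset.sum_le_sum fun i (_ : i ∈ Finset.univ) => e i
    rw [← trace_eq_sum] at h3
    simp only [Finset.sum_const, Finset.card_univ, Fintype.card_fin, nsmul_eq_mul] at h3
    rw [div_lt_iff₀ hn']
    have : g < b := (h2.trans_le (min_le_left _ _)).trans h2'
    nlinarith

/-- (e1) -/
lemma BY_lower (sig ℓ t : ℝ) (hsig : 0 < sig) (hl : 0 < ℓ) (ht : 0 < t) (ht1 : t < 1) (hθ : ℓ * sig^2 * t < 1) :
    ∃ ε : ℝ, 0 < ε ∧ ∀ᶠ p in PF sig, ∀ x, ε * (x ⬝ᵥ x) ≤ x ⬝ᵥ (BY ℓ (t + 1/t) p *ᵥ x) := by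
  obtain ⟨ε, hε, he⟩ := PF_lower' sig t ht ht1
  have ht2 : t < 1/t := by rw [lt_div_iff₀ ht]; nlinarith
  have hv : 0 < ℓ * sig^2 := by positivity
  have h0 : t < 1 / (ℓ * sig^2) := by rw [lt_div_iff₀ hv]; linarith
  obtain ⟨g, h1, h2⟩ := exists_between (lt_min h0 ht2)
  have h3 := h2.trans_le (min_le_left _ _)
  rw [lt_div_iff₀ hv] at h3
  obtain ⟨c, hc1, hc2⟩ := exists_between h3
  refine ⟨(1 - c) * ε, by nlinarith, ?_⟩
  have hS := (PF_normS sig hsig).const_mul (g * ℓ)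
  have hS' := hS.eventually_lt_const (show g * ℓ * sig^2 < c by linarith)
  filter_upwards [he, hS', PF_U sig t g ht h1 (h2.trans_le (min_le_right _ _)), PF_n (eventually_gt_atTop 0)] with p he hS hU hn x
  have hn' : (0:ℝ) < p.1 := by exact_mod_cast hn
  obtain ⟨h5, h6⟩ := hU x
  rw [qf_eq] at h5 h6
  rw [BY_quad, YY_quad]
  have h7 := he x
  have hW : x ⬝ᵥ (WW p *ᵥ x) = (t + 1/t) * (x ⬝ᵥ x) - x ⬝ᵥ (BW (t+1/t) p *ᵥ x) := by rw [BW_quad]; ring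
  rw [hW]
  set q := x ⬝ᵥ (BW (t+1/t) p *ᵥ x)
  have h8 : ℓ / p.1 * (p.2.1 ⬝ᵥ x)^2 ≤ c * q := by
    calc _ ≤ ℓ / p.1 * (g * (p.2.1 ⬝ᵥ p.2.1) * q) := by gcongr
      _ = (g * ℓ * (p.2.1 ⬝ᵥ p.2.1 / p.1)) * q := by ring
      _ ≤ c * q := by gcongr
  have h9 : (1-c) * (ε * (x ⬝ᵥ x)) ≤ (1-c) * q := by gcongr
  linarith

lemma cs_dot {n : ℕ} (x y : Fin n → ℝ) : (x ⬝ᵥ y)^2 ≤ (x ⬝ᵥ x) * (y ⬝ᵥ y) := by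
  simp only [dotProduct]
  have := Finset.sum_mul_sq_le_sq_mul_sq Finset.univ x y
  simpa [pow_two] using this

lemma cs_dot' {n : ℕ} (x y : Fin n → ℝ) {A B : ℝ} (hx : x ⬝ᵥ x ≤ A^2) (hy : y ⬝ᵥ y ≤ B^2)
    (hA : 0 ≤ A) (hB : 0 ≤ B) : |x ⬝ᵥ y| ≤ A * B := by
  apply abs_le_of_sq_le_sq _ (by positivity)
  refine (cs_dot x y).trans ?_
  rw [mul_pow]
  exact mul_le_mul hx hy (dnn y) (by positivity)

/-- (e2) -/
lemma trH_lim (sig ℓ t : ℝ) (hsig : 0 < sig) (hl : 0 < ℓ) (ht : 0 < t) (ht1 : t < 1) (hθ : ℓ * sig^2 * t < 1) :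
    Tendsto (fun p : PP => ((BY ℓ (t+1/t) p)⁻¹).trace / p.1) (PF sig) (nhds t) := by
  obtain ⟨ε, hε, he⟩ := PF_lower' sig t ht ht1
  obtain ⟨ε', hε', he'⟩ := BY_lower sig ℓ t hsig hl ht ht1 hθ
  have hN : Tendsto (fun p : PP => (1:ℝ) / p.1) (PF sig) (nhds 0) := by
    have : Tendsto (fun p : PP => p.1) (PF sig) atTop := by
      intro s hs; exact PF_n hs
    exact tendsto_one_div_atTop_nhds_zero_nat.comp this
  have hb := ((PF_normS sig hsig).mul hN).const_mul (ℓ / (ε * ε'))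
  simp only [mul_zero] at hb
  have hd : Tendsto (fun p : PP => ((BY ℓ (t+1/t) p)⁻¹).trace / p.1 - (GG t p).trace / p.1) (PF sig) (nhds 0) := by
    refine squeeze_zero_norm' ?_ hb
    filter_upwards [he, he', PF_symm sig, PF_n (eventually_gt_atTop 0)] with p he he' hs hn
    have hn' : (0:ℝ) < p.1 := by exact_mod_cast hn
    set H := (BY ℓ (t+1/t) p)⁻¹ with hH
    have i1 := nonsing_inv_mul _ (det_unit_of_lower hε' he')
    have i2 := mul_nonsing_inv _ (det_unit_of_lower hε he)
    have i3 : BW (t+1/t) p = BY ℓ (t+1/t) p + (ℓ/p.1) • vecMulVec p.2.1 p.2.1 := by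
      rw [BY, YY, BW]; abel
    have i4 : H - GG t p = (ℓ/p.1) • (H * vecMulVec p.2.1 p.2.1 * GG t p) := by
      have : H - GG t p = H * (BW (t+1/t) p * GG t p) - (H * BY ℓ (t+1/t) p) * GG t p := by
        rw [GG, i2, hH, i1, mul_one, one_mul]
      rw [this, ← mul_assoc, ← sub_mul, ← mul_sub]
      rw [i3, add_sub_cancel_left, mul_smul_comm, smul_mul_assoc]
    rw [← sub_div, ← trace_sub, i4, trace_smul, smul_eq_mul]
    have i5 : (H * vecMulVec p.2.1 p.2.1 * GG t p).trace = (GG t p *ᵥ p.2.1) ⬝ᵥ (H *ᵥ p.2.1) := by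
      rw [mul_vecMulVec, vecMulVec_mul, trace_vecMulVec, ← mulVec_transpose]
      have : (GG t p)ᵀ = GG t p := by rw [GG, transpose_nonsing_inv, BW_symm hs]
      rw [this, dotProduct_comm]
    rw [i5]
    have b1 := (solve_bounds hε (GG t p *ᵥ p.2.1) p.2.1 (by
      have := he (GG t p *ᵥ p.2.1); rwa [GG, inv_solve hε he] at this)).1
    have b2 := (solve_bounds hε' (H *ᵥ p.2.1) p.2.1 (by
      have := he' (H *ᵥ p.2.1); rwa [hH, inv_solve hε' he'] at this)).1
    have hS := dnn p.2.1
    have b3 := cs_dot' _ _ (A := √(p.2.1 ⬝ᵥ p.2.1) / ε) (B := √(p.2.1 ⬝ᵥ p.2.1) / ε') (b1.trans_eq (by rw [div_pow, Real.sq_sqrt hS])) (b2.trans_eq (by rw [div_pow, Real.sq_sqrt hS])) (by positivity) (by positivity)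
    rw [Real.norm_eq_abs, abs_div, abs_mul, abs_of_nonneg (show 0 ≤ ℓ / p.1 by positivity), abs_of_pos hn']
    calc _ ≤ ℓ / p.1 * (√(p.2.1 ⬝ᵥ p.2.1) / ε * (√(p.2.1 ⬝ᵥ p.2.1) / ε')) / p.1 := by gcongr
      _ = ℓ / p.1 * ((√(p.2.1 ⬝ᵥ p.2.1))^2 / (ε * ε')) / p.1 := by ring
      _ = _ := by rw [Real.sq_sqrt hS]; ring
  have := hd.add (trG_lim sig t ht ht1)
  simpa using this

/-- (f1) -/
lemma test1 (sig ℓ ε : ℝ) (hsig : 0 < sig) (hl : 0 < ℓ) (hθ : 1 < ℓ * sig^2) (hε : 0 < ε) :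
    ∀ᶠ p in PF sig, ∃ w : Fin p.1 → ℝ, w ≠ 0 ∧ (ℓ * sig^2 + 1/(ℓ * sig^2) - ε) * (w ⬝ᵥ w) ≤ w ⬝ᵥ (YY ℓ p *ᵥ w) := by
  set θ := ℓ * sig^2 with hθd
  have hθ0 : 0 < 1/θ := by positivity
  have hθ1 : 1/θ < 1 := by rw [div_lt_one (by linarith)]; exact hθ
  have hc : ContinuousAt (fun t : ℝ => t + 1/t) (1/θ) := by
    apply ContinuousAt.add continuousAt_id; apply ContinuousAt.div continuousAt_const continuousAt_id; exact hθ0.ne'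
  have h1 := hc.eventually_const_lt (show θ + 1/θ - ε < (fun t : ℝ => t + 1/t) (1/θ) by simp; linarith)
  obtain ⟨t, h2, h3, h4⟩ := ((_root_.frequently_gt_nhds (1/θ)).and_eventually (h1.and (eventually_lt_nhds hθ1))).exists
  obtain ⟨l, h5, h6⟩ := exists_between h2
  have ht := hθ0.trans h2
  have h7 : 1/ℓ - l * sig^2 < 0 := by
    rw [div_lt_iff₀ (by linarith)] at h5
    rw [sub_neg, div_lt_iff₀ hl]; linarith
  have hS := ((PF_normS sig hsig).const_mul l).const_sub (1/ℓ)
  filter_upwards [hS.eventually_lt_const h7, PF_L sig t l hsig ht h4 h6, PF_n (eventually_gt_atTop 0)] with p h8 h9 hn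
  have hn' : (0:ℝ) < p.1 := by exact_mod_cast hn
  obtain ⟨x, hx⟩ := h9
  rw [qf_eq, BW_quad] at hx
  have h10 : 1/ℓ * p.1 < l * (p.2.1 ⬝ᵥ p.2.1) := by
    rw [sub_neg, ← mul_div_assoc, lt_div_iff₀ hn'] at h8; exact h8
  have h11 : 2 * (p.2.1 ⬝ᵥ x) ≤ 1/ℓ * p.1 + ℓ / p.1 * (p.2.1 ⬝ᵥ x)^2 := by
    have : 0 ≤ ℓ / p.1 * (p.2.1 ⬝ᵥ x - p.1/ℓ)^2 := by positivity
    have e : ℓ / p.1 * (p.2.1 ⬝ᵥ x - p.1/ℓ)^2 = ℓ / p.1 * (p.2.1 ⬝ᵥ x)^2 - 2 * (p.2.1 ⬝ᵥ x) + 1/ℓ * p.1 := by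
      field_simp; ring
    linarith
  refine ⟨x, ?_, ?_⟩
  · rintro rfl
    simp at hx
    have := hx
    have : 0 < 1/ℓ * p.1 := by positivity
    linarith
  · rw [YY_quad]
    have := mul_le_mul_of_nonneg_right h3.le (dnn x)
    linarith

/-- (f2) -/
lemma test2 (sig ℓ ε : ℝ) (hsig : 0 < sig) (hl : 0 < ℓ) (hε : 0 < ε) :
    ∀ᶠ p in PF sig, ∃ w : Fin p.1 → ℝ, w ≠ 0 ∧ (2 - ε) * (w ⬝ᵥ w) ≤ w ⬝ᵥ (YY ℓ p *ᵥ w) := by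
  obtain ⟨t, h1, h2⟩ := exists_between (show max (1 - ε/2) 0 < 1 by simp; linarith)
  have ht : 0 < t := (le_max_right _ _).trans_lt h1
  have h1' := (le_max_left _ _).trans_lt h1
  obtain ⟨δ, hδ, hlow⟩ := PF_lower' sig t ht h2
  have hlim := ((gs_norm sig t hsig ht h2).const_mul (t + 1/t - (2 - ε))).sub (gs_lim sig t hsig ht h2)
  have ht2 : 0 < 1 - t^2 := by nlinarith
  have hpos : 0 < (t + 1/t - (2 - ε)) * (t^2/(1-t^2) * sig^2) - t * sig^2 := by
    have : (t + 1/t - (2 - ε)) * (t^2/(1-t^2) * sig^2) - t * sig^2 = (2 * t - (2 - ε)) * (t^2/(1-t^2) * sig^2) := by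
      field_simp; ring
    rw [this]
    apply mul_pos (by linarith); positivity
  have hpos2 : 0 < t^2/(1-t^2) * sig^2 := by positivity
  filter_upwards [hlim.eventually_const_lt hpos, (gs_norm sig t hsig ht h2).eventually_const_lt hpos2, hlow, PF_n (eventually_gt_atTop 0)] with p h3 h4 hlow hn
  have hn' : (0:ℝ) < p.1 := by exact_mod_cast hn
  refine ⟨gs t p, ?_, ?_⟩
  · intro h; rw [h] at h4; simp at h4
  · have e2 : BW (t+1/t) p *ᵥ gs t p = p.2.1 := inv_solve hδ hlow p.2.1
    have e := BW_quad (t+1/t) p (gs t p)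
    rw [e2, dotProduct_comm] at e
    rw [YY_quad]
    have : 0 ≤ ℓ / p.1 * (p.2.1 ⬝ᵥ gs t p)^2 := by positivity
    rw [← mul_div_assoc, ← sub_div, lt_div_iff₀ hn'] at h3
    nlinarith
end

section

section
variable {n : ℕ} (hn : 0 < n) {a : ℝ} (ha : 0 < a) {β : ℝ} {Y : Matrix (Fin n) (Fin n) ℝ}

include hn ha in
lemma concY (hY : Yᵀ = Y) {z ρ ε : ℝ} (hz : a^2 * ρ = a * z - β) (hε : 0 < ε)
    (hl : ∀ x, ε * (x ⬝ᵥ x) ≤ x ⬝ᵥ ((z • (1 : Matrix (Fin n) (Fin n) ℝ) - Y) *ᵥ x)) (h : Fin n → ℝ) :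
    ∫ x, (RR x - ρ)^2 ∂(gY n a β Y) ≤
      ((z • (1 : Matrix (Fin n) (Fin n) ℝ) - Y)⁻¹.trace / n / a + (h ⬝ᵥ h) / n - ρ)^2 + 2/(a^2 * ε^2) * (1/n) +
      4 * ((h ⬝ᵥ h) / n) / (a * ε) * (1/n) + 2/a * ((h ⬝ᵥ ((z • (1 : Matrix (Fin n) (Fin n) ℝ) - Y) *ᵥ h)) / n) := by
  have hn' : (0:ℝ) < n := by exact_mod_cast hn
  set M := z • (1 : Matrix (Fin n) (Fin n) ℝ) - Y with hM
  have hMs : Mᵀ = M := by rw [hM, transpose_sub, transpose_smul, transpose_one, hY]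
  have h1 := conc (B := a • M) (κ := a^2/(4*n)) (P := n * ρ) (ε := a * ε) (by rw [transpose_smul, hMs])
    (by positivity) (by positivity) (fun x => by
      rw [smul_mulVec, dotProduct_smul, smul_eq_mul, mul_assoc]
      exact mul_le_mul_of_nonneg_left (hl x) ha.le) h
  have e1 : a • M - (4 * (a^2/(4*n)) * (n*ρ)) • (1 : Matrix (Fin n) (Fin n) ℝ) = β • 1 - a • Y := by
    have : 4 * (a^2/(4*n)) * (n*ρ) = a * z - β := by rw [← hz]; field_simp
    rw [this, hM, smul_sub, sub_smul, smul_smul]; abel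
  rw [e1] at h1
  have e2 : (a • M)⁻¹.trace = M⁻¹.trace / a := by
    have hd := det_unit_of_lower hε hl
    have : (a • M)⁻¹ = a⁻¹ • M⁻¹ := by
      apply inv_eq_right_inv
      rw [smul_mul_smul_comm, mul_nonsing_inv _ hd, mul_inv_cancel₀ ha.ne', one_smul]
    rw [this, trace_smul, smul_eq_mul]; ring
  rw [e2, smul_mulVec, dotProduct_smul, smul_eq_mul, Fintype.card_fin] at h1
  have e3 : ∫ x, (x ⬝ᵥ x - n * ρ)^2 ∂(gY n a β Y) = n^2 * ∫ x, (RR x - ρ)^2 ∂(gY n a β Y) := by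
    rw [← integral_const_mul]; congr 1; ext x; rw [RR]; field_simp
  change a^2/(4*n) * ∫ x, (x ⬝ᵥ x - n * ρ)^2 ∂(gY n a β Y) ≤ _ at h1
  rw [e3] at h1
  have h2 : (0:ℝ) < a^2 / (4*n) * n^2 := by positivity
  refine le_of_mul_le_mul_left ?_ h2
  calc _ = a^2/(4*n) * (n^2 * ∫ x, (RR x - ρ)^2 ∂(gY n a β Y)) := by ring
    _ ≤ _ := h1
    _ = _ := by field_simp; ring

/-- second moment of the fluctuation -/
def del (n : ℕ) (a β : ℝ) (Y : Matrix (Fin n) (Fin n) ℝ) (ρ : ℝ) : ℝ := ∫ x, (RR x - ρ)^2 ∂(gY n a β Y)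
def dd (n : ℕ) (a β : ℝ) (Y : Matrix (Fin n) (Fin n) ℝ) (ρ : ℝ) : ℝ := ∫ x, |RR x - ρ| * RR x ∂(gY n a β Y)
def rav (n : ℕ) (a β : ℝ) (Y : Matrix (Fin n) (Fin n) ℝ) : ℝ := ∫ x, RR x ∂(gY n a β Y)

lemma del_nonneg (ρ : ℝ) : 0 ≤ del n a β Y ρ := integral_nonneg fun x => sq_nonneg _
lemma dd_nonneg (ρ : ℝ) : 0 ≤ dd n a β Y ρ := integral_nonneg fun x => mul_nonneg (abs_nonneg _) (RR_nonneg x)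
lemma rav_nonneg : 0 ≤ rav n a β Y := integral_nonneg fun x => RR_nonneg x

lemma RRs_PG (ρ : ℝ) : PG (fun x : Fin n → ℝ => RR x - ρ) := RR_PG.sub (PG.const ρ)

include hn ha in
lemma rav_le (ρ : ℝ) : |rav n a β Y - ρ| ≤ √(del n a β Y ρ) := by
  have : IsProbabilityMeasure (gY n a β Y) := gY_prob hn ha β Y
  apply Real.abs_le_sqrt
  have := sq_av_le hn ha (RRs_PG (n := n) ρ) (β := β) (Y := Y)
  rw [integral_sub (RR_PG.intY hn ha β Y) (integrable_const _), integral_const, probReal_univ, one_smul] at this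
  exact this

include hn ha in
lemma dd_le (ρ : ℝ) : dd n a β Y ρ ≤ del n a β Y ρ + |ρ| * √(del n a β Y ρ) := by
  have h1 : ∫ x, |RR x - ρ| ∂(gY n a β Y) ≤ √(del n a β Y ρ) := by
    apply Real.le_sqrt_of_sq_le
    have := sq_av_le hn ha (RRs_PG (n := n) ρ).abs (β := β) (Y := Y)
    simp only [sq_abs] at this
    exact this
  have h2 : dd n a β Y ρ ≤ ∫ x, ((RR x - ρ)^2 + |ρ| * |RR x - ρ|) ∂(gY n a β Y) := by
    refine integral_mono (((RRs_PG ρ).abs.mul RR_PG).intY hn ha β Y)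
      ((((RRs_PG ρ).pow 2).add ((PG.const |ρ|).mul (RRs_PG ρ).abs)).intY hn ha β Y) fun x => ?_
    simp only
    rw [← sq_abs (RR x - ρ)]
    have : RR x ≤ |RR x - ρ| + |ρ| := by
      have := le_abs_self (RR x - ρ); have := le_abs_self ρ; linarith
    nlinarith [abs_nonneg (RR x - ρ)]
  rw [integral_add (((RRs_PG ρ).pow 2).intY hn ha β Y) (((PG.const |ρ|).mul (RRs_PG ρ).abs).intY hn ha β Y),
    integral_const_mul] at h2
  refine h2.trans ?_
  have := mul_le_mul_of_nonneg_left h1 (abs_nonneg ρ)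
  rw [del] at *
  linarith

include hn ha in
lemma Mat_bound {ρ : ℝ} (u w : Fin n → ℝ) {A B : ℝ} (hu : u ⬝ᵥ u ≤ A^2) (hw : w ⬝ᵥ w ≤ B^2) (hA : 0 ≤ A) (hB : 0 ≤ B) :
    |u ⬝ᵥ (Mat n a β Y (fun x => RR x - ρ) *ᵥ w)| ≤ A * B * dd n a β Y ρ := by
  have hn' : (0:ℝ) < n := by exact_mod_cast hn
  rw [Mat_bil hn ha (RRs_PG ρ), abs_div, abs_of_pos hn', div_le_iff₀ hn', dd]
  refine (abs_integral_le_integral_abs).trans ?_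
  have hp : PG (fun x : Fin n → ℝ => |(RR x - ρ) * ((u ⬝ᵥ x) * (w ⬝ᵥ x))|) :=
    ((RRs_PG ρ).mul ((PG.dotc u).mul (PG.dotc w))).abs
  rw [mul_right_comm, ← integral_const_mul]
  refine integral_mono (hp.intY hn ha β Y) (((PG.const _).mul ((RRs_PG ρ).abs.mul RR_PG)).intY hn ha β Y) fun x => ?_
  simp only
  rw [abs_mul, abs_mul]
  have hx := dnn x
  have h1 := cs_dot' u x (B := √(x ⬝ᵥ x)) hu (by rw [Real.sq_sqrt hx]) hA (Real.sqrt_nonneg _)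
  have h2 := cs_dot' w x (B := √(x ⬝ᵥ x)) hw (by rw [Real.sq_sqrt hx]) hB (Real.sqrt_nonneg _)
  have h3 : |u ⬝ᵥ x| * |w ⬝ᵥ x| ≤ A * B * (x ⬝ᵥ x) := by
    calc _ ≤ (A * √(x ⬝ᵥ x)) * (B * √(x ⬝ᵥ x)) := by gcongr
      _ = A * B * (√(x ⬝ᵥ x))^2 := by ring
      _ = _ := by rw [Real.sq_sqrt hx]
  calc _ ≤ |RR x - ρ| * (A * B * (x ⬝ᵥ x)) := by gcongr
    _ = _ := by rw [RR]; field_simp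

include hn ha in
lemma Mat_one_bound (u : Fin n → ℝ) :
    0 ≤ u ⬝ᵥ (Mat n a β Y (fun _ => 1) *ᵥ u) ∧ u ⬝ᵥ (Mat n a β Y (fun _ => 1) *ᵥ u) ≤ (u ⬝ᵥ u) * rav n a β Y := by
  have hn' : (0:ℝ) < n := by exact_mod_cast hn
  rw [Mat_bil hn ha (PG.const 1)]
  constructor
  · apply div_nonneg _ hn'.le
    exact integral_nonneg fun x => by simp only [one_mul]; exact mul_self_nonneg _
  rw [div_le_iff₀ hn', rav, mul_right_comm, ← integral_const_mul]
  refine integral_mono (((PG.const 1).mul ((PG.dotc u).mul (PG.dotc u))).intY hn ha β Y)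
    (((PG.const _).mul RR_PG).intY hn ha β Y) fun x => ?_
  simp only
  have := cs_dot u x
  rw [RR]
  calc _ = (u ⬝ᵥ x)^2 := by ring
    _ ≤ _ := this
    _ = _ := by field_simp

include hn ha in
lemma Mat_tr_bound {ρ ε : ℝ} (hε : 0 < ε) {B : Matrix (Fin n) (Fin n) ℝ} (hl : ∀ x, ε * (x ⬝ᵥ x) ≤ x ⬝ᵥ (B *ᵥ x)) :
    |(B⁻¹ * Mat n a β Y (fun x => RR x - ρ)).trace| ≤ dd n a β Y ρ / ε := by
  have hn' : (0:ℝ) < n := by exact_mod_cast hn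
  rw [Mat_trace hn ha (RRs_PG ρ), abs_div, abs_of_pos hn', div_le_iff₀ hn', dd]
  refine (abs_integral_le_integral_abs).trans ?_
  rw [div_mul_eq_mul_div, mul_div_assoc, mul_comm, ← integral_const_mul]
  refine integral_mono (((RRs_PG ρ).mul (PG.qd _)).abs.intY hn ha β Y)
    (((PG.const _).mul ((RRs_PG ρ).abs.mul RR_PG)).intY hn ha β Y) fun x => ?_
  simp only
  obtain ⟨_, h1, h2⟩ := solve_bounds hε (B⁻¹ *ᵥ x) x (by
      have := hl (B⁻¹ *ᵥ x); rwa [inv_solve hε hl] at this)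
  rw [dotProduct_comm] at h1 h2
  rw [abs_mul, abs_of_nonneg h2]
  calc _ ≤ |RR x - ρ| * ((x ⬝ᵥ x) / ε) := by gcongr
    _ = _ := by rw [RR]; field_simp
end

lemma PF_fst (sig : ℝ) : Tendsto (fun p : PP => p.1) (PF sig) atTop := by
  intro s hs; exact PF_n hs

lemma PF_inv_n (sig : ℝ) : Tendsto (fun p : PP => (1:ℝ) / p.1) (PF sig) (nhds 0) :=
  tendsto_one_div_atTop_nhds_zero_nat.comp (PF_fst sig)

/-- concentration, non-condensed case -/
lemma del_lim3 (sig ℓ a β : ℝ) (hsig : 0 < sig) (hl : 0 < ℓ) (ha : 0 < a) (hβ : 0 < β)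
    (h1 : a < β) (h2 : a * (ℓ * sig^2) < β) :
    Tendsto (fun p : PP => del p.1 a β (YY ℓ p) (1/β)) (PF sig) (nhds 0) := by
  have ht : 0 < a/β := by positivity
  have ht1 : a/β < 1 := by rw [div_lt_one hβ]; exact h1
  have hθ : ℓ * sig^2 * (a/β) < 1 := by rw [← mul_div_assoc, div_lt_one hβ]; linarith
  obtain ⟨ε, hε, he⟩ := BY_lower sig ℓ (a/β) hsig hl ht ht1 hθ
  have L := (((trH_lim sig ℓ (a/β) hsig hl ht ht1 hθ).div_const a).sub_const (1/β)).pow 2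
  have L2 := L.add ((PF_inv_n sig).const_mul (2/(a^2*ε^2)))
  have e0 : (a/β/a - 1/β)^2 + 2/(a^2*ε^2) * 0 = 0 := by field_simp; simp
  rw [e0] at L2
  refine squeeze_zero' (Eventually.of_forall fun p => del_nonneg _) ?_ L2
  filter_upwards [he, PF_symm sig, PF_n (eventually_gt_atTop 0)] with p he hs hn
  have := concY hn ha (β := β) (ρ := 1/β) (YY_symm hs ℓ) (z := a/β + 1/(a/β)) (by field_simp; ring) hε he 0
  refine this.trans_eq ?_
  simp [BY]

set_option maxHeartbeats 1600000 in
/-- concentration, condensed case -/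
lemma del_lim12 (sig ℓ a β T : ℝ) (hsig : 0 < sig) (hl : 0 < ℓ) (ha : 0 < a) (hβ : 0 < β)
    (hT : 0 < T) (hT1 : T ≤ 1) (hTβ : β * T ≤ a) (hTθ : ℓ * sig^2 * T ≤ 1)
    (test : ∀ ε, 0 < ε → ∀ᶠ p in PF sig, ∃ w : Fin p.1 → ℝ, w ≠ 0 ∧ (T + 1/T - ε) * (w ⬝ᵥ w) ≤ w ⬝ᵥ (YY ℓ p *ᵥ w)) :
    Tendsto (fun p : PP => del p.1 a β (YY ℓ p) ((a * (T + 1/T) - β)/a^2)) (PF sig) (nhds 0) := by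
  set ρ := (a * (T + 1/T) - β)/a^2 with hρ
  rw [tendsto_order]
  refine ⟨fun b hb => Eventually.of_forall fun p => hb.trans_le (del_nonneg _), fun η hη => ?_⟩
  -- choose t
  let f : ℝ → ℝ := fun t => 2 * (2/a * (2 * ((t + 1/t) - (T + 1/T)) * ((a * (t + 1/t) - β)/a^2)))
    + 2 * (((t + 1/t) - (T + 1/T))/a)^2
  have hc : ContinuousAt f T := by
    have : ContinuousAt (fun t : ℝ => t + 1/t) T := by
      apply ContinuousAt.add continuousAt_id; apply ContinuousAt.div continuousAt_const continuousAt_id; exact hT.ne'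
    apply ContinuousAt.add
    · apply ContinuousAt.mul continuousAt_const
      apply ContinuousAt.mul continuousAt_const
      apply ContinuousAt.mul
      · exact (this.sub continuousAt_const).const_mul 2
      · exact ((this.const_mul a).sub continuousAt_const).div_const _
    · exact (((this.sub continuousAt_const).div_const _).pow 2).const_mul 2
  have h1 := hc.eventually_lt_const (show f T < η by simp [f]; exact hη)
  obtain ⟨t, htT, hf, ht⟩ := ((_root_.frequently_lt_nhds T).and_eventually (h1.and (eventually_gt_nhds hT))).exists
  have ht1 : t < 1 := htT.trans_le hT1
  have hpos : 0 < ℓ * sig^2 := by positivity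
  have hθ : ℓ * sig^2 * t < 1 := by nlinarith
  set e := (t + 1/t) - (T + 1/T) with he
  have he0 : 0 < e := by have := zlt ht htT hT1; linarith
  set ρ' := (a * (t + 1/t) - β)/a^2 with hρ'
  have hρt : t / a < ρ' := by
    rw [hρ', lt_div_iff₀ (by positivity)]
    have : β < a * (1/t) := by
      rw [mul_one_div, lt_div_iff₀ ht]; nlinarith
    have e : t/a * a^2 = a * t := by field_simp
    rw [e]; linarith
  have hρ0 : 0 < ρ' := lt_trans (by positivity) hρt
  obtain ⟨ε, hε, hlow⟩ := BY_lower sig ℓ t hsig hl ht ht1 hθ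
  have L := (trH_lim sig ℓ t hsig hl ht ht1 hθ).div_const a
  have L2 := (((PF_inv_n sig).const_mul (2/(a^2*ε^2))).add ((PF_inv_n sig).const_mul (4 * ρ' / (a * ε)))).const_mul 2
  simp only [mul_zero, add_zero] at L2
  have L3 := L2.add_const (f t)
  rw [zero_add] at L3
  filter_upwards [L.eventually_const_lt (show 0 < t/a by positivity), L.eventually_lt_const hρt, L3.eventually_lt_const hf,
    hlow, test e he0, PF_symm sig, PF_n (eventually_gt_atTop 0)] with p hp1 hp2 hp3 hlow ⟨w, hw0, hw⟩ hs hn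
  have hn' : (0:ℝ) < p.1 := by exact_mod_cast hn
  have hww : 0 < w ⬝ᵥ w := dot_self_pos hw0
  set τ := ((BY ℓ (t+1/t) p)⁻¹).trace / p.1 / a with hτ
  set h : Fin p.1 → ℝ := √(p.1 * (ρ' - τ) / (w ⬝ᵥ w)) • w with hh
  have hsq : 0 ≤ p.1 * (ρ' - τ) / (w ⬝ᵥ w) := by apply div_nonneg _ hww.le; apply mul_nonneg hn'.le; linarith
  have h2 : (h ⬝ᵥ h) / p.1 = ρ' - τ := by
    rw [hh, smul_dotProduct, dotProduct_smul, smul_smul, Real.mul_self_sqrt hsq, smul_eq_mul]; field_simp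
  have h3 : (h ⬝ᵥ (BY ℓ (t+1/t) p *ᵥ h)) / p.1 ≤ 2 * e * ρ' := by
    have : h ⬝ᵥ (BY ℓ (t+1/t) p *ᵥ h) ≤ 2 * e * (h ⬝ᵥ h) := by
      rw [BY_quad, hh, mulVec_smul, smul_dotProduct, smul_dotProduct, dotProduct_smul, dotProduct_smul, smul_smul, smul_smul, Real.mul_self_sqrt hsq, smul_eq_mul, smul_eq_mul]
      have : (t + 1/t) * (w ⬝ᵥ w) - w ⬝ᵥ (YY ℓ p *ᵥ w) ≤ 2 * e * (w ⬝ᵥ w) := by linarith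
      nlinarith [mul_le_mul_of_nonneg_left this hsq]
    calc _ ≤ 2 * e * (h ⬝ᵥ h) / p.1 := by gcongr
      _ = 2 * e * (ρ' - τ) := by rw [← h2]; ring
      _ ≤ _ := by gcongr; linarith
  have hC := concY hn ha (β := β) (ρ := ρ') (YY_symm hs ℓ) (z := t + 1/t) (by rw [hρ']; field_simp) hε hlow h
  change ∫ x, (RR x - ρ')^2 ∂(gY p.1 a β (YY ℓ p)) ≤ (τ + _ - ρ')^2 + _ + _ + 2/a * ((h ⬝ᵥ (BY ℓ (t+1/t) p *ᵥ h)) / p.1) at hC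
  rw [h2] at hC
  have h4 : 2/a * ((h ⬝ᵥ (BY ℓ (t+1/t) p *ᵥ h)) / p.1) ≤ 2/a * (2 * e * ρ') := by gcongr
  have h5 : 4 * (ρ' - τ) / (a * ε) * (1/p.1) ≤ 4 * ρ' / (a * ε) * (1/(p.1:ℝ)) := by gcongr; linarith
  have h6 : del p.1 a β (YY ℓ p) ρ ≤ 2 * del p.1 a β (YY ℓ p) ρ' + 2 * (e/a)^2 := by
    have : IsProbabilityMeasure (gY p.1 a β (YY ℓ p)) := gY_prob hn ha _ _
    have hd : ρ' - ρ = e/a := by rw [hρ', hρ, he]; field_simp; ring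
    calc _ ≤ ∫ x, (2 * (RR x - ρ')^2 + 2 * (e/a)^2) ∂(gY p.1 a β (YY ℓ p)) := by
            refine integral_mono (((RRs_PG ρ).pow 2).intY hn ha _ _) ((((PG.const 2).mul ((RRs_PG ρ').pow 2)).add (PG.const (2 * (e/a)^2))).intY hn ha _ _) fun x => ?_
            simp only
            rw [← hd]
            nlinarith [sq_nonneg (RR x - ρ' - (ρ' - ρ))]
      _ = _ := by
            rw [integral_add (((PG.const 2).mul ((RRs_PG ρ').pow 2)).intY hn ha _ _) (integrable_const _), integral_const_mul, integral_const, probReal_univ, one_smul, del]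
  refine lt_of_le_of_lt ?_ hp3
  have h7 : del p.1 a β (YY ℓ p) ρ' ≤ 2/(a^2*ε^2) * (1/p.1) + 4 * ρ' / (a * ε) * (1/p.1) + 2/a * (2 * e * ρ') := by
    rw [del]; refine hC.trans ?_
    have : (τ + (ρ' - τ) - ρ')^2 = 0 := by ring
    rw [this]; linarith
  simp only [f]
  linarith
end

section

/-- overlap with the signal -/
def m2 (a β ℓ : ℝ) (p : PP) : ℝ := (p.2.1 ⬝ᵥ (Mat p.1 a β (YY ℓ p) (fun _ => 1) *ᵥ p.2.1)) / p.1

def EE (a β ℓ ρ : ℝ) (p : PP) : Matrix (Fin p.1) (Fin p.1) ℝ :=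
  (1/(a*p.1)) • (1 : Matrix (Fin p.1) (Fin p.1) ℝ) - a • Mat p.1 a β (YY ℓ p) (fun x => RR x - ρ)

def er (a β ℓ ρ : ℝ) (p : PP) : ℝ := 1/(a*p.1) + a * dd p.1 a β (YY ℓ p) ρ

section
variable {a β ℓ ρ z : ℝ} {p : PP} (hn : 0 < p.1) (ha : 0 < a) (hs : (p.2.2)ᵀ = p.2.2)

include ha in
lemma er_nonneg : 0 ≤ er a β ℓ ρ p := by
  have := dd_nonneg (n := p.1) (a := a) (β := β) (Y := YY ℓ p) ρ
  unfold er; positivity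

include hn ha in
lemma EE_bound (u w : Fin p.1 → ℝ) {A B : ℝ} (hu : u ⬝ᵥ u ≤ A^2) (hw : w ⬝ᵥ w ≤ B^2) (hA : 0 ≤ A) (hB : 0 ≤ B) :
    |u ⬝ᵥ (EE a β ℓ ρ p *ᵥ w)| ≤ A * B * er a β ℓ ρ p := by
  have h1 := Mat_bound hn ha u w hu hw hA hB (β := β) (Y := YY ℓ p) (ρ := ρ)
  have h2 := cs_dot' u w hu hw hA hB
  rw [EE, sub_mulVec, smul_mulVec, smul_mulVec, one_mulVec, dotProduct_sub, dotProduct_smul, dotProduct_smul, smul_eq_mul, smul_eq_mul]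
  refine (abs_sub _ _).trans ?_
  rw [abs_mul, abs_mul, abs_of_pos ha, abs_of_nonneg (show 0 ≤ 1/(a*(p.1:ℝ)) by positivity), er]
  calc _ ≤ 1/(a*p.1) * (A*B) + a * (A * B * dd p.1 a β (YY ℓ p) ρ) := by gcongr
    _ = _ := by ring

include hn ha hs in
lemma main_eq (hz : a^2 * ρ = a * z - β) (v : Fin p.1 → ℝ) :
    BW z p *ᵥ (Mat p.1 a β (YY ℓ p) (fun _ => 1) *ᵥ v) = EE a β ℓ ρ p *ᵥ v +
      ((ℓ/p.1) * (p.2.1 ⬝ᵥ (Mat p.1 a β (YY ℓ p) (fun _ => 1) *ᵥ v))) • p.2.1 := by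
  have h := xibp hn ha (YY_symm hs ℓ) hz
  have h2 := congrArg (fun M => M *ᵥ v) h
  simp only [← mulVec_mulVec] at h2
  change _ = EE a β ℓ ρ p *ᵥ v at h2
  rw [← h2]
  set y := Mat p.1 a β (YY ℓ p) (fun _ => 1) *ᵥ v
  have e : BW z p = (z • 1 - YY ℓ p) + (ℓ/p.1) • vecMulVec p.2.1 p.2.1 := by rw [BW, YY]; abel
  rw [e, add_mulVec, smul_mulVec, vecMulVec_mulVec, IsCentralScalar.op_smul_eq_smul, smul_smul]

lemma As_symm (u v : Fin p.1 → ℝ) : u ⬝ᵥ (Mat p.1 a β (YY ℓ p) (fun _ => 1) *ᵥ v) = v ⬝ᵥ (Mat p.1 a β (YY ℓ p) (fun _ => 1) *ᵥ u) := by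
  rw [symm_dot (Mat_symm _), dotProduct_comm]

include hn ha hs in
/-- κ relation -/
lemma kappa_eq {z' : ℝ} (hz : a^2 * ρ = a * z - β) (u v : Fin p.1 → ℝ) (hu : BW z' p *ᵥ u = p.2.1) :
    (1 - ℓ * ((p.2.1 ⬝ᵥ u)/p.1)) * (p.2.1 ⬝ᵥ (Mat p.1 a β (YY ℓ p) (fun _ => 1) *ᵥ v)) =
      u ⬝ᵥ (EE a β ℓ ρ p *ᵥ v) + (z' - z) * (u ⬝ᵥ (Mat p.1 a β (YY ℓ p) (fun _ => 1) *ᵥ v)) := by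
  have h1 := main_eq hn ha hs hz v (ℓ := ℓ)
  set y := Mat p.1 a β (YY ℓ p) (fun _ => 1) *ᵥ v with hy
  have h2 : p.2.1 ⬝ᵥ y = u ⬝ᵥ (BW z' p *ᵥ y) := by rw [symm_dot (BW_symm hs z'), hu]
  have h3 : BW z' p *ᵥ y = BW z p *ᵥ y + (z' - z) • y := by
    simp only [BW, sub_mulVec, smul_mulVec, one_mulVec, sub_smul]; abel
  rw [h3, h1, dotProduct_add, dotProduct_add, dotProduct_smul, dotProduct_smul, smul_eq_mul, smul_eq_mul,
    dotProduct_comm u p.2.1] at h2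
  linear_combination h2

include hn ha hs in
lemma m2_ineq {z' ε : ℝ} (hz : a^2 * ρ = a * z - β) (hzz : z ≤ z') (hε : 0 < ε)
    (hl : ∀ x, ε * (x ⬝ᵥ x) ≤ x ⬝ᵥ (BW z' p *ᵥ x)) (u : Fin p.1 → ℝ) (hu : u = (BW z' p)⁻¹ *ᵥ p.2.1) :
    (1 - ℓ * ((p.2.1 ⬝ᵥ u)/p.1))^2 * m2 a β ℓ p ≤
      |1 - ℓ * ((p.2.1 ⬝ᵥ u)/p.1)| * (((p.2.1 ⬝ᵥ p.2.1) / p.1) / ε * er a β ℓ ρ p) +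
      (z' - z) * (((p.2.1 ⬝ᵥ p.2.1) / p.1) / ε^2 * er a β ℓ ρ p) +
      (z' - z)^2 * (rav p.1 a β (YY ℓ p) * ((u ⬝ᵥ u)/p.1)) := by
  have hn' : (0:ℝ) < p.1 := by exact_mod_cast hn
  have hu' : BW z' p *ᵥ u = p.2.1 := by rw [hu]; exact inv_solve hε hl _
  have k1 := kappa_eq hn ha hs hz u p.2.1 hu' (ℓ := ℓ)
  have k2 := kappa_eq hn ha hs hz u u hu' (ℓ := ℓ)
  have hS := dnn p.2.1
  have b0 := (solve_bounds hε u p.2.1 (by have := hl u; rwa [hu'] at this)).1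
  have b1 : u ⬝ᵥ u ≤ (√(p.2.1 ⬝ᵥ p.2.1)/ε)^2 := b0.trans_eq (by rw [div_pow, Real.sq_sqrt hS])
  have b2 : p.2.1 ⬝ᵥ p.2.1 ≤ (√(p.2.1 ⬝ᵥ p.2.1))^2 := (Real.sq_sqrt hS).ge
  have e1 := EE_bound hn ha u p.2.1 b1 b2 (by positivity) (by positivity) (β := β) (ℓ := ℓ) (ρ := ρ)
  have e2 := EE_bound hn ha u u b1 b1 (by positivity) (by positivity) (β := β) (ℓ := ℓ) (ρ := ρ)
  have e3 := (Mat_one_bound hn ha u (β := β) (Y := YY ℓ p)).2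
  rw [As_symm] at k2
  set κ := 1 - ℓ * ((p.2.1 ⬝ᵥ u)/p.1)
  have key : κ^2 * (p.2.1 ⬝ᵥ (Mat p.1 a β (YY ℓ p) (fun _ => 1) *ᵥ p.2.1)) =
      κ * (u ⬝ᵥ (EE a β ℓ ρ p *ᵥ p.2.1)) + (z' - z) * (u ⬝ᵥ (EE a β ℓ ρ p *ᵥ u)) +
      (z' - z)^2 * (u ⬝ᵥ (Mat p.1 a β (YY ℓ p) (fun _ => 1) *ᵥ u)) := by
    linear_combination κ * k1 + (z' - z) * k2
  have f1 : κ * (u ⬝ᵥ (EE a β ℓ ρ p *ᵥ p.2.1)) ≤ |κ| * (√(p.2.1 ⬝ᵥ p.2.1)/ε * √(p.2.1 ⬝ᵥ p.2.1) * er a β ℓ ρ p) := by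
    refine (le_abs_self _).trans ?_
    rw [abs_mul]; gcongr
  have f2 : (z' - z) * (u ⬝ᵥ (EE a β ℓ ρ p *ᵥ u)) ≤ (z' - z) * (√(p.2.1 ⬝ᵥ p.2.1)/ε * (√(p.2.1 ⬝ᵥ p.2.1)/ε) * er a β ℓ ρ p) := by
    exact mul_le_mul_of_nonneg_left ((le_abs_self _).trans e2) (by linarith)
  have f3 : (z' - z)^2 * (u ⬝ᵥ (Mat p.1 a β (YY ℓ p) (fun _ => 1) *ᵥ u)) ≤ (z' - z)^2 * ((u ⬝ᵥ u) * rav p.1 a β (YY ℓ p)) := by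
    gcongr
  have g1 : √(p.2.1 ⬝ᵥ p.2.1)/ε * √(p.2.1 ⬝ᵥ p.2.1) = (p.2.1 ⬝ᵥ p.2.1)/ε := by
    rw [div_mul_eq_mul_div, Real.mul_self_sqrt hS]
  have g2 : √(p.2.1 ⬝ᵥ p.2.1)/ε * (√(p.2.1 ⬝ᵥ p.2.1)/ε) = (p.2.1 ⬝ᵥ p.2.1)/ε^2 := by
    rw [div_mul_div_comm, Real.mul_self_sqrt hS, pow_two]
  rw [g1] at f1
  rw [g2] at f2
  rw [m2, ← mul_div_assoc, div_le_iff₀ hn', key]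
  refine (add_le_add (add_le_add f1 f2) f3).trans_eq ?_
  field_simp

include hn ha hs in
lemma rav_expand {ε : ℝ} (hz : a^2 * ρ = a * z - β) (hε : 0 < ε) (hℓ : 0 < ℓ)
    (hl : ∀ x, ε * (x ⬝ᵥ x) ≤ x ⬝ᵥ (BW z p *ᵥ x)) (u : Fin p.1 → ℝ) (hu : u = (BW z p)⁻¹ *ᵥ p.2.1) :
    |rav p.1 a β (YY ℓ p) - ((BW z p)⁻¹.trace / p.1 / a + ℓ^2 * m2 a β ℓ p * ((u ⬝ᵥ u)/p.1))| ≤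
      a * (dd p.1 a β (YY ℓ p) ρ / ε) + ℓ * (((p.2.1 ⬝ᵥ p.2.1) / p.1) / ε^2 * er a β ℓ ρ p) := by
  have hn' : (0:ℝ) < p.1 := by exact_mod_cast hn
  have hS := dnn p.2.1
  set G := (BW z p)⁻¹ with hG
  have hGs : Gᵀ = G := by rw [hG, transpose_nonsing_inv, BW_symm hs]
  have hGB : G * BW z p = 1 := nonsing_inv_mul _ (det_unit_of_lower hε hl)
  set A := Mat p.1 a β (YY ℓ p) (fun _ => 1) with hA
  have hAs : Aᵀ = A := Mat_symm _
  have e1 : ∀ v, A *ᵥ v = G *ᵥ (EE a β ℓ ρ p *ᵥ v) + ((ℓ/p.1) * (p.2.1 ⬝ᵥ (A *ᵥ v))) • u := by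
    intro v
    have := congrArg (fun y => G *ᵥ y) (main_eq hn ha hs hz v (ℓ := ℓ))
    simp only at this
    rw [mulVec_mulVec, hGB, one_mulVec, mulVec_add, mulVec_smul, ← hu] at this
    exact this
  have e2 : A = G * EE a β ℓ ρ p + (ℓ/p.1) • vecMulVec u (A *ᵥ p.2.1) := by
    apply ext_of_mulVec_single
    intro i
    rw [e1, add_mulVec, ← mulVec_mulVec, smul_mulVec, vecMulVec_mulVec, IsCentralScalar.op_smul_eq_smul, smul_smul, symm_dot hAs]
  have e3 : rav p.1 a β (YY ℓ p) = (G * EE a β ℓ ρ p).trace + (ℓ/p.1) * (u ⬝ᵥ (A *ᵥ p.2.1)) := by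
    rw [rav, ← Mat_trace_one hn ha, ← hA]
    nth_rw 1 [e2]
    rw [trace_add, trace_smul, trace_vecMulVec, smul_eq_mul]
  have e4 : u ⬝ᵥ (A *ᵥ p.2.1) = (G *ᵥ u) ⬝ᵥ (EE a β ℓ ρ p *ᵥ p.2.1) + ℓ * m2 a β ℓ p * (u ⬝ᵥ u) := by
    rw [e1 p.2.1, dotProduct_add, symm_dot hGs, dotProduct_smul, smul_eq_mul, m2]; ring
  have e5 : (G * EE a β ℓ ρ p).trace = G.trace / p.1 / a - a * (G * Mat p.1 a β (YY ℓ p) (fun x => RR x - ρ)).trace := by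
    rw [EE, mul_sub, trace_sub, mul_smul_comm, mul_smul_comm, trace_smul, trace_smul, mul_one, smul_eq_mul, smul_eq_mul]
    congr 1
    field_simp
  have b1 := Mat_tr_bound hn ha hε hl (β := β) (Y := YY ℓ p) (ρ := ρ)
  rw [← hG] at b1
  have hu' : BW z p *ᵥ u = p.2.1 := by rw [hu]; exact inv_solve hε hl _
  have c0 := (solve_bounds hε u p.2.1 (by have := hl u; rwa [hu'] at this)).1
  have c1 := (solve_bounds hε (G *ᵥ u) u (by have := hl (G *ᵥ u); rwa [hG, inv_solve hε hl] at this)).1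
  have c2 : (G *ᵥ u) ⬝ᵥ (G *ᵥ u) ≤ (√(p.2.1 ⬝ᵥ p.2.1)/ε^2)^2 := by
    refine c1.trans ?_
    rw [div_pow, Real.sq_sqrt hS]
    calc _ ≤ (p.2.1 ⬝ᵥ p.2.1)/ε^2/ε^2 := by gcongr
      _ = _ := by rw [div_div]; ring_nf
  have b2 := EE_bound hn ha (G *ᵥ u) p.2.1 c2 (Real.sq_sqrt hS).ge (by positivity) (by positivity) (β := β) (ℓ := ℓ) (ρ := ρ)
  have e6 : rav p.1 a β (YY ℓ p) - (G.trace / p.1 / a + ℓ^2 * m2 a β ℓ p * ((u ⬝ᵥ u)/p.1)) =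
      - (a * (G * Mat p.1 a β (YY ℓ p) (fun x => RR x - ρ)).trace) + (ℓ/p.1) * ((G *ᵥ u) ⬝ᵥ (EE a β ℓ ρ p *ᵥ p.2.1)) := by
    rw [e3, e4, e5]; field_simp; ring
  rw [e6]
  refine (abs_add_le _ _).trans ?_
  rw [abs_neg, abs_mul, abs_mul, abs_of_pos ha, abs_of_pos (show 0 < ℓ/(p.1:ℝ) by positivity)]
  calc _ ≤ a * (dd p.1 a β (YY ℓ p) ρ / ε) + ℓ/p.1 * (√(p.2.1 ⬝ᵥ p.2.1)/ε^2 * √(p.2.1 ⬝ᵥ p.2.1) * er a β ℓ ρ p) := by gcongr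
    _ = _ := by
      rw [div_mul_eq_mul_div (√(p.2.1 ⬝ᵥ p.2.1)), Real.mul_self_sqrt hS]
      field_simp
end

section
variable {sig a β ℓ ρ : ℝ} (hsig : 0 < sig) (ha : 0 < a) (hℓ : 0 < ℓ)
  (hdel : Tendsto (fun p : PP => del p.1 a β (YY ℓ p) ρ) (PF sig) (nhds 0))

lemma sqrt_lim0 {α : Type*} {F : Filter α} {f : α → ℝ} (h : Tendsto f F (nhds 0)) : Tendsto (fun x => √(f x)) F (nhds 0) := by
  have := (Real.continuous_sqrt.tendsto 0).comp h
  rw [Real.sqrt_zero] at this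
  exact this

include ha hdel in
lemma rav_lim : Tendsto (fun p : PP => rav p.1 a β (YY ℓ p)) (PF sig) (nhds ρ) := by
  rw [tendsto_iff_norm_sub_tendsto_zero]
  refine squeeze_zero' (Eventually.of_forall fun p => norm_nonneg _) ?_ (sqrt_lim0 hdel)
  filter_upwards [PF_n (eventually_gt_atTop 0)] with p hn
  exact rav_le hn ha ρ

include ha hdel in
lemma dd_lim : Tendsto (fun p : PP => dd p.1 a β (YY ℓ p) ρ) (PF sig) (nhds 0) := by
  have := hdel.add ((sqrt_lim0 hdel).const_mul |ρ|)
  rw [mul_zero, add_zero] at this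
  refine squeeze_zero' (Eventually.of_forall fun p => dd_nonneg _) ?_ this
  filter_upwards [PF_n (eventually_gt_atTop 0)] with p hn
  exact dd_le hn ha ρ

include ha hdel in
lemma er_lim : Tendsto (fun p : PP => er a β ℓ ρ p) (PF sig) (nhds 0) := by
  have := ((PF_inv_n sig).const_mul (1/a)).add ((dd_lim ha hdel).const_mul a)
  simp only [mul_zero, add_zero] at this
  refine this.congr fun p => ?_
  rw [er, one_div_mul_one_div]

include hsig ha hℓ hdel in
lemma m2_lim1 {t : ℝ} (ht : 0 < t) (ht1 : t < 1) (hz : a^2 * ρ = a * (t + 1/t) - β) :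
    Tendsto (fun p : PP => m2 a β ℓ p) (PF sig) (nhds ((ρ - t/a) / (ℓ^2 * (t^2/(1-t^2) * sig^2)))) := by
  obtain ⟨ε, hε, he⟩ := PF_lower' sig t ht ht1
  have hb := (((dd_lim ha hdel).div_const ε).const_mul a).add
    ((((PF_normS sig hsig).div_const (ε^2)).mul (er_lim ha hdel)).const_mul ℓ)
  simp only [zero_div, mul_zero, add_zero] at hb
  have h0 : Tendsto (fun p : PP => rav p.1 a β (YY ℓ p) - ((GG t p).trace / p.1 / a + ℓ^2 * m2 a β ℓ p * ((gs t p ⬝ᵥ gs t p)/p.1)))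
      (PF sig) (nhds 0) := by
    refine squeeze_zero_norm' ?_ hb
    filter_upwards [he, PF_symm sig, PF_n (eventually_gt_atTop 0)] with p he hs hn
    exact rav_expand hn ha hs hz hε hℓ he (gs t p) rfl
  have h1 := (((rav_lim ha hdel).sub h0).sub ((trG_lim sig t ht ht1).div_const a)).div
    ((gs_norm sig t hsig ht ht1).const_mul (ℓ^2)) (by have : 0 < 1 - t^2 := by nlinarith
                                                      positivity)
  rw [sub_zero] at h1
  refine h1.congr' ?_
  have hpos : 0 < t^2/(1-t^2) * sig^2 := by
    have : 0 < 1 - t^2 := by nlinarith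
    positivity
  filter_upwards [(gs_norm sig t hsig ht ht1).eventually_const_lt hpos] with p hp
  simp only [Pi.div_apply]
  rw [div_eq_iff (by positivity)]
  ring

include hsig ha hdel in
lemma m2_small {t z : ℝ} (ht : 0 < t) (ht1 : t < 1) (hz : a^2 * ρ = a * z - β) (hzt : z ≤ t + 1/t) (hθ : ℓ * sig^2 * t < 1)
    (η : ℝ) (hη : ((t + 1/t) - z)^2 * (ρ * (t^2/(1-t^2) * sig^2)) / (1 - ℓ * (t * sig^2))^2 < η) :
    ∀ᶠ p in PF sig, m2 a β ℓ p < η := by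
  obtain ⟨ε, hε, he⟩ := PF_lower' sig t ht ht1
  have hκ := ((gs_lim sig t hsig ht ht1).const_mul ℓ).const_sub 1
  have hS := PF_normS sig hsig
  have her := er_lim ha hdel
  have hκ0 : 0 < 1 - ℓ * (t * sig^2) := by linarith
  have L := (((hκ.abs.mul ((hS.div_const ε).mul her)).add (((hS.div_const (ε^2)).mul her).const_mul ((t+1/t) - z))).add
    (((rav_lim ha hdel).mul (gs_norm sig t hsig ht ht1)).const_mul (((t+1/t) - z)^2))).div (hκ.pow 2) (by positivity)
  simp only [mul_zero, zero_add] at L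
  filter_upwards [L.eventually_lt_const hη, he, PF_symm sig, PF_n (eventually_gt_atTop 0), hκ.eventually_const_lt hκ0] with p hp he hs hn hκp
  refine lt_of_le_of_lt ?_ hp
  simp only [Pi.div_apply]
  rw [le_div_iff₀ (by positivity), mul_comm]
  exact m2_ineq hn ha hs hz hzt hε he (gs t p) rfl

lemma m2_nonneg (ha : 0 < a) {p : PP} (hn : 0 < p.1) : 0 ≤ m2 a β ℓ p :=
  div_nonneg (Mat_one_bound hn ha _).1 (by positivity)

include hsig ha hdel in
lemma m2_lim3 {t : ℝ} (ht : 0 < t) (ht1 : t < 1) (hz : a^2 * ρ = a * (t + 1/t) - β) (hθ : ℓ * sig^2 * t < 1) :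
    Tendsto (fun p : PP => m2 a β ℓ p) (PF sig) (nhds 0) := by
  rw [tendsto_order]
  refine ⟨fun b hb => ?_, fun η hη => ?_⟩
  · filter_upwards [PF_n (eventually_gt_atTop 0)] with p hn
    exact hb.trans_le (m2_nonneg ha hn)
  · exact m2_small hsig ha hdel ht ht1 hz le_rfl hθ η (by simpa using hη)

include hsig ha hdel hℓ in
lemma m2_lim2 (hz : a^2 * ρ = a * 2 - β) (hθ : ℓ * sig^2 ≤ 1) :
    Tendsto (fun p : PP => m2 a β ℓ p) (PF sig) (nhds 0) := by
  rw [tendsto_order]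
  refine ⟨fun b hb => ?_, fun η hη => ?_⟩
  · filter_upwards [PF_n (eventually_gt_atTop 0)] with p hn
    exact hb.trans_le (m2_nonneg ha hn)
  · have hc : Continuous (fun t : ℝ => |ρ| * sig^2 * (1 - t)) := by fun_prop
    have h1 := (hc.tendsto 1).eventually_lt_const (show |ρ| * sig^2 * (1-1) < η by simpa using hη)
    obtain ⟨t, h2, h3, ht⟩ := ((_root_.frequently_lt_nhds (1:ℝ)).and_eventually (h1.and (eventually_gt_nhds zero_lt_one))).exists
    have hp : 0 < ℓ * sig^2 := by positivity
    have hθt : ℓ * sig^2 * t ≤ t := by nlinarith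
    refine m2_small hsig ha hdel ht h2 hz ?_ (by linarith) η ?_
    · have := zlt ht h2 le_rfl; norm_num at this ⊢; linarith
    refine lt_of_le_of_lt ?_ h3
    have h4 : t + 1/t - 2 = (1-t)^2/t := by field_simp; ring
    have h5 : 0 < 1 - t := by linarith
    have h6 : 0 < 1 - ℓ * (t * sig^2) := by nlinarith
    rw [h4, div_le_iff₀ (by positivity)]
    have h7 : (1-t)^2 ≤ (1 - ℓ * (t * sig^2))^2 := by
      apply pow_le_pow_left₀ h5.le; linarith
    have h8 : ((1-t)^2/t)^2 * (ρ * (t^2/(1-t^2) * sig^2)) = ρ * sig^2 * (1-t) * (1-t)^2 / (1+t) := by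
      have : 1 - t^2 ≠ 0 := by nlinarith
      field_simp; ring
    rw [h8, div_le_iff₀ (by linarith)]
    calc _ ≤ |ρ| * sig^2 * (1-t) * (1-t)^2 := by gcongr; exact le_abs_self _
      _ ≤ |ρ| * sig^2 * (1-t) * (1 - ℓ * (t * sig^2))^2 := by gcongr
      _ ≤ _ := by
        have : 0 ≤ |ρ| * sig^2 * (1-t) * (1 - ℓ * (t * sig^2))^2 := by positivity
        nlinarith
end
end

section

lemma meas_gY_int {n : ℕ} (a β : ℝ) {f : (Fin n → ℝ) → ℝ} (hf : Continuous f) :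
    Measurable (fun Y : Matrix (Fin n) (Fin n) ℝ => ∫ x, f x ∂gY n a β Y) := by
  unfold gY
  simp only [gm_int]
  have key : ∀ g : (Fin n → ℝ) → ℝ, Continuous g → Measurable (fun Y : Matrix (Fin n) (Fin n) ℝ =>
      ∫ x, g x * Real.exp (-UU (β • (1 : Matrix (Fin n) (Fin n) ℝ) - a • Y) (a ^ 2 / (4 * n)) x)) := by
    intro g hg
    refine StronglyMeasurable.measurable (StronglyMeasurable.integral_prod_right
      (f := fun (Y : Matrix (Fin n) (Fin n) ℝ) x =>
        g x * Real.exp (-UU (β • (1 : Matrix (Fin n) (Fin n) ℝ) - a • Y) (a ^ 2 / (4 * n)) x)) ?_)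
    refine Continuous.stronglyMeasurable ?_
    unfold UU Function.uncurry
    fun_prop
  have h1 := key f hf
  have h2 := key (fun _ => 1) continuous_const
  simp only [one_mul] at h2
  exact h1.div h2

lemma meas_YY (n : ℕ) (ℓ : ℝ) : Measurable (β := Matrix (Fin n) (Fin n) ℝ) (fun ω : Om n => YY ℓ ⟨n, ω⟩) := by
  refine measurable_matrix fun i j => ?_
  unfold YY WW
  simp only [Matrix.add_apply, Matrix.smul_apply, vecMulVec_apply, smul_eq_mul]
  have : Measurable fun a : Om n => a.2 i j := (measurable_entry (n := n) i j).comp measurable_snd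
  fun_prop

lemma meas_av {n : ℕ} (a β ℓ : ℝ) {f : (Fin n → ℝ) → ℝ} (hf : Continuous f) :
    Measurable (fun ω : Om n => ∫ x, f x ∂gY n a β (YY ℓ ⟨n, ω⟩)) :=
  (meas_gY_int a β hf).comp (meas_YY n ℓ)

def SS (p : PP) : ℝ := (p.2.1 ⬝ᵥ p.2.1) / p.1
def ZB {n : ℕ} (Z : Matrix (Fin n) (Fin n) ℝ) : ℝ := (∑ i, ∑ j, Z i j ^ 2) / (n : ℝ)^2
def R2 (a β ℓ : ℝ) (p : PP) : ℝ := ∫ x, RR x ^ 2 ∂gY p.1 a β (YY ℓ p)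
def TT (p : PP) : ℝ := 1 + SS p ^ 4 + ZB p.2.2 ^ 4 +
  (p.1 : ℝ)^4 * (Uset (1 / √(p.1 : ℝ)) 3 1 (0 : Fin p.1 → ℝ))ᶜ.indicator (fun _ => (1:ℝ)) p.2.2

lemma SS_nonneg (p : PP) : 0 ≤ SS p := div_nonneg (dot_self_nonneg _) (by positivity)
lemma ZB_nonneg {n : ℕ} (Z : Matrix (Fin n) (Fin n) ℝ) : 0 ≤ ZB Z := by unfold ZB; positivity

lemma le_of_sq_le_sq' {x y : ℝ} (h : x^2 ≤ y^2) (hy : 0 ≤ y) : x ≤ y :=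
  (le_abs_self x).trans (abs_le_of_sq_le_sq h hy)

lemma quad_frob {n : ℕ} (Z : Matrix (Fin n) (Fin n) ℝ) (x : Fin n → ℝ) :
    (x ⬝ᵥ Z *ᵥ x)^2 ≤ (∑ i, ∑ j, Z i j ^ 2) * (x ⬝ᵥ x)^2 := by
  have h1 := cs_dot x (Z *ᵥ x)
  have h2 : (Z *ᵥ x) ⬝ᵥ (Z *ᵥ x) ≤ (∑ i, ∑ j, Z i j ^ 2) * (x ⬝ᵥ x) := by
    rw [Finset.sum_mul, dotProduct]
    refine Finset.sum_le_sum fun i _ => ?_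
    have := cs_dot (Z i) x
    have e : (Z *ᵥ x) i = Z i ⬝ᵥ x := rfl
    rw [e, ← sq]
    refine this.trans (le_of_eq ?_)
    congr 1
    simp [dotProduct, sq]
  nlinarith [dot_self_nonneg x]

set_option maxHeartbeats 1600000 in
lemma R2_bound {a β ℓ : ℝ} (ha : 0 < a) (hβ : 0 ≤ β) (hℓ : 0 ≤ ℓ) {p : PP} (hn : 0 < p.1)
    (hs : p.2.2ᵀ = p.2.2) :
    a^2 * (R2 a β ℓ p * (1 + SS p ^ 2)) ≤ (100 + 10 * ℓ^2) * TT p := by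
  have hS := SS_nonneg p
  have hnr : (0:ℝ) < p.1 := by exact_mod_cast hn
  have hZ := ZB_nonneg p.2.2
  have hspike : ∀ x, ℓ / p.1 * (p.2.1 ⬝ᵥ x)^2 ≤ ℓ * SS p * (x ⬝ᵥ x) := by
    intro x
    have := cs_dot p.2.1 x
    have e : ℓ * SS p * (x ⬝ᵥ x) = ℓ / p.1 * ((p.2.1 ⬝ᵥ p.2.1) * (x ⬝ᵥ x)) := by
      unfold SS; field_simp
    rw [e]
    exact mul_le_mul_of_nonneg_left this (by positivity)
  have hℓS : 0 ≤ ℓ * SS p := by positivity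
  by_cases hb : p.2.2 ∈ Uset (1 / √(p.1 : ℝ)) 3 1 (0 : Fin p.1 → ℝ)
  · have h := apriori hn ha hβ (YY_symm hs ℓ) (m := 3 + ℓ * SS p) (by positivity) (by
      intro x
      have h1 := (hb x).1
      unfold qf at h1
      rw [YY_quad]
      have h2 := hspike x
      have h3 : x ⬝ᵥ WW p *ᵥ x = 1 / √(p.1 : ℝ) * (x ⬝ᵥ p.2.2 *ᵥ x) := by
        unfold WW
        rw [Matrix.smul_mulVec, dotProduct_smul, smul_eq_mul]
      rw [h3]
      linarith)
    change a^2 * R2 a β ℓ p ≤ _ at h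
    have hT : TT p = 1 + SS p ^ 4 + ZB p.2.2 ^ 4 := by
      unfold TT; rw [Set.indicator_of_notMem (by simpa using hb)]; ring
    rw [hT]
    have h2 : a^2 * R2 a β ℓ p ≤ 20 + 2 * ℓ^2 * SS p ^2 := by nlinarith [sq_nonneg (3 - ℓ * SS p)]
    have h3 : a^2 * (R2 a β ℓ p * (1 + SS p ^ 2)) ≤ (20 + 2 * ℓ^2 * SS p ^2) * (1 + SS p^2) := by
      rw [← mul_assoc]; exact mul_le_mul_of_nonneg_right h2 (by positivity)
    have h4 : 0 ≤ ZB p.2.2 ^ 4 := by positivity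
    have h5 : SS p ^ 2 ≤ 1 + SS p ^ 4 := by nlinarith [sq_nonneg (SS p ^2 - 1), sq_nonneg (SS p)]
    have h6 : 0 ≤ ℓ^2 := sq_nonneg _
    have h7 : 0 ≤ SS p ^ 4 := by positivity
    have h8 : 0 ≤ ℓ^2 * ZB p.2.2 ^ 4 := by positivity
    have h9 := mul_le_mul_of_nonneg_left h5 h6
    have h10 : 0 ≤ ℓ^2 * SS p ^ 4 := by positivity
    nlinarith
  · have hquad : ∀ x, x ⬝ᵥ WW p *ᵥ x ≤ √(p.1 * ZB p.2.2) * (x ⬝ᵥ x) := by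
      intro x
      have h1 := quad_frob (WW p) x
      have h2 : (∑ i, ∑ j, (WW p) i j ^ 2) = p.1 * ZB p.2.2 := by
        unfold WW ZB
        simp only [Matrix.smul_apply, smul_eq_mul, mul_pow, ← Finset.mul_sum]
        rw [div_pow, Real.sq_sqrt hnr.le]
        field_simp
      rw [h2] at h1
      have h0 := dot_self_nonneg x
      refine le_of_sq_le_sq' ?_ (by positivity)
      rw [mul_pow, Real.sq_sqrt (by positivity)]
      exact h1
    have h := apriori hn ha hβ (YY_symm hs ℓ) (m := √(p.1 * ZB p.2.2) + ℓ * SS p) (by positivity) (by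
      intro x
      rw [YY_quad]
      have h2 := hspike x
      have h1 := hquad x
      linarith)
    change a^2 * R2 a β ℓ p ≤ _ at h
    have hT : TT p = 1 + SS p ^ 4 + ZB p.2.2 ^ 4 + (p.1:ℝ)^4 := by
      unfold TT; rw [Set.indicator_of_mem (by simpa using hb)]; ring
    rw [hT]
    have hsq : √(p.1 * ZB p.2.2)^2 = p.1 * ZB p.2.2 := Real.sq_sqrt (by positivity)
    have h2 : a^2 * R2 a β ℓ p ≤ 2 + 2 * (p.1 * ZB p.2.2) + 2 * ℓ^2 * SS p ^2 := by
      nlinarith [sq_nonneg (√(p.1 * ZB p.2.2) - ℓ * SS p)]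
    have h3 : a^2 * (R2 a β ℓ p * (1 + SS p ^ 2)) ≤
        (2 + 2 * (p.1 * ZB p.2.2) + 2 * ℓ^2 * SS p ^2) * (1 + SS p^2) := by
      rw [← mul_assoc]; exact mul_le_mul_of_nonneg_right h2 (by positivity)
    have h4 : 0 ≤ ZB p.2.2 ^ 4 := by positivity
    have h5 : SS p ^ 2 ≤ 1 + SS p ^ 4 := by nlinarith [sq_nonneg (SS p ^2 - 1), sq_nonneg (SS p)]
    have h6 : 0 ≤ ℓ^2 := sq_nonneg _
    have h7 : 0 ≤ SS p ^ 4 := by positivity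
    have h8 : 0 ≤ ℓ^2 * ZB p.2.2 ^ 4 := by positivity
    have h9 := mul_le_mul_of_nonneg_left h5 h6
    have h10 : 0 ≤ ℓ^2 * SS p ^ 4 := by positivity
    have h11 : 0 ≤ ℓ^2 * (p.1:ℝ) ^ 4 := by positivity
    have h12 : 0 ≤ (p.1:ℝ) ^ 4 := by positivity
    have h13 : 2 * ((p.1 * ZB p.2.2) * (1 + SS p^2)) ≤ (p.1 * ZB p.2.2)^2 + (1 + SS p^2)^2 := by
      nlinarith [sq_nonneg ((p.1 * ZB p.2.2) - (1 + SS p^2))]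
    have h14 : 2 * (p.1 * ZB p.2.2)^2 ≤ (p.1:ℝ)^4 + ZB p.2.2 ^4 := by
      nlinarith [sq_nonneg ((p.1:ℝ)^2 - ZB p.2.2 ^2)]
    nlinarith

end

section

lemma gmom (v : NNReal) (k : ℕ) : Integrable (fun x : ℝ => x ^ k) (gaussianReal 0 v) := by
  by_cases hk : k = 0
  · subst hk; simp
  have h := (memLp_id_gaussianReal (μ := 0) (v := v) (k : NNReal)).integrable_norm_pow hk
  refine (integrable_norm_iff (by fun_prop)).1 ?_
  simpa using h

def K8 (v : NNReal) : ℝ := ∫ x, x^8 ∂gaussianReal 0 v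
lemma K8_nonneg (v) : 0 ≤ K8 v := integral_nonneg fun x => by positivity

lemma mean_pow {ι : Type*} [Fintype ι] (z : ι → ℝ) {N : ℝ} (hN : N = Fintype.card ι) (h0 : 0 < N) :
    ((∑ i, z i ^ 2) / N)^4 ≤ (∑ i, z i ^ 8) / N := by
  have := Real.pow_arith_mean_le_arith_mean_pow_of_even Finset.univ (fun _ => 1 / N)
    (fun i => z i ^2) (fun _ _ => by positivity) (by simp [← hN, h0.ne']) (n := 4) ⟨2, rfl⟩
  rw [← Finset.mul_sum, ← Finset.mul_sum] at this
  simp only [← pow_mul] at this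
  norm_num at this
  calc _ = (N⁻¹ * ∑ i, z i ^ 2)^4 := by rw [div_eq_inv_mul]
    _ ≤ _ := this
    _ = _ := by rw [div_eq_inv_mul]

lemma Smom (n : ℕ) (hn : 0 < n) (v : ℝ) :
    Integrable (fun s : Fin n → ℝ => ((s ⬝ᵥ s) / n)^4) (gaussPrior n v) ∧
    ∫ s, ((s ⬝ᵥ s) / n)^4 ∂(gaussPrior n v) ≤ K8 v.toNNReal := by
  have hnr : (0:ℝ) < n := by exact_mod_cast hn
  have h1 : ∀ i : Fin n, Integrable (fun s : Fin n → ℝ => s i ^ 8) (gaussPrior n v) := fun i =>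
    integrable_comp_eval (μ := fun _ : Fin n => gaussianReal 0 v.toNNReal) (f := fun x : ℝ => x^8) (gmom _ 8)
  have h2 : Integrable (fun s : Fin n → ℝ => (∑ i, s i ^ 8) / n) (gaussPrior n v) :=
    (integrable_finset_sum _ fun i _ => h1 i).div_const _
  have hb : ∀ s : Fin n → ℝ, ((s ⬝ᵥ s) / n)^4 ≤ (∑ i, s i ^ 8) / n := by
    intro s
    have := mean_pow s (N := n) (by simp) hnr
    simpa [dotProduct, sq] using this
  have h3 : Integrable (fun s : Fin n → ℝ => ((s ⬝ᵥ s) / n)^4) (gaussPrior n v) := by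
    refine h2.mono' (Continuous.aestronglyMeasurable (by fun_prop)) (Eventually.of_forall fun s => ?_)
    rw [Real.norm_of_nonneg (by positivity)]
    exact hb s
  refine ⟨h3, (integral_mono h3 h2 hb).trans (le_of_eq ?_)⟩
  rw [integral_div, integral_finset_sum _ fun i _ => h1 i]
  have : ∀ i : Fin n, ∫ s, s i ^ 8 ∂(gaussPrior n v) = K8 v.toNNReal := fun i =>
    integral_comp_eval (μ := fun _ : Fin n => gaussianReal 0 v.toNNReal) (f := fun x : ℝ => x^8)
      (gmom _ 8).aestronglyMeasurable
  simp only [this]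
  simp; field_simp

def NV (n : ℕ) (p : Fin n × Fin n) : NNReal := if p.1 = p.2 then 2 else 1
def symmMap (n : ℕ) (g : Fin n × Fin n → ℝ) : Matrix (Fin n) (Fin n) ℝ :=
  Matrix.of fun i j => if i ≤ j then g (i, j) else g (j, i)
lemma noise_eq (n : ℕ) : noiseMeasure n =
    (Measure.pi fun p => gaussianReal 0 (NV n p)).map (symmMap n) := rfl
lemma symmMap_meas (n : ℕ) : Measurable (symmMap n) := measurable_symmMap n

lemma Zent (n : ℕ) (i j : Fin n) (k : ℕ) : Integrable (fun Z => Z i j ^ k) (noiseMeasure n) := by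
  rw [noise_eq, integrable_map_measure
    ((measurable_entry i j).pow_const k).aestronglyMeasurable (symmMap_meas n).aemeasurable]
  unfold symmMap Function.comp
  by_cases h : i ≤ j
  · simp only [of_apply, h, if_true]
    exact integrable_comp_eval (μ := fun p => gaussianReal 0 (NV n p)) (i := (i,j)) (f := fun x : ℝ => x^k) (gmom _ k)
  · simp only [of_apply, h, if_false]
    exact integrable_comp_eval (μ := fun p => gaussianReal 0 (NV n p)) (i := (j,i)) (f := fun x : ℝ => x^k) (gmom _ k)

lemma Zent8 (n : ℕ) (i j : Fin n) : ∫ Z, Z i j ^ 8 ∂(noiseMeasure n) ≤ K8 1 + K8 2 := by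
  have hNV : ∀ p, K8 (NV n p) ≤ K8 1 + K8 2 := by
    intro p; unfold NV; split_ifs
    · linarith [K8_nonneg 1]
    · linarith [K8_nonneg 2]
  rw [noise_eq, integral_map (symmMap_meas n).aemeasurable
    ((measurable_entry i j).pow_const 8).aestronglyMeasurable]
  unfold symmMap
  by_cases h : i ≤ j
  · simp only [of_apply, h, if_true]
    exact (le_of_eq (integral_comp_eval (μ := fun p => gaussianReal 0 (NV n p)) (i := (i,j)) (f := fun x : ℝ => x^8) (gmom _ 8).aestronglyMeasurable)).trans (hNV _)
  · simp only [of_apply, h, if_false]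
    exact (le_of_eq (integral_comp_eval (μ := fun p => gaussianReal 0 (NV n p)) (i := (j,i)) (f := fun x : ℝ => x^8) (gmom _ 8).aestronglyMeasurable)).trans (hNV _)

lemma ZB_meas (n : ℕ) : Measurable (fun Z : Matrix (Fin n) (Fin n) ℝ => ZB Z) := by
  unfold ZB
  refine Measurable.div_const ?_ _
  refine Finset.measurable_sum _ fun i _ => Finset.measurable_sum _ fun j _ => ?_
  exact (measurable_entry i j).pow_const 2

lemma Zmom (n : ℕ) (hn : 0 < n) :
    Integrable (fun Z : Matrix (Fin n) (Fin n) ℝ => ZB Z ^ 4) (noiseMeasure n) ∧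
    ∫ Z, ZB Z ^4 ∂(noiseMeasure n) ≤ K8 1 + K8 2 := by
  have hnr : (0:ℝ) < n := by exact_mod_cast hn
  have h1 : ∀ q : Fin n × Fin n, Integrable (fun Z => Z q.1 q.2 ^ 8) (noiseMeasure n) :=
    fun q => Zent n q.1 q.2 8
  have h2 : Integrable (fun Z : Matrix (Fin n) (Fin n) ℝ =>
      (∑ q : Fin n × Fin n, Z q.1 q.2 ^ 8) / (n:ℝ)^2) (noiseMeasure n) :=
    (integrable_finset_sum _ fun i _ => h1 i).div_const _
  have hb : ∀ Z : Matrix (Fin n) (Fin n) ℝ, ZB Z ^4 ≤ (∑ q : Fin n × Fin n, Z q.1 q.2 ^ 8) / (n:ℝ)^2 := by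
    intro Z
    have := mean_pow (fun q : Fin n × Fin n => Z q.1 q.2) (N := (n:ℝ)^2) (by simp [sq]) (by positivity)
    refine le_trans (le_of_eq ?_) this
    unfold ZB
    rw [Fintype.sum_prod_type]
  have h3 : Integrable (fun Z : Matrix (Fin n) (Fin n) ℝ => ZB Z ^ 4) (noiseMeasure n) := by
    refine h2.mono' ((ZB_meas n).pow_const 4).aestronglyMeasurable (Eventually.of_forall fun s => ?_)
    rw [Real.norm_of_nonneg (by positivity)]
    exact hb s
  refine ⟨h3, (integral_mono h3 h2 hb).trans ?_⟩
  rw [integral_div, integral_finset_sum _ fun i _ => h1 i, div_le_iff₀ (by positivity)]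
  refine (Finset.sum_le_sum fun q _ => Zent8 n q.1 q.2).trans ?_
  simp
  nlinarith

lemma ind_int {n : ℕ} {ν : Measure (Matrix (Fin n) (Fin n) ℝ)} [IsProbabilityMeasure ν] (r : ℝ) :
    Integrable ((Uset r 3 1 (0 : Fin n → ℝ))ᶜ.indicator (fun _ => (1:ℝ))) ν :=
  (integrable_const 1).indicator (Uset_meas _ _ _ _).compl

lemma TT_slice (n : ℕ) (hn : 0 < n) (s : Fin n → ℝ) :
    Integrable (fun Z => TT ⟨n, (s, Z)⟩) (noiseMeasure n) := by
  exact (((integrable_const _).add (integrable_const (((s ⬝ᵥ s) / (n:ℝ))^4))).add (Zmom n hn).1).add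
    ((ind_int (1 / √(n:ℝ))).const_mul ((n:ℝ)^4))

lemma TT_int (sig : ℝ) : ∃ C, (∀ n, 0 < n → Integrable (fun ω => TT ⟨n, ω⟩) (mu sig n)) ∧
    ∀ᶠ n in atTop, ∫ ω, TT ⟨n, ω⟩ ∂(mu sig n) ≤ C := by
  obtain ⟨c, hc0, hc1, hU⟩ := U_prob 3 1 one_pos (by norm_num)
  have h_intg1 : ∀ n, 0 < n → Integrable (fun ω : Om n => SS ⟨n, ω⟩ ^ 4) (mu sig n) := fun n hn =>
    (Smom n hn (sig^2)).1.comp_fst (ν := noiseMeasure n)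
  have h_intg2 : ∀ n, 0 < n → Integrable (fun ω : Om n => ZB ω.2 ^ 4) (mu sig n) := fun n hn =>
    (Zmom n hn).1.comp_snd (μ := gaussPrior n (sig^2))
  have h_intg3 : ∀ n : ℕ, Integrable (fun ω : Om n =>
      (Uset (1 / √(n : ℝ)) 3 1 (0 : Fin n → ℝ))ᶜ.indicator (fun _ => (1:ℝ)) ω.2) (mu sig n) := fun n =>
    (ind_int (ν := noiseMeasure n) _).comp_snd (μ := gaussPrior n (sig^2))
  have h_intg : ∀ n, 0 < n → Integrable (fun ω => TT ⟨n, ω⟩) (mu sig n) := fun n hn =>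
    (((integrable_const _).add (h_intg1 n hn)).add (h_intg2 n hn)).add ((h_intg3 n).const_mul ((n:ℝ)^4))
  have hlim : Tendsto (fun n : ℕ => (n:ℝ)^4 * (n * (3 * c^n))) atTop (nhds 0) := by
    have := (tendsto_pow_const_mul_const_pow_of_lt_one 5 hc0.le hc1).const_mul 3
    rw [mul_zero] at this
    refine this.congr fun n => ?_
    ring
  refine ⟨1 + K8 (sig^2).toNNReal + (K8 1 + K8 2) + 1, h_intg, ?_⟩
  filter_upwards [hlim.eventually_le_const one_pos, eventually_gt_atTop 0] with n h1 hn
  have e : ∫ ω, TT ⟨n, ω⟩ ∂(mu sig n) = 1 + ∫ ω, SS ⟨n, ω⟩ ^ 4 ∂(mu sig n) +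
      ∫ ω, ZB ω.2 ^ 4 ∂(mu sig n) + (n:ℝ)^4 * ∫ ω, (Uset (1 / √(n : ℝ)) 3 1 (0 : Fin n → ℝ))ᶜ.indicator (fun _ => (1:ℝ)) ω.2 ∂(mu sig n) := by
    have i1 : Integrable (fun ω : Om n => 1 + SS ⟨n, ω⟩ ^ 4) (mu sig n) :=
      (integrable_const _).add (h_intg1 n hn)
    have i2 : Integrable (fun ω : Om n => 1 + SS ⟨n, ω⟩ ^ 4 + ZB ω.2 ^ 4) (mu sig n) :=
      i1.add (h_intg2 n hn)
    unfold TT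
    show ∫ ω : Om n, (1 + SS ⟨n, ω⟩ ^ 4 + ZB ω.2 ^ 4 + (n:ℝ)^4 * (Uset (1 / √(n : ℝ)) 3 1 (0 : Fin n → ℝ))ᶜ.indicator (fun _ => (1:ℝ)) ω.2) ∂(mu sig n) = _
    rw [integral_add i2 ((h_intg3 n).const_mul _), integral_add i1 (h_intg2 n hn),
      integral_add (integrable_const _) (h_intg1 n hn), integral_const_mul]
    simp
  rw [e]
  have e1 : ∫ ω, SS ⟨n, ω⟩ ^ 4 ∂(mu sig n) ≤ K8 (sig^2).toNNReal := by
    refine le_trans (le_of_eq ?_) (Smom n hn (sig^2)).2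
    have := integral_fun_fst (μ := gaussPrior n (sig^2)) (ν := noiseMeasure n) (fun s : Fin n → ℝ => ((s ⬝ᵥ s) / n)^4)
    rw [probReal_univ, one_smul] at this
    exact this
  have e2 : ∫ ω, ZB ω.2 ^ 4 ∂(mu sig n) ≤ K8 1 + K8 2 := by
    refine le_trans (le_of_eq ?_) (Zmom n hn).2
    have := integral_fun_snd (μ := gaussPrior n (sig^2)) (ν := noiseMeasure n) (fun Z => ZB Z ^ 4)
    rw [probReal_univ, one_smul] at this
    exact this
  have e3 : ∫ ω, (Uset (1 / √(n : ℝ)) 3 1 (0 : Fin n → ℝ))ᶜ.indicator (fun _ => (1:ℝ)) ω.2 ∂(mu sig n) ≤ n * (3 * c^n) := by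
    refine le_trans (le_of_eq ?_) (hU n hn n le_rfl 0)
    have := integral_fun_snd (μ := gaussPrior n (sig^2)) (ν := noiseMeasure n) 
      ((Uset (1 / √(n : ℝ)) 3 1 (0 : Fin n → ℝ))ᶜ.indicator (fun _ => (1:ℝ)))
    rw [probReal_univ, one_smul, integral_indicator (Uset_meas _ _ _ _).compl] at this
    simp only [integral_const, smul_eq_mul, mul_one, measureReal_restrict_apply_univ] at this
    exact this
  have e4 := mul_le_mul_of_nonneg_left e3 (show (0:ℝ) ≤ (n:ℝ)^4 by positivity)
  linarith

/-- Convergence in probability plus an `L²` bound gives convergence of means. -/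
lemma PF_lim_integral {sig c C : ℝ} (X : PP → ℝ) (hX : Tendsto X (PF sig) (nhds c))
    (hm : ∀ n, Measurable (fun ω : Om n => X ⟨n, ω⟩))
    (hi : ∀ᶠ n in atTop, Integrable (fun ω : Om n => X ⟨n, ω⟩ ^2) (mu sig n))
    (hC : ∀ᶠ n in atTop, ∫ ω : Om n, X ⟨n, ω⟩^2 ∂(mu sig n) ≤ C) :
    Tendsto (fun n => ∫ ω : Om n, X ⟨n, ω⟩ ∂(mu sig n)) atTop (nhds c) := by
  rw [Metric.tendsto_nhds]
  intro ε hε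
  have hC0 : 0 ≤ C := by
    obtain ⟨n, hn⟩ := hC.exists
    exact (integral_nonneg fun ω => sq_nonneg _).trans hn
  set D := 2 * C + 2 * c^2 + 1 with hD
  have hDpos : 0 < D := by positivity
  set η := ε / (4 * D) with hη
  have hηpos : 0 < η := by positivity
  have hP := (PF_iff sig _).1 (Metric.tendsto_nhds.1 hX (ε/4) (by positivity))
  have hP2 := hP.eventually_lt_const (show (0:ℝ) < η * ε / 4 by positivity)
  filter_upwards [hi, hC, hP2] with n hi hC hP
  set A : Set (Om n) := {ω | ¬ dist (X ⟨n, ω⟩) c < ε/4} with hA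
  have hAm : MeasurableSet A := (measurableSet_lt ((hm n).dist measurable_const) measurable_const).compl
  have hXi : Integrable (fun ω : Om n => X ⟨n, ω⟩) (mu sig n) := by
    refine (hi.add (integrable_const 1)).mono' (hm n).aestronglyMeasurable (Eventually.of_forall fun ω => ?_)
    simp only [Pi.add_apply, Real.norm_eq_abs]
    rw [← sq_abs]
    nlinarith [sq_nonneg (|X ⟨n, ω⟩| - 1), abs_nonneg (X ⟨n, ω⟩)]
  have hb : Integrable (fun ω : Om n => (ε/4 + η * (X ⟨n, ω⟩^2 + c^2)) + 1/(2*η) * A.indicator (fun _ => (1:ℝ)) ω) (mu sig n) :=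
    ((integrable_const _).add ((hi.add (integrable_const _)).const_mul _)).add
      (((integrable_const _).indicator hAm).const_mul _)
  rw [Real.dist_eq]
  have e1 : (∫ ω : Om n, X ⟨n, ω⟩ ∂(mu sig n)) - c = ∫ ω : Om n, (X ⟨n, ω⟩ - c) ∂(mu sig n) := by
    rw [integral_sub hXi (integrable_const _)]; simp
  rw [e1]
  calc _ ≤ ∫ ω : Om n, |X ⟨n, ω⟩ - c| ∂(mu sig n) := abs_integral_le_integral_abs
    _ ≤ ∫ ω : Om n, ((ε/4 + η * (X ⟨n, ω⟩^2 + c^2)) + 1/(2*η) * A.indicator (fun _ => (1:ℝ)) ω) ∂(mu sig n) := by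
        refine integral_mono (hXi.sub (integrable_const _)).abs hb fun ω => ?_
        simp only
        by_cases hω : ω ∈ A
        · rw [Set.indicator_of_mem hω]
          set y := |X ⟨n, ω⟩ - c|
          have hy : y^2 ≤ 2 * (X ⟨n, ω⟩^2 + c^2) := by
            rw [sq_abs]; nlinarith [sq_nonneg (X ⟨n, ω⟩ + c)]
          have : y ≤ η / 2 * y^2 + 1/(2*η) := by
            have : η / 2 * y^2 + 1/(2*η) - y = (η * y - 1)^2 / (2*η) := by field_simp; ring
            have h2 : 0 ≤ (η * y - 1)^2 / (2*η) := by positivity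
            linarith
          have := mul_le_mul_of_nonneg_left hy (show 0 ≤ η/2 by positivity)
          linarith
        · rw [Set.indicator_of_notMem hω]
          simp only [hA, Set.mem_setOf_eq, not_not, Real.dist_eq] at hω
          have : 0 ≤ η * (X ⟨n, ω⟩^2 + c^2) := by positivity
          linarith
    _ = ε/4 + η * (∫ ω : Om n, X ⟨n, ω⟩^2 ∂(mu sig n) + c^2) + 1/(2*η) * (mu sig n).real A := by
        have i1 : Integrable (fun ω : Om n => η * (X ⟨n, ω⟩^2 + c^2)) (mu sig n) :=
          (hi.add (integrable_const _)).const_mul _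
        have i2 : Integrable (fun ω : Om n => ε/4 + η * (X ⟨n, ω⟩^2 + c^2)) (mu sig n) :=
          (integrable_const _).add i1
        have i3 : Integrable (fun ω : Om n => 1/(2*η) * A.indicator (fun _ => (1:ℝ)) ω) (mu sig n) :=
          ((integrable_const _).indicator hAm).const_mul _
        rw [integral_add i2 i3, integral_add (integrable_const _) i1,
          integral_const_mul, integral_const_mul, integral_add hi (integrable_const _),
          integral_indicator hAm]
        simp
    _ < ε := by
        have h1 : η * (∫ ω : Om n, X ⟨n, ω⟩^2 ∂(mu sig n) + c^2) ≤ η * D :=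
          mul_le_mul_of_nonneg_left (by nlinarith [sq_nonneg c]) hηpos.le
        have h2 : η * D = ε/4 := by rw [hη]; field_simp
        have h3 : 1/(2*η) * (mu sig n).real A < 1/(2*η) * (η * ε / 4) :=
          mul_lt_mul_of_pos_left hP (by positivity)
        have h4 : 1/(2*η) * (η * ε / 4) = ε/8 := by field_simp; norm_num
        linarith

end

section

lemma gm_pert {ι : Type*} [Fintype ι] {V X : (ι → ℝ) → ℝ} (h : ∀ τ : ℝ, Coer (fun x => V x - τ * X x))
    (hX : PG X) :
    HasDerivAt (fun τ => ∫ x, X x ∂gm (fun x => V x - τ * X x))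
      (∫ x, X x ^ 2 ∂gm V - (∫ x, X x ∂gm V)^2) 0 := by
  have hV : Coer V := by simpa using h 0
  have hvol : ∀ W : (ι → ℝ) → ℝ, Coer W → Integrable (fun x => Real.exp (-W x)) volume := by
    intro W hW
    simpa using (gm_integrable_iff hW (fun _ => 1)).1 ((PG.const 1).int hW)
  have hexp : ∀ τ : ℝ, Integrable (fun x => Real.exp (τ * X x)) (gm V) := by
    intro τ
    rw [gm_integrable_iff hV]
    refine (hvol _ (h τ)).congr (Eventually.of_forall fun x => ?_)
    simp only
    rw [← Real.exp_add]; congr 1; ring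
  have hset : integrableExpSet X (gm V) = Set.univ := by
    ext τ; simp [integrableExpSet, hexp τ]
  have h_intg : ∀ τ, τ ∈ interior (integrableExpSet X (gm V)) := by intro τ; simp [hset]
  have e : ∀ τ : ℝ, ∫ x, X x ∂gm (fun x => V x - τ * X x) = deriv (cgf X (gm V)) τ := by
    intro τ
    rw [← integral_tilted_mul_self (h_intg τ)]
    congr 1
    unfold gm
    rw [tilted_tilted (hvol V hV)]
    congr 1
    funext x
    simp only [Pi.add_apply]; ring
  have e' : (fun τ => ∫ x, X x ∂gm (fun x => V x - τ * X x)) = deriv (cgf X (gm V)) := funext e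
  rw [e']
  have hd : DifferentiableAt ℝ (deriv (cgf X (gm V))) 0 :=
    (analyticAt_cgf (h_intg 0)).deriv.differentiableAt
  refine hd.hasDerivAt.congr_deriv ?_
  have h1 := variance_tilted_mul (h_intg 0)
  rw [iteratedDeriv_succ, iteratedDeriv_one] at h1
  rw [← h1]
  have h0 : (gm V).tilted (fun ω => 0 * X ω) = gm V := by
    have : IsProbabilityMeasure (gm V) := by
      unfold gm; exact isProbabilityMeasure_tilted (hvol V hV)
    simp
  have : IsProbabilityMeasure (gm V) := by
      unfold gm; exact isProbabilityMeasure_tilted (hvol V hV)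
  rw [h0, variance_eq_sub]
  · simp
  · rw [memLp_two_iff_integrable_sq hX.1.aestronglyMeasurable]
    exact (hX.pow 2).int hV

lemma GV_deriv {ι : Type*} [Fintype ι] [DecidableEq ι] (v : ι → NNReal) (p : ι) (x : ι → ℝ) :
    HasLineDerivAt ℝ (GV v) (x p / v p) x (Pi.single p 1) := by
  have h : ∀ i, HasDerivAt (fun t : ℝ => (x + t • (Pi.single p 1 : ι → ℝ)) i ^ 2 / (2 * v i))
      (if i = p then x p / v p else 0) 0 := by
    intro i
    have := lineDeriv_coord i p x
    unfold HasLineDerivAt at this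
    have h2 := (this.pow 2).div_const (2 * (v i : ℝ))
    refine h2.congr_deriv ?_
    by_cases hi : i = p
    · subst hi
      simp
      by_cases h0 : (v i : ℝ) = 0
      · simp [h0]
      · field_simp
    · simp [hi]
  unfold HasLineDerivAt GV
  have := HasDerivAt.fun_sum (u := Finset.univ) fun i _ => h i
  simpa using this

def cij {n : ℕ} (i j : Fin n) : ℝ := if i = j then 1/2 else 1

lemma symm_pert {n : ℕ} (g : Fin n × Fin n → ℝ) {i j : Fin n} (hij : i ≤ j) (t : ℝ) (x : Fin n → ℝ) :
    x ⬝ᵥ (symmMap n (g + t • Pi.single (i,j) 1)) *ᵥ x = x ⬝ᵥ (symmMap n g) *ᵥ x + 2 * (t * cij i j) * (x i * x j) := by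
  have h1 : symmMap n (g + t • Pi.single (i,j) 1) = symmMap n g +
      (t * cij i j) • (vecMulVec (Pi.single i 1) (Pi.single j 1) + vecMulVec (Pi.single j 1) (Pi.single i 1)) := by
    ext k l
    simp only [symmMap, of_apply, Matrix.add_apply, Matrix.smul_apply, vecMulVec_apply, smul_eq_mul,
      Pi.add_apply, Pi.smul_apply, Pi.single_apply, Prod.mk.injEq, cij]
    by_cases hkl : k ≤ l
    · simp only [hkl, if_true]
      by_cases h1 : k = i <;> by_cases h2 : l = j <;> by_cases h3 : i = j <;> by_cases h4 : k = j <;>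
        by_cases h5 : l = i <;> simp_all <;> first | ring1 | (exfalso; omega)
    · simp only [hkl, if_false]
      by_cases h1 : k = i <;> by_cases h2 : l = j <;> by_cases h3 : i = j <;> by_cases h4 : k = j <;>
        by_cases h5 : l = i <;> simp_all <;> first | ring1 | (exfalso; omega)
  rw [h1, Matrix.add_mulVec, dotProduct_add, Matrix.smul_mulVec, dotProduct_smul, Matrix.add_mulVec,
    vecMulVec_mulVec, vecMulVec_mulVec, dotProduct_add]
  simp [dotProduct_smul]
  ring

end

section

/-- Posterior correlation and second moment of `x_i x_j`. -/
def cor (a β ℓ : ℝ) {n : ℕ} (i j : Fin n) (ω : Om n) : ℝ := ∫ x, x i * x j ∂gY n a β (YY ℓ ⟨n, ω⟩)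
def cor2 (a β ℓ : ℝ) {n : ℕ} (i j : Fin n) (ω : Om n) : ℝ := ∫ x, (x i * x j)^2 ∂gY n a β (YY ℓ ⟨n, ω⟩)

lemma cor_meas (a β ℓ : ℝ) {n : ℕ} (i j : Fin n) : Measurable (cor a β ℓ i j) :=
  meas_av a β ℓ (by fun_prop)
lemma cor2_meas (a β ℓ : ℝ) {n : ℕ} (i j : Fin n) : Measurable (cor2 a β ℓ i j) :=
  meas_av a β ℓ (by fun_prop)

lemma PG_xx {n : ℕ} (i j : Fin n) : PG (fun x : Fin n → ℝ => x i * x j) := (PG.coord i).mul (PG.coord j)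

lemma cor_sq_le {a β ℓ : ℝ} (ha : 0 < a) {n : ℕ} (hn : 0 < n) (i j : Fin n) (ω : Om n) :
    cor a β ℓ i j ω ^ 2 ≤ cor2 a β ℓ i j ω := sq_av_le hn ha (PG_xx i j)

lemma cor2_sum {a β ℓ : ℝ} (ha : 0 < a) {n : ℕ} (hn : 0 < n) (ω : Om n) :
    ∑ i, ∑ j, cor2 a β ℓ i j ω = (n:ℝ)^2 * R2 a β ℓ ⟨n, ω⟩ := by
  have hnr : (n:ℝ) ≠ 0 := by exact_mod_cast hn.ne'
  unfold cor2 R2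
  rw [← integral_const_mul]
  have h : ∀ i j : Fin n, Integrable (fun x => (x i * x j)^2) (gY n a β (YY ℓ ⟨n, ω⟩)) := fun i j =>
    ((PG_xx i j).pow 2).intY hn ha β _
  simp only
  rw [Finset.sum_congr rfl fun i _ => (integral_finset_sum (s := Finset.univ) (f := fun (j : Fin n) (x : Fin n → ℝ) => (x i * x j)^2) fun j _ => h i j).symm,
    ← integral_finset_sum _ fun i _ => integrable_finset_sum _ fun j _ => h i j]
  congr 1
  funext x
  have : (n:ℝ)^2 * RR x ^2 = (x ⬝ᵥ x)^2 := by unfold RR; field_simp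
  rw [this, sq, dotProduct, Finset.sum_mul_sum]
  refine Finset.sum_congr rfl fun i _ => Finset.sum_congr rfl fun j _ => by ring

lemma cor2_nonneg {a β ℓ : ℝ} {n : ℕ} (i j : Fin n) (ω : Om n) : 0 ≤ cor2 a β ℓ i j ω :=
  integral_nonneg fun x => sq_nonneg _

lemma R2_nonneg {a β ℓ : ℝ} (p : PP) : 0 ≤ R2 a β ℓ p := integral_nonneg fun x => sq_nonneg _

lemma cor2_le {a β ℓ : ℝ} (ha : 0 < a) {n : ℕ} (hn : 0 < n) (i j : Fin n) (ω : Om n) :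
    cor2 a β ℓ i j ω ≤ (n:ℝ)^2 * R2 a β ℓ ⟨n, ω⟩ := by
  rw [← cor2_sum ha hn]
  refine le_trans ?_ (Finset.single_le_sum (f := fun i => ∑ j, cor2 a β ℓ i j ω)
    (fun i _ => Finset.sum_nonneg fun j _ => cor2_nonneg i j ω) (Finset.mem_univ i))
  exact (Finset.single_le_sum (f := fun j => cor2 a β ℓ i j ω)
    (fun j _ => cor2_nonneg i j ω) (Finset.mem_univ j))

section
variable {a β ℓ : ℝ} (ha : 0 < a) (hβ : 0 ≤ β) (hℓ : 0 ≤ ℓ)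
include ha hβ hℓ

lemma R2_le_TT {p : PP} (hn : 0 < p.1) (hs : p.2.2ᵀ = p.2.2) :
    R2 a β ℓ p * (1 + SS p ^2) ≤ ((100 + 10 * ℓ^2)/a^2) * TT p := by
  have := R2_bound ha hβ hℓ hn hs
  rw [div_mul_eq_mul_div, le_div_iff₀ (by positivity)]
  linarith

lemma R2_le_TT' {p : PP} (hn : 0 < p.1) (hs : p.2.2ᵀ = p.2.2) :
    R2 a β ℓ p ≤ ((100 + 10 * ℓ^2)/a^2) * TT p := by
  have := R2_le_TT ha hβ hℓ hn hs
  nlinarith [mul_nonneg (R2_nonneg (a := a) (β := β) (ℓ := ℓ) p) (sq_nonneg (SS p))]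

lemma slice_int {n : ℕ} (hn : 0 < n) (s : Fin n → ℝ) {f : Om n → ℝ} (hf : Measurable f) (C : ℝ) (hC : 0 ≤ C)
    (hb : ∀ ω, |f ω| ≤ C * R2 a β ℓ ⟨n, ω⟩) : Integrable (fun Z => f (s, Z)) (noiseMeasure n) := by
  refine ((TT_slice n hn s).const_mul (C * ((100 + 10 * ℓ^2)/a^2))).mono'
    (hf.comp measurable_prodMk_left).aestronglyMeasurable ?_
  filter_upwards [noise_ae_symm n] with Z hZ
  refine (hb (s, Z)).trans ?_
  rw [mul_assoc]
  exact mul_le_mul_of_nonneg_left (R2_le_TT' ha hβ hℓ (p := ⟨n, (s, Z)⟩) hn hZ) hC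

lemma full_int (sig : ℝ) {n : ℕ} (hn : 0 < n) {f : Om n → ℝ} (hf : Measurable f) (C : ℝ) (hC : 0 ≤ C)
    (hb : ∀ ω, |f ω| ≤ C * (R2 a β ℓ ⟨n, ω⟩ * (1 + SS ⟨n, ω⟩ ^2))) : Integrable f (mu sig n) := by
  obtain ⟨C', h1, -⟩ := TT_int sig
  refine ((h1 n hn).const_mul (C * ((100 + 10 * ℓ^2)/a^2))).mono' hf.aestronglyMeasurable ?_
  have : ∀ᵐ ω ∂(mu sig n), ω.2ᵀ = ω.2 := by
    unfold mu
    exact Measure.quasiMeasurePreserving_snd.ae (noise_ae_symm n)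
  filter_upwards [this] with ω hZ
  refine (hb ω).trans ?_
  rw [mul_assoc]
  exact mul_le_mul_of_nonneg_left (R2_le_TT ha hβ hℓ (p := ⟨n, ω⟩) hn hZ) hC

lemma cor2_slice {n : ℕ} (hn : 0 < n) (s : Fin n → ℝ) (i j : Fin n) :
    Integrable (fun Z => cor2 a β ℓ i j (s, Z)) (noiseMeasure n) := by
  refine slice_int ha hβ hℓ hn s (cor2_meas a β ℓ i j) ((n:ℝ)^2) (by positivity) fun ω => ?_
  rw [abs_of_nonneg (cor2_nonneg i j ω)]
  exact cor2_le ha hn i j ω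

lemma corsq_slice {n : ℕ} (hn : 0 < n) (s : Fin n → ℝ) (i j : Fin n) :
    Integrable (fun Z => cor a β ℓ i j (s, Z)^2) (noiseMeasure n) := by
  refine slice_int ha hβ hℓ hn s ((cor_meas a β ℓ i j).pow_const 2) ((n:ℝ)^2) (by positivity) fun ω => ?_
  rw [abs_of_nonneg (sq_nonneg _)]
  exact (cor_sq_le ha hn i j ω).trans (cor2_le ha hn i j ω)

lemma cor_slice {n : ℕ} (hn : 0 < n) (s : Fin n → ℝ) (i j : Fin n) :
    Integrable (fun Z => cor a β ℓ i j (s, Z)) (noiseMeasure n) := by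
  refine ((integrable_const 1).add (corsq_slice ha hβ hℓ hn s i j)).mono'
    ((cor_meas a β ℓ i j).comp measurable_prodMk_left).aestronglyMeasurable (Eventually.of_forall fun Z => ?_)
  simp only [Pi.add_apply, Real.norm_eq_abs]
  rw [← sq_abs]
  nlinarith [sq_nonneg (|cor a β ℓ i j (s, Z)| - 1), abs_nonneg (cor a β ℓ i j (s, Z))]

lemma zcor_slice {n : ℕ} (hn : 0 < n) (s : Fin n → ℝ) (i j : Fin n) :
    Integrable (fun Z => Z i j * cor a β ℓ i j (s, Z)) (noiseMeasure n) := by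
  refine ((Zent n i j 2).add (corsq_slice ha hβ hℓ hn s i j)).mono'
    ((measurable_entry i j).mul ((cor_meas a β ℓ i j).comp measurable_prodMk_left)).aestronglyMeasurable
    (Eventually.of_forall fun Z => ?_)
  simp only [Pi.add_apply, Real.norm_eq_abs, abs_mul]
  rw [← sq_abs, ← sq_abs (cor a β ℓ i j (s, Z))]
  nlinarith [sq_nonneg (|Z i j| - |cor a β ℓ i j (s, Z)|), sq_nonneg (|Z i j|), sq_nonneg (|cor a β ℓ i j (s, Z)|)]

omit hβ hℓ in
lemma cor_deriv {n : ℕ} (hn : 0 < n) (s : Fin n → ℝ) {i j : Fin n} (hij : i ≤ j) (g : Fin n × Fin n → ℝ) :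
    HasLineDerivAt ℝ (fun g => cor a β ℓ i j (s, symmMap n g))
      (a / √n * cij i j * (cor2 a β ℓ i j (s, symmMap n g) - cor a β ℓ i j (s, symmMap n g)^2)) g (Pi.single (i,j) 1) := by
  set V : (Fin n → ℝ) → ℝ := UU (β • 1 - a • YY ℓ ⟨n, (s, symmMap n g)⟩) (a^2/(4*n)) with hV
  have hUU : ∀ t : ℝ, UU (β • 1 - a • YY ℓ ⟨n, (s, symmMap n (g + t • Pi.single (i,j) 1))⟩) (a^2/(4*n)) =
      fun x => V x - (a / √n * cij i j * t) * (x i * x j) := by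
    intro t
    funext x
    simp only [hV, UU]
    have hW : ∀ g : Fin n × Fin n → ℝ, x ⬝ᵥ (WW ⟨n, (s, symmMap n g)⟩ *ᵥ x) =
        1 / √(n:ℝ) * (x ⬝ᵥ (symmMap n g *ᵥ x)) := by
      intro g
      unfold WW
      rw [Matrix.smul_mulVec, dotProduct_smul, smul_eq_mul]
    rw [Matrix.sub_mulVec, Matrix.sub_mulVec, Matrix.smul_mulVec, Matrix.smul_mulVec, Matrix.smul_mulVec,
      dotProduct_sub, dotProduct_sub, dotProduct_smul a, dotProduct_smul a, YY_quad ℓ ⟨n, _⟩, YY_quad ℓ ⟨n, _⟩, hW, hW, symm_pert g hij]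
    simp only [smul_eq_mul]
    ring
  have hco : ∀ τ : ℝ, Coer (fun x : Fin n → ℝ => V x - τ * (x i * x j)) := by
    intro τ
    have : (fun x : Fin n → ℝ => V x - τ * (x i * x j)) =
        UU ((β • 1 - a • YY ℓ ⟨n, (s, symmMap n g)⟩) - (2 * τ) • vecMulVec (Pi.single i 1) (Pi.single j 1)) (a^2/(4*n)) := by
      funext x
      simp only [hV, UU]
      rw [Matrix.sub_mulVec _ ((2 * τ) • vecMulVec (Pi.single i 1) (Pi.single j 1)), Matrix.smul_mulVec (2*τ), dotProduct_sub, dotProduct_smul (2*τ),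
        vecMulVec_mulVec]
      simp [dotProduct_smul]
      ring
    rw [this]
    exact UU_coer_quartic _ _ (by have : (0:ℝ) < n := by exact_mod_cast hn
                                  positivity)
  have hd := gm_pert hco (PG_xx i j)
  have hg : ∀ t : ℝ, cor a β ℓ i j (s, symmMap n (g + t • Pi.single (i,j) 1)) =
      ∫ x, x i * x j ∂gm (fun x => V x - (a / √n * cij i j * t) * (x i * x j)) := by
    intro t
    unfold cor gY
    rw [hUU t]
  unfold HasLineDerivAt
  simp only [hg]
  have hl : HasDerivAt (fun t : ℝ => a / √n * cij i j * t) (a / √n * cij i j) 0 := by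
    simpa using (hasDerivAt_id (0:ℝ)).const_mul (a / √n * cij i j)
  have hd' : HasDerivAt (fun τ : ℝ => ∫ x, x i * x j ∂gm (fun x => V x - τ * (x i * x j)))
    (∫ x, (x i * x j) ^ 2 ∂gm V - (∫ x, x i * x j ∂gm V)^2) (a / √n * cij i j * 0) := by
    rw [mul_zero]; exact hd
  have := hd'.comp (0:ℝ) hl
  refine this.congr_deriv ?_
  unfold cor cor2 gY
  ring

lemma zibp_le {n : ℕ} (hn : 0 < n) (s : Fin n → ℝ) {i j : Fin n} (hij : i ≤ j) :
    ∫ Z, Z i j * cor a β ℓ i j (s, Z) ∂(noiseMeasure n) =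
      a / √n * ∫ Z, (cor2 a β ℓ i j (s, Z) - cor a β ℓ i j (s, Z)^2) ∂(noiseMeasure n) := by
  have hNV : ∀ p, NV n p ≠ 0 := by intro p; unfold NV; split_ifs <;> norm_num
  have hm := symmMap_meas n
  have hpi := pi_gauss_gm (NV n) hNV
  have pull : ∀ f : Matrix (Fin n) (Fin n) ℝ → ℝ, Integrable f (noiseMeasure n) →
      Integrable (fun g => f (symmMap n g)) (gm (GV (NV n))) := by
    intro f hf
    rw [noise_eq, hpi] at hf
    exact hf.comp_measurable hm
  have i1 := pull _ (cor_slice ha hβ hℓ hn s i j)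
  have i2 := pull _ (((cor2_slice ha hβ hℓ hn s i j).sub (corsq_slice ha hβ hℓ hn s i j)).const_mul (a / √n * cij i j))
  have i3 := pull _ ((zcor_slice ha hβ hℓ hn s i j).mul_const (1 / (NV n (i,j) : ℝ)))
  have hent : ∀ g, symmMap n g i j = g (i,j) := by intro g; simp [symmMap, hij]
  have hI := ibp (GV_coer (NV n) hNV) (Pi.single (i,j) 1) i1 i2 (V' := fun g => g (i,j) / NV n (i,j)) ?_
    (fun g => cor_deriv ha hn s hij g) (fun g => GV_deriv (NV n) (i,j) g)
  · have t1 : ∫ Z, Z i j * cor a β ℓ i j (s, Z) ∂(noiseMeasure n) =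
        ∫ g, g (i,j) * cor a β ℓ i j (s, symmMap n g) ∂gm (GV (NV n)) := by
      rw [noise_eq, hpi, integral_map hm.aemeasurable]
      · simp only [hent]
      · exact ((measurable_entry i j).mul ((cor_meas a β ℓ i j).comp measurable_prodMk_left)).aestronglyMeasurable
    have t2 : ∫ Z, (cor2 a β ℓ i j (s, Z) - cor a β ℓ i j (s, Z)^2) ∂(noiseMeasure n) =
        ∫ g, (cor2 a β ℓ i j (s, symmMap n g) - cor a β ℓ i j (s, symmMap n g)^2) ∂gm (GV (NV n)) := by
      rw [noise_eq, hpi, integral_map hm.aemeasurable]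
      exact (((cor2_meas a β ℓ i j).comp measurable_prodMk_left).sub (((cor_meas a β ℓ i j).comp measurable_prodMk_left).pow_const 2)).aestronglyMeasurable
    rw [t1, t2]
    simp only [Pi.sub_apply] at hI
    rw [integral_const_mul] at hI
    have e3 : ∫ g, cor a β ℓ i j (s, symmMap n g) * (g (i,j) / NV n (i,j)) ∂gm (GV (NV n)) =
       (∫ g, g (i,j) * cor a β ℓ i j (s, symmMap n g) ∂gm (GV (NV n))) * (1 / (NV n (i,j):ℝ)) := by
      rw [← integral_mul_const]
      congr 1; funext g; ring
    rw [e3] at hI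
    have hc : cij i j = 1 / (NV n (i,j):ℝ) := by
      unfold cij NV; simp only; split_ifs <;> simp
    have hv : (NV n (i,j):ℝ) ≠ 0 := by exact_mod_cast hNV (i,j)
    rw [hc] at hI
    field_simp at hI ⊢
    linarith
  · refine i3.congr (Eventually.of_forall fun g => ?_)
    simp only [hent]; ring

omit ha hβ hℓ in
lemma cor_comm {n : ℕ} (i j : Fin n) (ω : Om n) : cor a β ℓ i j ω = cor a β ℓ j i ω := by
  unfold cor; simp only [mul_comm]
omit ha hβ hℓ in
lemma cor2_comm {n : ℕ} (i j : Fin n) (ω : Om n) : cor2 a β ℓ i j ω = cor2 a β ℓ j i ω := by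
  unfold cor2; congr 1; funext x; ring

lemma zibp {n : ℕ} (hn : 0 < n) (s : Fin n → ℝ) (i j : Fin n) :
    ∫ Z, Z i j * cor a β ℓ i j (s, Z) ∂(noiseMeasure n) =
      a / √n * ∫ Z, (cor2 a β ℓ i j (s, Z) - cor a β ℓ i j (s, Z)^2) ∂(noiseMeasure n) := by
  rcases le_total i j with h | h
  · exact zibp_le ha hβ hℓ hn s h
  · have := zibp_le ha hβ hℓ hn s h
    simp only [cor_comm j i, cor2_comm j i] at this
    rw [← this]
    refine integral_congr_ae ?_
    filter_upwards [noise_ae_symm n] with Z hZ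
    have : Z i j = Z j i := congrFun (congrFun hZ j) i
    rw [this]

end
end

section

def q2 (a β ℓ : ℝ) (p : PP) : ℝ := (∑ i, ∑ j, cor a β ℓ (n := p.1) i j p.2 ^2) / (p.1:ℝ)^2

lemma rav_cor {a β ℓ : ℝ} (ha : 0 < a) {n : ℕ} (hn : 0 < n) (ω : Om n) :
    rav n a β (YY ℓ ⟨n, ω⟩) = (∑ i, cor a β ℓ i i ω) / n := by
  rw [rav, ← Mat_trace_one hn ha, Matrix.trace, Finset.sum_div]
  refine Finset.sum_congr rfl fun i _ => ?_
  simp [Mat, cor]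

lemma m2_cor {a β ℓ : ℝ} {n : ℕ} (hn : 0 < n) (ω : Om n) :
    m2 a β ℓ ⟨n, ω⟩ = (∑ i, ∑ j, ω.1 i * ω.1 j * cor a β ℓ i j ω) / (n:ℝ)^2 := by
  have hnr : (n:ℝ) ≠ 0 := by exact_mod_cast hn.ne'
  unfold m2
  simp only [dotProduct, mulVec, Mat, of_apply, one_mul]
  rw [div_eq_div_iff hnr (by positivity), Finset.sum_mul, Finset.sum_mul]
  refine Finset.sum_congr rfl fun i _ => ?_
  rw [Finset.mul_sum, Finset.sum_mul, Finset.sum_mul]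
  refine Finset.sum_congr rfl fun j _ => ?_
  unfold cor
  field_simp

lemma rav_meas {a β ℓ : ℝ} (ha : 0 < a) (n : ℕ) : Measurable (fun ω : Om n => rav n a β (YY ℓ ⟨n, ω⟩)) :=
  meas_av a β ℓ RR_PG.1

lemma m2_meas {a β ℓ : ℝ} (n : ℕ) : Measurable (fun ω : Om n => m2 a β ℓ ⟨n, ω⟩) := by
  rcases Nat.eq_zero_or_pos n with h | hn
  · subst h
    have : (fun ω : Om 0 => m2 a β ℓ ⟨0, ω⟩) = fun _ => 0 := by funext ω; simp [m2]
    rw [this]; exact measurable_const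
  · simp only [m2_cor hn]
    refine Measurable.div_const ?_ _
    refine Finset.measurable_sum _ fun i _ => Finset.measurable_sum _ fun j _ => ?_
    refine Measurable.mul ?_ (cor_meas a β ℓ i j)
    fun_prop

lemma q2_meas {a β ℓ : ℝ} (n : ℕ) : Measurable (fun ω : Om n => q2 a β ℓ ⟨n, ω⟩) := by
  have h : Measurable (fun ω : Om n => ∑ i, ∑ j, cor a β ℓ i j ω ^ 2) := Finset.measurable_sum _ fun i _ => Finset.measurable_sum _ fun j _ => (cor_meas a β ℓ i j).pow_const 2
  exact h.div_const ((n:ℝ)^2)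

lemma q2_nonneg {a β ℓ : ℝ} (p : PP) : 0 ≤ q2 a β ℓ p := by unfold q2; positivity

lemma q2_le {a β ℓ : ℝ} (ha : 0 < a) {n : ℕ} (hn : 0 < n) (ω : Om n) :
    q2 a β ℓ ⟨n, ω⟩ ≤ R2 a β ℓ ⟨n, ω⟩ := by
  have hnr : (0:ℝ) < n := by exact_mod_cast hn
  unfold q2
  rw [div_le_iff₀ (by positivity), mul_comm, ← cor2_sum ha hn]
  exact Finset.sum_le_sum fun i _ => Finset.sum_le_sum fun j _ => cor_sq_le ha hn i j ω

lemma rav_sq_le {a β ℓ : ℝ} (ha : 0 < a) {n : ℕ} (hn : 0 < n) (ω : Om n) :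
    rav n a β (YY ℓ ⟨n, ω⟩) ^ 2 ≤ R2 a β ℓ ⟨n, ω⟩ := sq_av_le hn ha RR_PG

lemma m2_sq_le {a β ℓ : ℝ} (ha : 0 < a) {n : ℕ} (hn : 0 < n) (ω : Om n) :
    m2 a β ℓ ⟨n, ω⟩ ^ 2 ≤ R2 a β ℓ ⟨n, ω⟩ * SS ⟨n, ω⟩ ^2 := by
  have hnr : (0:ℝ) < n := by exact_mod_cast hn
  have h0 := m2_nonneg (a := a) (β := β) (ℓ := ℓ) ha (p := ⟨n, ω⟩) hn
  have h1 : m2 a β ℓ ⟨n, ω⟩ ≤ SS ⟨n, ω⟩ * rav n a β (YY ℓ ⟨n, ω⟩) := by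
    unfold m2 SS
    have := (Mat_one_bound hn ha (β := β) (Y := YY ℓ ⟨n, ω⟩) ω.1).2
    rw [div_mul_eq_mul_div]
    exact div_le_div_of_nonneg_right this hnr.le
  calc _ ≤ (SS ⟨n, ω⟩ * rav n a β (YY ℓ ⟨n, ω⟩))^2 := pow_le_pow_left₀ h0 h1 2
    _ = rav n a β (YY ℓ ⟨n, ω⟩)^2 * SS ⟨n, ω⟩ ^2 := by ring
    _ ≤ _ := mul_le_mul_of_nonneg_right (rav_sq_le ha hn ω) (sq_nonneg _)

lemma quad_int {a β : ℝ} {n : ℕ} (hn : 0 < n) (ha : 0 < a) (Y M : Matrix (Fin n) (Fin n) ℝ) :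
    ∫ x, x ⬝ᵥ M *ᵥ x ∂gY n a β Y = ∑ i, ∑ j, M i j * ∫ x, x i * x j ∂gY n a β Y := by
  have hxx : ∀ i j : Fin n, Integrable (fun x => M i j * (x i * x j)) (gY n a β Y) := fun i j =>
    ((PG_xx i j).intY hn ha β _).const_mul _
  simp only [← integral_const_mul]
  rw [Finset.sum_congr rfl fun i _ => (integral_finset_sum (s := Finset.univ)
      (f := fun (j : Fin n) (x : Fin n → ℝ) => M i j * (x i * x j)) fun j _ => hxx i j).symm,
      ← integral_finset_sum _ fun i _ => integrable_finset_sum _ fun j _ => hxx i j]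
  congr 1
  funext x
  simp only [dotProduct, mulVec]
  refine Finset.sum_congr rfl fun i _ => ?_
  rw [Finset.mul_sum]
  exact Finset.sum_congr rfl fun j _ => by ring

lemma pointwise_id {a β ℓ : ℝ} (ha : 0 < a) {n : ℕ} (hn : 0 < n) (ω : Om n) (hs : ω.2ᵀ = ω.2) :
    β * rav n a β (YY ℓ ⟨n, ω⟩) - a * ℓ * m2 a β ℓ ⟨n, ω⟩ + a^2 * q2 a β ℓ ⟨n, ω⟩ =
    1 + ∑ i, ∑ j, (a / (n * √n) * (ω.2 i j * cor a β ℓ i j ω) -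
      a^2/(n:ℝ)^2 * (cor2 a β ℓ i j ω - cor a β ℓ i j ω^2)) := by
  have hnr : (0:ℝ) < n := by exact_mod_cast hn
  have h := xtrace hn ha (β := β) (YY_symm (p := ⟨n, ω⟩) hs ℓ)
  have hxx : ∀ i j : Fin n, Integrable (fun x => x i * x j) (gY n a β (YY ℓ ⟨n, ω⟩)) := fun i j =>
    (PG_xx i j).intY hn ha β _
  have e1 : ∫ x, x ⬝ᵥ YY ℓ ⟨n, ω⟩ *ᵥ x ∂gY n a β (YY ℓ ⟨n, ω⟩) =
      ∑ i, ∑ j, YY ℓ ⟨n, ω⟩ i j * cor a β ℓ i j ω := by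
    exact quad_int hn ha _ _
  rw [e1] at h
  have e2 : ∑ i, ∑ j, YY ℓ ⟨n, ω⟩ i j * cor a β ℓ i j ω =
      ℓ * n * m2 a β ℓ ⟨n, ω⟩ + 1/√n * ∑ i, ∑ j, ω.2 i j * cor a β ℓ i j ω := by
    rw [m2_cor hn]
    have : ℓ * n * ((∑ i, ∑ j, ω.1 i * ω.1 j * cor a β ℓ i j ω) / (n:ℝ)^2) =
       ℓ / n * (∑ i, ∑ j, ω.1 i * ω.1 j * cor a β ℓ i j ω) := by field_simp
    rw [this]
    simp only [Finset.mul_sum, ← Finset.sum_add_distrib]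
    refine Finset.sum_congr rfl fun i _ => Finset.sum_congr rfl fun j _ => ?_
    unfold YY WW
    simp only [Matrix.add_apply, Matrix.smul_apply, vecMulVec_apply, smul_eq_mul]
    ring
  rw [e2] at h
  simp only [Finset.sum_sub_distrib, ← Finset.mul_sum]
  rw [cor2_sum ha hn]
  change 1 = β * rav n a β (YY ℓ ⟨n, ω⟩) - _ + a^2 * R2 a β ℓ ⟨n, ω⟩ at h
  have e3 : q2 a β ℓ ⟨n, ω⟩ = (∑ i, ∑ j, cor a β ℓ i j ω ^2) / (n:ℝ)^2 := rfl
  rw [e3]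
  generalize (∑ i, ∑ j, cor a β ℓ i j ω ^2) = A at *
  generalize (∑ i, ∑ j, ω.2 i j * cor a β ℓ i j ω) = B at *
  have hsq : 0 < √(n:ℝ) := Real.sqrt_pos.2 hnr
  have e4 : a * ((ℓ * n * m2 a β ℓ ⟨n, ω⟩ + 1/√n * B)/n) = a * ℓ * m2 a β ℓ ⟨n, ω⟩ + a / (n * √n) * B := by
    field_simp
  have e5 : a^2/(n:ℝ)^2 * ((n:ℝ)^2 * R2 a β ℓ ⟨n, ω⟩ - A) = a^2 * R2 a β ℓ ⟨n, ω⟩ - a^2 * (A / (n:ℝ)^2) := by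
    field_simp
  rw [e4] at h
  rw [e5]
  linarith

lemma int_of_sq {α : Type*} [MeasurableSpace α] {μ : Measure α} [IsProbabilityMeasure μ] {f : α → ℝ}
    (hf : Measurable f) (h : Integrable (fun x => f x ^2) μ) : Integrable f μ := by
  refine ((integrable_const 1).add h).mono' hf.aestronglyMeasurable (Eventually.of_forall fun Z => ?_)
  simp only [Pi.add_apply, Real.norm_eq_abs]
  rw [← sq_abs]
  nlinarith [sq_nonneg (|f Z| - 1), abs_nonneg (f Z)]

section
variable {a β ℓ : ℝ} (ha : 0 < a) (hβ : 0 ≤ β) (hℓ : 0 ≤ ℓ)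
include ha hβ hℓ

lemma slice_id {n : ℕ} (hn : 0 < n) (s : Fin n → ℝ) :
    ∫ Z, (β * rav n a β (YY ℓ ⟨n, (s, Z)⟩) - a * ℓ * m2 a β ℓ ⟨n, (s, Z)⟩ + a^2 * q2 a β ℓ ⟨n, (s, Z)⟩)
      ∂(noiseMeasure n) = 1 := by
  have hnr : (0:ℝ) < n := by exact_mod_cast hn
  have e : ∫ Z, (β * rav n a β (YY ℓ ⟨n, (s, Z)⟩) - a * ℓ * m2 a β ℓ ⟨n, (s, Z)⟩ + a^2 * q2 a β ℓ ⟨n, (s, Z)⟩)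
      ∂(noiseMeasure n) = ∫ Z, (1 + ∑ i, ∑ j, (a / (n * √n) * (Z i j * cor a β ℓ i j (s, Z)) -
      a^2/(n:ℝ)^2 * (cor2 a β ℓ i j (s, Z) - cor a β ℓ i j (s, Z)^2))) ∂(noiseMeasure n) := by
    refine integral_congr_ae ?_
    filter_upwards [noise_ae_symm n] with Z hZ
    exact pointwise_id ha hn (s, Z) hZ
  rw [e]
  have i0 : ∀ i j : Fin n, Integrable (fun Z => cor2 a β ℓ i j (s, Z) - cor a β ℓ i j (s, Z)^2) (noiseMeasure n) :=
    fun i j => (cor2_slice ha hβ hℓ hn s i j).sub (corsq_slice ha hβ hℓ hn s i j)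
  have i1 : ∀ i j : Fin n, Integrable (fun Z => a / (n * √n) * (Z i j * cor a β ℓ i j (s, Z)) -
      a^2/(n:ℝ)^2 * (cor2 a β ℓ i j (s, Z) - cor a β ℓ i j (s, Z)^2)) (noiseMeasure n) := fun i j =>
    ((zcor_slice ha hβ hℓ hn s i j).const_mul _).sub ((i0 i j).const_mul _)
  rw [integral_add (integrable_const _) (integrable_finset_sum _ fun i _ => integrable_finset_sum _ fun j _ => i1 i j),
    integral_finset_sum _ fun i _ => integrable_finset_sum _ fun j _ => i1 i j]
  simp only [integral_const, probReal_univ, one_smul]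
  rw [Finset.sum_eq_zero, add_zero]
  intro i _
  rw [integral_finset_sum _ fun j _ => i1 i j]
  refine Finset.sum_eq_zero fun j _ => ?_
  rw [integral_sub ((zcor_slice ha hβ hℓ hn s i j).const_mul _) ((i0 i j).const_mul _), integral_const_mul,
    integral_const_mul, zibp ha hβ hℓ hn s i j, ← mul_assoc]
  have : a / (n * √(n:ℝ)) * (a / √n) = a^2/(n:ℝ)^2 := by
    have h2 : √(n:ℝ) * √n = n := Real.mul_self_sqrt hnr.le
    rw [div_mul_div_comm, mul_assoc, h2]; ring
  rw [this, sub_self]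

lemma rav_sq_int (sig : ℝ) {n : ℕ} (hn : 0 < n) :
    Integrable (fun ω : Om n => rav n a β (YY ℓ ⟨n, ω⟩)^2) (mu sig n) := by
  refine full_int ha hβ hℓ sig hn ((rav_meas ha n).pow_const 2) 1 zero_le_one fun ω => ?_
  rw [abs_of_nonneg (sq_nonneg _), one_mul]
  have := rav_sq_le (β := β) (ℓ := ℓ) ha hn ω
  nlinarith [mul_nonneg (R2_nonneg (a := a) (β := β) (ℓ := ℓ) ⟨n, ω⟩) (sq_nonneg (SS ⟨n, ω⟩))]

lemma m2_sq_int (sig : ℝ) {n : ℕ} (hn : 0 < n) :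
    Integrable (fun ω : Om n => m2 a β ℓ ⟨n, ω⟩^2) (mu sig n) := by
  refine full_int ha hβ hℓ sig hn ((m2_meas n).pow_const 2) 1 zero_le_one fun ω => ?_
  rw [abs_of_nonneg (sq_nonneg _), one_mul]
  have := m2_sq_le (β := β) (ℓ := ℓ) ha hn ω
  nlinarith [R2_nonneg (a := a) (β := β) (ℓ := ℓ) ⟨n, ω⟩]

lemma q2_int (sig : ℝ) {n : ℕ} (hn : 0 < n) :
    Integrable (fun ω : Om n => q2 a β ℓ ⟨n, ω⟩) (mu sig n) := by
  refine full_int ha hβ hℓ sig hn (q2_meas n) 1 zero_le_one fun ω => ?_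
  rw [abs_of_nonneg (q2_nonneg _), one_mul]
  have := q2_le (β := β) (ℓ := ℓ) ha hn ω
  nlinarith [mul_nonneg (R2_nonneg (a := a) (β := β) (ℓ := ℓ) ⟨n, ω⟩) (sq_nonneg (SS ⟨n, ω⟩))]

lemma full_id (sig : ℝ) {n : ℕ} (hn : 0 < n) :
    β * ∫ ω, rav n a β (YY ℓ ⟨n, ω⟩) ∂(mu sig n) - a * ℓ * ∫ ω, m2 a β ℓ ⟨n, ω⟩ ∂(mu sig n) +
      a^2 * ∫ ω, q2 a β ℓ ⟨n, ω⟩ ∂(mu sig n) = 1 := by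
  have i1 := int_of_sq (rav_meas ha n) (rav_sq_int ha hβ hℓ sig hn)
  have i2 := int_of_sq (m2_meas n) (m2_sq_int ha hβ hℓ sig hn)
  have i3 := q2_int ha hβ hℓ sig hn
  have i12 : Integrable (fun ω : Om n => β * rav n a β (YY ℓ ⟨n, ω⟩) - a * ℓ * m2 a β ℓ ⟨n, ω⟩) (mu sig n) :=
    (i1.const_mul β).sub (i2.const_mul (a * ℓ))
  have i4 : Integrable (fun ω : Om n => β * rav n a β (YY ℓ ⟨n, ω⟩) - a * ℓ * m2 a β ℓ ⟨n, ω⟩ +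
     a^2 * q2 a β ℓ ⟨n, ω⟩) (mu sig n) := i12.add (i3.const_mul (a^2))
  have e := integral_prod _ (show Integrable _ ((gaussPrior n (sig^2)).prod (noiseMeasure n)) from i4)
  simp only [slice_id ha hβ hℓ hn] at e
  change ∫ ω : Om n, _ ∂(mu sig n) = _ at e
  rw [integral_add i12 (i3.const_mul (a^2)), integral_sub (i1.const_mul β) (i2.const_mul (a*ℓ)),
    integral_const_mul, integral_const_mul, integral_const_mul] at e
  rw [e]; simp

end
end

section

lemma SS_meas (n : ℕ) : Measurable (fun ω : Om n => SS ⟨n, ω⟩) := by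
  have h : Measurable (fun ω : Om n => ∑ i, ω.1 i * ω.1 i) :=
    Finset.measurable_sum _ fun i _ => by fun_prop
  exact h.div_const (n:ℝ)

lemma gibbs_cor {sig' lam lam' : ℝ} (hs : 0 < sig') (hl : 0 < lam) (hl' : 0 < lam') {n : ℕ} (hn : 0 < n)
    (ω : Om n) (i j : Fin n) :
    gibbsMatrix n sig' lam' (obs n lam ω.1 ω.2) i j = cor (√lam') (1/sig'^2) (√lam) i j ω := by
  have hnr : (0:ℝ) < n := by exact_mod_cast hn
  unfold gibbsMatrix cor
  rw [of_apply, gibbs_eq hs hl']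
  unfold gY
  have e1 : BB n sig' lam' (obs n lam ω.1 ω.2) =
      (1/sig'^2) • (1 : Matrix (Fin n) (Fin n) ℝ) - √lam' • YY (√lam) ⟨n, ω⟩ := by
    unfold BB obs YY WW
    congr 1
    ext k l
    have h2 : √(n:ℝ) * √n = n := Real.mul_self_sqrt hnr.le
    have h3 : √lam' / √n * (√lam / √n) = √lam' * (√lam / n) := by
      rw [div_mul_div_comm, h2]; ring
    simp only [Matrix.add_apply, Matrix.smul_apply, vecMulVec_apply, smul_eq_mul,
      Real.sqrt_div hl.le, Real.sqrt_div hl'.le]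
    have : √lam' / √n * (√lam / √n * (ω.1 k * ω.1 l) + ω.2 k l) =
      (√lam' / √n * (√lam / √n)) * (ω.1 k * ω.1 l) + √lam' / √n * ω.2 k l := by ring
    rw [this, h3]; ring
  rw [e1, Real.sq_sqrt hl'.le]

lemma frob_id {sig' lam lam' : ℝ} (hs : 0 < sig') (hl : 0 < lam) (hl' : 0 < lam') {n : ℕ} (hn : 0 < n)
    (ω : Om n) :
    1/(n:ℝ)^2 * frobSq (vecMulVec ω.1 ω.1 - gibbsMatrix n sig' lam' (obs n lam ω.1 ω.2)) =
      SS ⟨n, ω⟩^2 - 2 * m2 (√lam') (1/sig'^2) (√lam) ⟨n, ω⟩ + q2 (√lam') (1/sig'^2) (√lam) ⟨n, ω⟩ := by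
  have hnr : (0:ℝ) < n := by exact_mod_cast hn
  rw [m2_cor hn]
  unfold frobSq SS q2
  simp only [Matrix.sub_apply, gibbs_cor hs hl hl' hn, vecMulVec_apply]
  have e : ∀ i j : Fin n, (ω.1 i * ω.1 j - cor (√lam') (1/sig'^2) (√lam) i j ω)^2 =
     (ω.1 i * ω.1 i) * (ω.1 j * ω.1 j) - 2 * (ω.1 i * ω.1 j * cor (√lam') (1/sig'^2) (√lam) i j ω)
      + cor (√lam') (1/sig'^2) (√lam) i j ω^2 := fun i j => by ring
  simp only [e, Finset.sum_add_distrib, Finset.sum_sub_distrib, ← Finset.mul_sum, ← Finset.sum_mul]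
  unfold dotProduct
  field_simp

lemma TT_ge_SS (p : PP) : (SS p ^2)^2 ≤ TT p := by
  unfold TT
  have h1 : 0 ≤ ZB p.2.2 ^ 4 := by positivity
  have h2 : (0:ℝ) ≤ (p.1 : ℝ)^4 * (Uset (1 / √(p.1 : ℝ)) 3 1 (0 : Fin p.1 → ℝ))ᶜ.indicator (fun _ => (1:ℝ)) p.2.2 :=
    mul_nonneg (by positivity) (Set.indicator_nonneg (fun _ _ => zero_le_one) _)
  nlinarith

lemma SS_sq_int (sig : ℝ) {n : ℕ} (hn : 0 < n) :
    Integrable (fun ω : Om n => (SS ⟨n, ω⟩^2)^2) (mu sig n) := by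
  obtain ⟨C', h1, -⟩ := TT_int sig
  refine (h1 n hn).mono' (((SS_meas n).pow_const 2).pow_const 2).aestronglyMeasurable
    (Eventually.of_forall fun ω => ?_)
  rw [Real.norm_of_nonneg (by positivity)]
  exact TT_ge_SS _

lemma mu_ae_symm (sig : ℝ) (n : ℕ) : ∀ᵐ ω ∂(mu sig n), ω.2ᵀ = ω.2 := by
  unfold mu
  exact Measure.quasiMeasurePreserving_snd.ae (noise_ae_symm n)

lemma bound_TT (sig C0 : ℝ) (hC0 : 0 ≤ C0) (X : PP → ℝ)
    (hi : ∀ n, 0 < n → Integrable (fun ω : Om n => X ⟨n, ω⟩) (mu sig n))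
    (hb : ∀ n, 0 < n → ∀ ω : Om n, ω.2ᵀ = ω.2 → X ⟨n, ω⟩ ≤ C0 * TT ⟨n, ω⟩) :
    ∃ C, ∀ᶠ n in atTop, ∫ ω : Om n, X ⟨n, ω⟩ ∂(mu sig n) ≤ C := by
  obtain ⟨C', h1, h2⟩ := TT_int sig
  refine ⟨C0 * C', ?_⟩
  filter_upwards [h2, eventually_gt_atTop 0] with n hn hn0
  calc ∫ ω : Om n, X ⟨n, ω⟩ ∂(mu sig n) ≤ ∫ ω : Om n, C0 * TT ⟨n, ω⟩ ∂(mu sig n) := by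
        refine integral_mono_ae (hi n hn0) ((h1 n hn0).const_mul C0) ?_
        filter_upwards [mu_ae_symm sig n] with ω hω
        exact hb n hn0 ω hω
    _ = C0 * ∫ ω : Om n, TT ⟨n, ω⟩ ∂(mu sig n) := integral_const_mul _ _
    _ ≤ _ := mul_le_mul_of_nonneg_left hn hC0

lemma MSE_eq {sig' lam lam' : ℝ} (sig : ℝ) (hs : 0 < sig') (hl : 0 < lam) (hl' : 0 < lam') {n : ℕ} (hn : 0 < n) :
    MSE n sig sig' lam lam' = ∫ ω : Om n, SS ⟨n, ω⟩^2 ∂(mu sig n)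
      - 2 * ∫ ω : Om n, m2 (√lam') (1/sig'^2) (√lam) ⟨n, ω⟩ ∂(mu sig n)
      + (1 - 1/sig'^2 * ∫ ω : Om n, rav n (√lam') (1/sig'^2) (YY (√lam) ⟨n, ω⟩) ∂(mu sig n)
        + √lam' * √lam * ∫ ω : Om n, m2 (√lam') (1/sig'^2) (√lam) ⟨n, ω⟩ ∂(mu sig n)) / lam' := by
  have ha : 0 < √lam' := Real.sqrt_pos.2 hl'
  have hβ : 0 ≤ 1/sig'^2 := by positivity
  have hℓ : 0 ≤ √lam := Real.sqrt_nonneg _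
  have h := full_id ha hβ hℓ sig hn
  rw [Real.sq_sqrt hl'.le] at h
  have i1 := int_of_sq ((SS_meas n).pow_const 2) (SS_sq_int sig hn)
  have i2 := int_of_sq (m2_meas n) (m2_sq_int ha hβ hℓ sig hn)
  have i3 := q2_int ha hβ hℓ sig hn
  have i12 : Integrable (fun ω : Om n => SS ⟨n, ω⟩^2 - 2 * m2 (√lam') (1/sig'^2) (√lam) ⟨n, ω⟩) (mu sig n) :=
    i1.sub (i2.const_mul 2)
  have e : MSE n sig sig' lam lam' = ∫ ω : Om n, (SS ⟨n, ω⟩^2 - 2 * m2 (√lam') (1/sig'^2) (√lam) ⟨n, ω⟩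
      + q2 (√lam') (1/sig'^2) (√lam) ⟨n, ω⟩) ∂(mu sig n) := by
    unfold MSE
    rw [← integral_const_mul]
    exact integral_congr_ae (Eventually.of_forall fun ω => frob_id hs hl hl' hn ω)
  rw [e, integral_add i12 i3, integral_sub i1 (i2.const_mul 2), integral_const_mul]
  have : ∫ ω : Om n, q2 (√lam') (1/sig'^2) (√lam) ⟨n, ω⟩ ∂(mu sig n) =
    (1 - 1/sig'^2 * ∫ ω : Om n, rav n (√lam') (1/sig'^2) (YY (√lam) ⟨n, ω⟩) ∂(mu sig n)
        + √lam' * √lam * ∫ ω : Om n, m2 (√lam') (1/sig'^2) (√lam) ⟨n, ω⟩ ∂(mu sig n)) / lam' := by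
    rw [eq_div_iff hl'.ne']
    linarith
  rw [this]

lemma MSE_lim {sig sig' lam lam' ρ m : ℝ} (hsig : 0 < sig) (hs : 0 < sig') (hl : 0 < lam) (hl' : 0 < lam')
    (h1 : Tendsto (fun p : PP => rav p.1 (√lam') (1/sig'^2) (YY (√lam) p)) (PF sig) (nhds ρ))
    (h2 : Tendsto (fun p : PP => m2 (√lam') (1/sig'^2) (√lam) p) (PF sig) (nhds m)) :
    Tendsto (fun n => MSE n sig sig' lam lam') atTop
      (nhds ((sig^2)^2 - 2 * m + (1 - 1/sig'^2 * ρ + √lam' * √lam * m)/lam')) := by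
  have ha : 0 < √lam' := Real.sqrt_pos.2 hl'
  have hβ : 0 ≤ 1/sig'^2 := by positivity
  have hℓ : 0 ≤ √lam := Real.sqrt_nonneg _
  have hC0 : 0 ≤ (100 + 10 * √lam^2)/√lam'^2 := by positivity
  obtain ⟨C1, hC1⟩ := bound_TT sig 1 zero_le_one (fun p => (SS p^2)^2) (fun n hn => SS_sq_int sig hn)
    (fun n hn ω hω => by rw [one_mul]; exact TT_ge_SS _)
  obtain ⟨C2, hC2⟩ := bound_TT sig _ hC0 (fun p => rav p.1 (√lam') (1/sig'^2) (YY (√lam) p)^2)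
    (fun n hn => rav_sq_int ha hβ hℓ sig hn)
    (fun n hn ω hω => (rav_sq_le ha hn ω).trans (R2_le_TT' ha hβ hℓ (p := ⟨n, ω⟩) hn hω))
  obtain ⟨C3, hC3⟩ := bound_TT sig _ hC0 (fun p => m2 (√lam') (1/sig'^2) (√lam) p^2)
    (fun n hn => m2_sq_int ha hβ hℓ sig hn)
    (fun n hn ω hω => (m2_sq_le ha hn ω).trans (le_trans (by
      nlinarith [R2_nonneg (a := √lam') (β := 1/sig'^2) (ℓ := √lam) ⟨n, ω⟩]) (R2_le_TT ha hβ hℓ (p := ⟨n, ω⟩) hn hω)))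
  have L1 := PF_lim_integral (fun p => SS p^2) ((PF_normS sig hsig).pow 2) (fun n => (SS_meas n).pow_const 2)
    ((eventually_gt_atTop 0).mono fun n hn => SS_sq_int sig hn) hC1
  have L2 := PF_lim_integral _ h1 (fun n => rav_meas ha n)
    ((eventually_gt_atTop 0).mono fun n hn => rav_sq_int ha hβ hℓ sig hn) hC2
  have L3 := PF_lim_integral _ h2 (fun n => m2_meas n)
    ((eventually_gt_atTop 0).mono fun n hn => m2_sq_int ha hβ hℓ sig hn) hC3
  have L := (L1.sub (L3.const_mul 2)).add
    ((((L2.const_mul (1/sig'^2)).const_sub 1).add (L3.const_mul (√lam' * √lam))).div_const lam')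
  refine L.congr' ?_
  filter_upwards [eventually_gt_atTop 0] with n hn
  rw [MSE_eq sig hs hl hl' hn]

lemma final_alg (s ℓ a b : ℝ) (hs : 0 < s) (hℓ : 0 < ℓ) (ha : 0 < a) (hb : 0 < b)
    (hθ : 1 < ℓ * s^2) :
    (s^2)^2 - 2 * (((a * (1/(ℓ*s^2) + 1/(1/(ℓ*s^2))) - 1/b^2)/a^2 - 1/(ℓ*s^2)/a) /
        (ℓ^2 * ((1/(ℓ*s^2))^2/(1-(1/(ℓ*s^2))^2) * s^2)))
      + (1 - 1/b^2 * ((a * (1/(ℓ*s^2) + 1/(1/(ℓ*s^2))) - 1/b^2)/a^2) + a * ℓ *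
       (((a * (1/(ℓ*s^2) + 1/(1/(ℓ*s^2))) - 1/b^2)/a^2 - 1/(ℓ*s^2)/a) /
        (ℓ^2 * ((1/(ℓ*s^2))^2/(1-(1/(ℓ*s^2))^2) * s^2))))/a^2 =
    s^4 * (1 - ℓ/a)^2 + 2/(ℓ*a) + 1/((a^2)^2*b^4) + (2*s^2/(a^2*b^2))*(1-ℓ/a)
      - 2/(ℓ^2*a^2*s^2*b^2) := by
  have h1 : (ℓ*s^2)^2 - 1 ≠ 0 := by nlinarith
  have e : ((a * (1/(ℓ*s^2) + 1/(1/(ℓ*s^2))) - 1/b^2)/a^2 - 1/(ℓ*s^2)/a) /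
        (ℓ^2 * ((1/(ℓ*s^2))^2/(1-(1/(ℓ*s^2))^2) * s^2)) =
      (a*ℓ*s^2*b^2 - 1) * ((ℓ*s^2)^2-1)/(a^2*b^2*ℓ^2*s^2) := by
    have h2 : 1 - (1/(ℓ*s^2))^2 = ((ℓ*s^2)^2-1)/(ℓ*s^2)^2 := by field_simp
    rw [h2]
    field_simp
    ring
  rw [e]
  field_simp
  ring

lemma main_lim {sig sig' lam lam' : ℝ} (hsig : 0 < sig) (hs : 0 < sig') (hl : 0 < lam) (hl' : 0 < lam') :
    Tendsto (fun n => MSE n sig sig' lam lam') atTop (nhds (MSElim sig sig' lam lam')) := by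
  have ha : 0 < √lam' := Real.sqrt_pos.2 hl'
  have hβ : 0 < 1/sig'^2 := by positivity
  have hℓ : 0 < √lam := Real.sqrt_pos.2 hl
  have ea : √lam'^2 = lam' := Real.sq_sqrt hl'.le
  have el : √lam^2 = lam := Real.sq_sqrt hl.le
  have hθ0 : 0 < √lam * sig^2 := by positivity
  have c1 : lam ≤ 1/sig^4 ↔ √lam * sig^2 ≤ 1 := by
    rw [le_div_iff₀ (by positivity), ← abs_of_pos hθ0, ← sq_le_one_iff_abs_le_one, mul_pow, el]
    ring_nf
  have c1' : 1/sig^4 ≤ lam ↔ 1 ≤ √lam * sig^2 := by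
    rw [div_le_iff₀ (by positivity), ← abs_of_pos hθ0, ← one_le_sq_iff_one_le_abs, mul_pow, el]
    ring_nf
  have c2 : 1/sig'^4 ≤ lam' ↔ 1/sig'^2 ≤ √lam' := by
    rw [Real.le_sqrt' hβ, div_pow]
    ring_nf
  have c3 : 1/(sig^2*sig'^2) ≤ √(lam*lam') ↔ 1/sig'^2 ≤ √lam' * (√lam * sig^2) := by
    rw [Real.sqrt_mul hl.le, div_le_iff₀ (by positivity), div_le_iff₀ (by positivity)]
    ring_nf
  unfold MSElim
  simp only [c1, c1', c2, c3]
  rw [Real.sqrt_mul hl.le, Real.sqrt_div hl.le]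
  by_cases A : √lam * sig^2 ≤ 1 ∧ 1/sig'^2 ≤ √lam'
  · rw [if_pos A]
    have hdel := del_lim12 sig (√lam) (√lam') (1/sig'^2) 1 hsig hℓ ha hβ one_pos le_rfl (by linarith [A.2])
      (by linarith [A.1]) (fun ε hε => by
        have := test2 sig (√lam) ε hsig hℓ hε
        norm_num at this ⊢
        exact this)
    have hz : √lam'^2 * ((√lam' * (1+1/1) - 1/sig'^2)/√lam'^2) = √lam' * 2 - 1/sig'^2 := by
      rw [mul_div_cancel₀ _ (by positivity)]; norm_num
    have h := MSE_lim hsig hs hl hl' (rav_lim ha hdel) (m2_lim2 hsig ha hℓ hdel hz A.1)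
    convert h using 2
    generalize √lam' = a at *
    subst ea
    field_simp
    ring
  · rw [if_neg A]
    by_cases B : 1 ≤ √lam * sig^2 ∧ 1/sig'^2 ≤ √lam' * (√lam * sig^2)
    · rw [if_pos B]
      have hθ : 1 < √lam * sig^2 := by
        rcases B.1.lt_or_eq with h | h
        · exact h
        · exact absurd ⟨h.ge, by have := B.2; rw [← h] at this; linarith⟩ A
      have hT : 0 < 1/(√lam * sig^2) := by positivity
      have hT1 : 1/(√lam * sig^2) < 1 := by rw [div_lt_one hθ0]; exact hθ
      have hdel := del_lim12 sig (√lam) (√lam') (1/sig'^2) (1/(√lam * sig^2)) hsig hℓ ha hβ hT hT1.le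
        (by rw [mul_one_div, div_le_iff₀ hθ0]; exact B.2)
        (by rw [mul_one_div_cancel hθ0.ne']) (fun ε hε => by
          have := test1 sig (√lam) ε hsig hℓ hθ hε
          rw [one_div_one_div, add_comm]
          exact this)
      have h := MSE_lim hsig hs hl hl' (rav_lim ha hdel) (m2_lim1 hsig ha hℓ hdel hT hT1
        (mul_div_cancel₀ _ (by positivity)))
      convert h using 2
      have := final_alg sig (√lam) (√lam') sig' hsig hℓ ha hs hθ
      rw [ea, el] at this
      rw [ea, el]
      exact this.symm
    · rw [if_neg B]
      have h1 : √lam' < 1/sig'^2 := by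
        by_contra h
        push Not at h
        have h3 : 1 < √lam * sig^2 := by
          by_contra h4
          exact A ⟨not_lt.1 h4, h⟩
        exact B ⟨h3.le, by nlinarith⟩
      have h2 : √lam' * (√lam * sig^2) < 1/sig'^2 := by
        by_contra h
        push Not at h
        have h3 : √lam * sig^2 < 1 := by
          by_contra h4
          exact B ⟨not_lt.1 h4, h⟩
        nlinarith
      have hdel := del_lim3 sig (√lam) (√lam') (1/sig'^2) hsig hℓ ha hβ h1 h2
      have ht : 0 < √lam' / (1/sig'^2) := by positivity
      have ht1 : √lam' / (1/sig'^2) < 1 := by rw [div_lt_one hβ]; exact h1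
      have h := MSE_lim hsig hs hl hl' (rav_lim ha hdel) (m2_lim3 hsig ha hdel ht ht1
        (by field_simp; ring) (by rw [← mul_div_assoc, div_lt_one hβ]; linarith))
      convert h using 2
      field_simp
      ring

end

/-- Under uniform convergence of `MSE_n` in `(λ,λ')` on a compact
set `K ⊂ ℝ₊²`, the limit of the mismatched matrix-MSE is given by the explicit
formula `MSElim` for all `σ, σ' > 0` and `(λ,λ') ∈ K`. -/
theorem mse_limit_formula (sig sig' : ℝ) (hsig : 0 < sig) (hsig' : 0 < sig')
    (K : Set (ℝ × ℝ)) (hK : IsCompact K) (hKpos : K ⊆ {p : ℝ × ℝ | 0 < p.1 ∧ 0 < p.2})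
    (F : ℝ × ℝ → ℝ)
    (hunif : TendstoUniformlyOn (fun n (p : ℝ × ℝ) => MSE n sig sig' p.1 p.2) F atTop K) :
    ∀ p ∈ K, Tendsto (fun n => MSE n sig sig' p.1 p.2) atTop
      (nhds (MSElim sig sig' p.1 p.2)) := by
  intro p hp
  exact main_lim hsig hsig' (hKpos hp).1 (hKpos hp).2

end
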